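/- arXiv:1105.1979 — 3 statements merged into one kernel-verified Lean document; each statement's English description precedes it below -/
import Mathlib

section
/- Let A be a separable C*-algebra which is the inductive limit of an inductive system (A_k, γ_k) in which every connecting *-homomorphism γ_k : A_k → A_{k+1} is null-homotopic. Then for every C*-algebra D, every semiprojective *-homomorphism φ : D → A is null-homotopic. (This is the implication (d) ⇒ (b) of the paper's main theorem on C*-algebras of trivial shape.) -/
open Filter Topology Set

noncomputable section

universe u v

/-- The iterated connecting morphisms `γ_{k+n,k} : A_k → A_{k+n}` of an inductive system. -/
def iterHom {A : ℕ → Type u} [∀ k, NonUnitalCStarAlgebra (A k)]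
    (γ : ∀ k, A k →⋆ₙₐ[ℂ] A (k + 1)) : ∀ k n : ℕ, A k →⋆ₙₐ[ℂ] A (k + n)
  | _, 0 => NonUnitalStarAlgHom.id ℂ _
  | k, n + 1 => (γ (k + n)).comp (iterHom γ k n)

/-- `(L, μ)` is the inductive limit of the inductive system `(A, γ)` of C*-algebras. -/
structure IsInductiveLimit {A : ℕ → Type u} [∀ k, NonUnitalCStarAlgebra (A k)]
    (γ : ∀ k, A k →⋆ₙₐ[ℂ] A (k + 1)) (L : Type v) [NonUnitalCStarAlgebra L]
    (μ : ∀ k, A k →⋆ₙₐ[ℂ] L) : Prop where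
  compat : ∀ k, (μ (k + 1)).comp (γ k) = μ k
  dense_union : Dense (⋃ k, Set.range (μ k))
  norm_tendsto : ∀ (k : ℕ) (a : A k),
    Tendsto (fun n => ‖iterHom γ k n a‖) atTop (𝓝 ‖μ k a‖)

/-- Two *-homomorphisms are homotopic if they are connected by a path of *-homomorphisms,
i.e. by a *-homomorphism into `C([0,1], B)`. -/
def Homotopic {A : Type u} {B : Type v} [NonUnitalCStarAlgebra A] [NonUnitalCStarAlgebra B]
    (φ ψ : A →⋆ₙₐ[ℂ] B) : Prop :=
  ∃ H : A →⋆ₙₐ[ℂ] C(unitInterval, B), (∀ a, H a 0 = φ a) ∧ (∀ a, H a 1 = ψ a)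

/-- A *-homomorphism is null-homotopic if it is homotopic to the zero morphism. -/
def NullHomotopic {A : Type u} {B : Type v} [NonUnitalCStarAlgebra A] [NonUnitalCStarAlgebra B]
    (φ : A →⋆ₙₐ[ℂ] B) : Prop :=
  Homotopic φ 0

/-- A C*-algebra is contractible if its identity is null-homotopic. -/
def Contractible (A : Type u) [NonUnitalCStarAlgebra A] : Prop :=
  NullHomotopic (NonUnitalStarAlgHom.id ℂ A)

/-- A projective *-homomorphism between C*-algebras. -/
def IsProjectiveMorphism {A B : Type u} [NonUnitalCStarAlgebra A] [NonUnitalCStarAlgebra B]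
    (φ : A →⋆ₙₐ[ℂ] B) : Prop :=
  ∀ (C D : Type u) [NonUnitalCStarAlgebra C] [NonUnitalCStarAlgebra D]
    (π : C →⋆ₙₐ[ℂ] D), Function.Surjective π → ∀ σ : B →⋆ₙₐ[ℂ] D,
    ∃ ψ : A →⋆ₙₐ[ℂ] C, π.comp ψ = σ.comp φ

/-- A projective C*-algebra. -/
def IsProjective (A : Type u) [NonUnitalCStarAlgebra A] : Prop :=
  IsProjectiveMorphism (NonUnitalStarAlgHom.id ℂ A)

/-- A semiprojective *-homomorphism between C*-algebras. -/
def IsSemiprojectiveMorphism {A B : Type u} [NonUnitalCStarAlgebra A] [NonUnitalCStarAlgebra B]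
    (φ : A →⋆ₙₐ[ℂ] B) : Prop :=
  ∀ (C : ℕ → Type u) [∀ k, NonUnitalCStarAlgebra (C k)]
    (δ : ∀ k, C k →⋆ₙₐ[ℂ] C (k + 1)), (∀ k, Function.Surjective (δ k)) →
    ∀ (L : Type u) [NonUnitalCStarAlgebra L] (μ : ∀ k, C k →⋆ₙₐ[ℂ] L),
    IsInductiveLimit δ L μ → ∀ σ : B →⋆ₙₐ[ℂ] L,
    ∃ (k : ℕ) (ψ : A →⋆ₙₐ[ℂ] C k), (μ k).comp ψ = σ.comp φ

/-- A semiprojective C*-algebra. -/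
def IsSemiprojective (A : Type u) [NonUnitalCStarAlgebra A] : Prop :=
  IsSemiprojectiveMorphism (NonUnitalStarAlgHom.id ℂ A)

/-- A weakly semiprojective *-homomorphism between C*-algebras. -/
def IsWeaklySemiprojectiveMorphism {A B : Type u} [NonUnitalCStarAlgebra A]
    [NonUnitalCStarAlgebra B] (φ : A →⋆ₙₐ[ℂ] B) : Prop :=
  ∀ (C : ℕ → Type u) [∀ k, NonUnitalCStarAlgebra (C k)]
    (δ : ∀ k, C k →⋆ₙₐ[ℂ] C (k + 1)), (∀ k, Function.Surjective (δ k)) →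
    ∀ (L : Type u) [NonUnitalCStarAlgebra L] (μ : ∀ k, C k →⋆ₙₐ[ℂ] L),
    IsInductiveLimit δ L μ → ∀ σ : B →⋆ₙₐ[ℂ] L,
    ∀ ε : ℝ, 0 < ε → ∀ F : Finset A,
    ∃ (k : ℕ) (ψ : A →⋆ₙₐ[ℂ] C k), ∀ x ∈ F, ‖μ k (ψ x) - σ (φ x)‖ < ε

/-- A weakly semiprojective C*-algebra. -/
def IsWeaklySemiprojective (A : Type u) [NonUnitalCStarAlgebra A] : Prop :=
  IsWeaklySemiprojectiveMorphism (NonUnitalStarAlgHom.id ℂ A)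

/-- A weakly projective C*-algebra. -/
def IsWeaklyProjective (A : Type u) [NonUnitalCStarAlgebra A] : Prop :=
  ∀ (C D : Type u) [NonUnitalCStarAlgebra C] [NonUnitalCStarAlgebra D]
    (π : C →⋆ₙₐ[ℂ] D), Function.Surjective π → ∀ σ : A →⋆ₙₐ[ℂ] D,
    ∀ ε : ℝ, 0 < ε → ∀ F : Finset A,
    ∃ ψ : A →⋆ₙₐ[ℂ] C, ∀ x ∈ F, ‖π (ψ x) - σ x‖ < ε

/-- `F ⊂_ε G` : every element of `F` is within `ε` of some element of `G`. -/
def EpsContained {A : Type*} [NonUnitalCStarAlgebra A] (ε : ℝ) (F G : Set A) : Prop :=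
  ∀ x ∈ F, ∃ y ∈ G, ‖x - y‖ < ε

/-- A subset of a C*-algebra which is a sub-C*-algebra. -/
def IsCStarSubset {A : Type*} [NonUnitalCStarAlgebra A] (S : Set A) : Prop :=
  IsClosed S ∧ (0 : A) ∈ S ∧ (∀ x ∈ S, ∀ y ∈ S, x + y ∈ S) ∧
    (∀ x ∈ S, ∀ y ∈ S, x * y ∈ S) ∧ (∀ (c : ℂ), ∀ x ∈ S, c • x ∈ S) ∧ ∀ x ∈ S, star x ∈ S

/-- A C*-algebra is finitely generated if some finite subset is contained in no proper
sub-C*-algebra. -/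
def IsFinitelyGeneratedCStar (A : Type*) [NonUnitalCStarAlgebra A] : Prop :=
  ∃ S : Finset A, ∀ T : Set A, IsCStarSubset T → ↑S ⊆ T → T = Set.univ

end
noncomputable section
universe w

/-- A bundled inductive system of C*-algebras. -/
structure CStarInductiveSystem : Type (w + 1) where
  X : ℕ → Type w
  inst : ∀ k, NonUnitalCStarAlgebra (X k)
  conn : ∀ k, X k →⋆ₙₐ[ℂ] X (k + 1)

attribute [instance] CStarInductiveSystem.inst

/-- `A` is (isomorphic to) an inductive limit of projective C*-algebras,
i.e. `A` has trivial shape. -/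
def IsInductiveLimitOfProjectives (A : Type w) [NonUnitalCStarAlgebra A] : Prop :=
  ∃ (S : CStarInductiveSystem.{w}) (μ : ∀ k, S.X k →⋆ₙₐ[ℂ] A),
    IsInductiveLimit S.conn A μ ∧ ∀ k, IsProjective (S.X k)

end

noncomputable section Homotopy

open scoped unitInterval CStarAlgebra

universe u v

/-- Precomposition of paths with a self-map of the unit interval, as a *-homomorphism. -/
def pathReparam (A : Type u) [NonUnitalCStarAlgebra A] (q : C(I, I)) :
    C(I, A) →⋆ₙₐ[ℂ] C(I, A) where
  toFun g := g.comp q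
  map_smul' _ _ := rfl
  map_zero' := rfl
  map_add' _ _ := rfl
  map_mul' _ _ := rfl
  map_star' _ := rfl

/-- Evaluation of paths at a point, as a *-homomorphism. -/
def pathEval (A : Type u) [NonUnitalCStarAlgebra A] (t : I) : C(I, A) →⋆ₙₐ[ℂ] A where
  toFun g := g t
  map_smul' _ _ := rfl
  map_zero' := rfl
  map_add' _ _ := rfl
  map_mul' _ _ := rfl
  map_star' _ := rfl

/-- Composition of paths with a *-homomorphism. -/
def pathMap {A : Type u} {B : Type v} [NonUnitalCStarAlgebra A] [NonUnitalCStarAlgebra B]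
    (f : A →⋆ₙₐ[ℂ] B) : C(I, A) →⋆ₙₐ[ℂ] C(I, B) where
  toFun g := (⟨f, map_continuous f⟩ : C(A, B)).comp g
  map_smul' _ _ := by ext; simp
  map_zero' := by ext; simp
  map_add' _ _ := by ext; simp
  map_mul' _ _ := by ext; simp
  map_star' _ := by ext; simp [map_star]

/-- The map `s ↦ (1 + s) / 2`. -/
def upperHalf : C(I, I) where
  toFun s := ⟨(1 + s) / 2, by constructor <;> linarith [s.2.1, s.2.2]⟩
  continuous_toFun := by fun_prop

/-- The map `s ↦ max (2 s - 1) 0`, a left inverse of `upperHalf`. -/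
def upperHalfRetract : C(I, I) where
  toFun s := ⟨max (2 * s - 1) 0, le_max_right _ _,
    max_le (by linarith [s.2.2]) zero_le_one⟩
  continuous_toFun := by fun_prop

/-- The map `s ↦ min (2 s) 1`. -/
def lowerHalfRamp : C(I, I) where
  toFun s := ⟨min (2 * s) 1, le_min (by linarith [s.2.1]) zero_le_one, min_le_right _ _⟩
  continuous_toFun := by fun_prop

@[simp] lemma upperHalfRetract_upperHalf (s : I) : upperHalfRetract (upperHalf s) = s := by
  apply Subtype.ext
  change max (2 * ((1 + (s : ℝ)) / 2) - 1) 0 = s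
  rw [max_eq_left] <;> linarith [s.2.1]

@[simp] lemma lowerHalfRamp_upperHalf (s : I) : lowerHalfRamp (upperHalf s) = 1 := by
  apply Subtype.ext
  change min (2 * ((1 + (s : ℝ)) / 2)) 1 = 1
  rw [min_eq_right]
  linarith [s.2.1]

@[simp] lemma lowerHalfRamp_zero : lowerHalfRamp 0 = 0 := by
  apply Subtype.ext
  simp [lowerHalfRamp]

@[simp] lemma upperHalf_one : upperHalf 1 = 1 := by
  apply Subtype.ext
  norm_num [upperHalf]

lemma one_sub_upperHalf_iterate_le (m : ℕ) (s : I) :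
    1 - ((upperHalf^[m] s : I) : ℝ) ≤ (1 / 2) ^ m := by
  induction m with
  | zero => simpa using s.2.1
  | succ m ih =>
    rw [Function.iterate_succ_apply']
    change 1 - (1 + ((upperHalf^[m] s : I) : ℝ)) / 2 ≤ _
    rw [pow_succ]
    linarith

lemma dist_upperHalf_iterate_le (m : ℕ) (s : I) : dist (upperHalf^[m] s) 1 ≤ (1 / 2) ^ m := by
  have h := one_sub_upperHalf_iterate_le m s
  rw [Subtype.dist_eq, dist_comm, Real.dist_eq, abs_of_nonneg]
  · exact h
  · simpa using (upperHalf^[m] s).2.2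

lemma tendsto_upperHalf_iterate (s : I) : Tendsto (fun m => upperHalf^[m] s) atTop (𝓝 1) := by
  rw [tendsto_iff_dist_tendsto_zero]
  exact squeeze_zero (fun _ => dist_nonneg) (fun m => dist_upperHalf_iterate_le m s)
    (tendsto_pow_atTop_nhds_zero_of_lt_one (by norm_num) (by norm_num))

lemma exists_forall_norm_upperHalf_iterate_le {A : Type u} [NonUnitalCStarAlgebra A]
    (g : C(I, A)) {c : ℝ} (hc : ‖g 1‖ < c) :
    ∃ N, ∀ m, N ≤ m → ∀ s, ‖g (upperHalf^[m] s)‖ ≤ c := by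
  have h : ∀ᶠ t in 𝓝 (1 : I), ‖g t‖ < c :=
    (map_continuous g).norm.continuousAt.eventually_lt continuousAt_const hc
  obtain ⟨ε, hε, hball⟩ := Metric.eventually_nhds_iff.1 h
  obtain ⟨N, hN⟩ := exists_pow_lt_of_lt_one hε (by norm_num : (1 / 2 : ℝ) < 1)
  refine ⟨N, fun m hm s => (hball ?_).le⟩
  calc dist (upperHalf^[m] s) 1 ≤ (1 / 2) ^ m := dist_upperHalf_iterate_le m s
    _ ≤ (1 / 2) ^ N := pow_le_pow_of_le_one (by norm_num) (by norm_num) hm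
    _ < ε := hN

lemma Homotopic.symm {A : Type u} {B : Type v} [NonUnitalCStarAlgebra A]
    [NonUnitalCStarAlgebra B] {φ ψ : A →⋆ₙₐ[ℂ] B} (h : Homotopic φ ψ) : Homotopic ψ φ := by
  obtain ⟨H, h0, h1⟩ := h
  refine ⟨(pathReparam B ⟨unitInterval.symm, unitInterval.continuous_symm⟩).comp H,
    fun a => ?_, fun a => ?_⟩
  · change H a (unitInterval.symm 0) = ψ a
    rw [unitInterval.symm_zero, h1]
  · change H a (unitInterval.symm 1) = φ a
    rw [unitInterval.symm_one, h0]

lemma Homotopic.trans {A : Type u} {B : Type v} [NonUnitalCStarAlgebra A]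
    [NonUnitalCStarAlgebra B] {φ ψ χ : A →⋆ₙₐ[ℂ] B} (h : Homotopic φ ψ)
    (h' : Homotopic ψ χ) : Homotopic φ χ := by
  obtain ⟨H, h0, h1⟩ := h
  obtain ⟨K, k0, k1⟩ := h'
  let P (a : A) (t : I) : B :=
    if (t : ℝ) ≤ 1 / 2 then H a (lowerHalfRamp t) else K a (upperHalfRetract t)
  have hP (a : A) : Continuous (P a) := by
    refine Continuous.if_le (by fun_prop) (by fun_prop) continuous_subtype_val
      continuous_const fun t ht => ?_
    have e1 : lowerHalfRamp t = 1 := by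
      apply Subtype.ext
      simp [lowerHalfRamp, ht]
    have e2 : upperHalfRetract t = 0 := by
      apply Subtype.ext
      simp [upperHalfRetract, ht]
    rw [e1, e2, h1, k0]
  refine ⟨{ toFun := fun a => ⟨P a, hP a⟩
            map_smul' := fun c a => ?_
            map_zero' := ?_
            map_add' := fun a b => ?_
            map_mul' := fun a b => ?_
            map_star' := fun a => ?_ }, fun a => ?_, fun a => ?_⟩
  any_goals
    ext t
    by_cases ht : (t : ℝ) ≤ 1 / 2 <;>
      simp only [ContinuousMap.coe_mk, P, ht, if_true, if_false] <;>
      simp [P, ht, map_star, -one_div]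
  · change P a 0 = φ a
    simp [P, h0]
  · change P a 1 = χ a
    have e : upperHalfRetract 1 = 1 := by
      simpa using upperHalfRetract_upperHalf 1
    have : ¬ ((1 : ℝ) ≤ 1 / 2) := by norm_num
    simp [P, e, k1, -one_div, this]

lemma NullHomotopic.comp_left {A : Type u} {B : Type v} {C : Type*} [NonUnitalCStarAlgebra A]
    [NonUnitalCStarAlgebra B] [NonUnitalCStarAlgebra C] {φ : A →⋆ₙₐ[ℂ] B} (h : NullHomotopic φ)
    (χ : B →⋆ₙₐ[ℂ] C) : NullHomotopic (χ.comp φ) := by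
  obtain ⟨H, h0, h1⟩ := h
  refine ⟨(pathMap χ).comp H, fun a => ?_, fun a => ?_⟩
  · simp [pathMap, h0]
  · simp [pathMap, h1]

lemma NullHomotopic.comp_right {A : Type u} {B : Type v} {C : Type*} [NonUnitalCStarAlgebra A]
    [NonUnitalCStarAlgebra B] [NonUnitalCStarAlgebra C] {φ : A →⋆ₙₐ[ℂ] B} (h : NullHomotopic φ)
    (χ : C →⋆ₙₐ[ℂ] A) : NullHomotopic (φ.comp χ) := by
  obtain ⟨H, h0, h1⟩ := h
  exact ⟨H.comp χ, fun a => h0 _, fun a => h1 _⟩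

end Homotopy

noncomputable section Telescope

open scoped unitInterval CStarAlgebra ENNReal

universe u

lemma comp_iterHom {A : ℕ → Type u} [∀ k, NonUnitalCStarAlgebra (A k)]
    {γ : ∀ k, A k →⋆ₙₐ[ℂ] A (k + 1)} {L : Type*} [NonUnitalCStarAlgebra L]
    {μ : ∀ k, A k →⋆ₙₐ[ℂ] L} (h : ∀ k, (μ (k + 1)).comp (γ k) = μ k) (k m : ℕ) (a : A k) :
    μ (k + m) (iterHom γ k m a) = μ k a := by
  induction m with
  | zero => rfl
  | succ m ih =>
    rw [← ih, ← h (k + m)]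
    rfl

/-- The elements on which the norms in an inductive system converge to a given seminorm form a
closed set. -/
lemma isClosed_setOf_tendsto_norm_iterHom {A : ℕ → Type u} [∀ k, NonUnitalCStarAlgebra (A k)]
    (γ : ∀ k, A k →⋆ₙₐ[ℂ] A (k + 1)) (k : ℕ) {L : Type*} [NonUnitalCStarAlgebra L]
    (μ : A k →⋆ₙₐ[ℂ] L) :
    IsClosed {a : A k | Tendsto (fun m => ‖iterHom γ k m a‖) atTop (𝓝 ‖μ a‖)} := by
  refine isClosed_of_closure_subset fun a ha => Metric.tendsto_atTop.2 fun ε hε => ?_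
  obtain ⟨b, hb, hab⟩ := Metric.mem_closure_iff.1 ha (ε / 3) (by positivity)
  obtain ⟨N, hN⟩ := Metric.tendsto_atTop.1 hb (ε / 3) (by positivity)
  refine ⟨N, fun m hm => ?_⟩
  have hm := hN m hm
  have h1 : |‖iterHom γ k m a‖ - ‖iterHom γ k m b‖| ≤ ‖a - b‖ := by
    refine (abs_norm_sub_norm_le _ _).trans ?_
    rw [← map_sub]
    exact NonUnitalStarAlgHom.norm_apply_le _ _
  have h2 : |‖μ a‖ - ‖μ b‖| ≤ ‖a - b‖ := by
    refine (abs_norm_sub_norm_le _ _).trans ?_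
    rw [← map_sub]
    exact NonUnitalStarAlgHom.norm_apply_le _ _
  rw [dist_eq_norm] at hab
  rw [Real.dist_eq, abs_lt] at hm ⊢
  rw [abs_le] at h1 h2
  constructor <;> linarith [h1.1, h1.2, h2.1, h2.2, hm.1, hm.2]

variable {Ak : ℕ → Type u} [∀ k, NonUnitalCStarAlgebra (Ak k)]

/-- Restriction of a bounded sequence indexed by `j ≥ n` to the indices `j ≥ n + 1`. -/
def lpTail (Ak : ℕ → Type u) [∀ k, NonUnitalCStarAlgebra (Ak k)] (n : ℕ) :
    lp (fun j : Ici n => Ak j) ∞ →⋆ₙₐ[ℂ] lp (fun j : Ici (n + 1) => Ak j) ∞ where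
  toFun a := ⟨fun j => a ⟨j, Nat.le_of_succ_le j.2⟩, memℓp_infty ⟨‖a‖, by
    rintro _ ⟨j, rfl⟩
    exact lp.norm_apply_le_norm ENNReal.top_ne_zero a _⟩⟩
  map_smul' _ _ := rfl
  map_zero' := rfl
  map_add' _ _ := rfl
  map_mul' _ _ := rfl
  map_star' _ := rfl

/-- Evaluation of a bounded sequence at an index. -/
def lpEval {ι : Type*} (E : ι → Type u) [∀ k, NonUnitalCStarAlgebra (E k)] (i : ι) :
    lp E ∞ →⋆ₙₐ[ℂ] E i where
  toFun a := a i
  map_smul' _ _ := rfl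
  map_zero' := rfl
  map_add' _ _ := rfl
  map_mul' _ _ := rfl
  map_star' _ := rfl

/-- Extension by zero of a bounded sequence indexed by `j ≥ n + 1` to the indices `j ≥ n`. -/
def lpExtend (Ak : ℕ → Type u) [∀ k, NonUnitalCStarAlgebra (Ak k)] (n : ℕ) :
    lp (fun j : Ici (n + 1) => Ak j) ∞ →+ lp (fun j : Ici n => Ak j) ∞ where
  toFun a := ⟨fun j => if h : n + 1 ≤ j then a ⟨j, h⟩ else 0, memℓp_infty ⟨‖a‖, by
    rintro _ ⟨j, rfl⟩
    dsimp only
    split_ifs with h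
    · exact lp.norm_apply_le_norm ENNReal.top_ne_zero a _
    · simp⟩⟩
  map_zero' := by
    ext j
    simp
  map_add' a b := by
    ext j
    change (if h : n + 1 ≤ j then a ⟨j, h⟩ + b ⟨j, h⟩ else 0 : Ak j) =
      (if h : n + 1 ≤ j then a ⟨j, h⟩ else 0) + (if h : n + 1 ≤ j then b ⟨j, h⟩ else 0)
    split_ifs with h
    · rfl
    · exact (add_zero 0).symm

lemma lpExtend_apply_of_le {n : ℕ} (a : lp (fun j : Ici (n + 1) => Ak j) ∞) (j : Ici n)
    (h : n + 1 ≤ (j : ℕ)) : lpExtend Ak n a j = a ⟨j, h⟩ :=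
  dif_pos h

lemma lpExtend_apply_self {n : ℕ} (a : lp (fun j : Ici (n + 1) => Ak j) ∞) :
    lpExtend Ak n a ⟨n, le_refl n⟩ = 0 :=
  dif_neg (Nat.not_succ_le_self n)

lemma continuous_lpExtend (n : ℕ) : Continuous (lpExtend Ak n) := by
  refine AddMonoidHomClass.continuous_of_bound (lpExtend Ak n) 1 fun a => ?_
  rw [one_mul]
  refine lp.norm_le_of_forall_le (norm_nonneg a) fun j => ?_
  by_cases h : n + 1 ≤ (j : ℕ)
  · rw [lpExtend_apply_of_le a j h]
    exact lp.norm_apply_le_norm ENNReal.top_ne_zero a _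
  · have h0 : lpExtend Ak n a j = 0 := dif_neg h
    simp [h0]

lemma lpTail_lpExtend {n : ℕ} (a : lp (fun j : Ici (n + 1) => Ak j) ∞) :
    lpTail Ak n (lpExtend Ak n a) = a := by
  ext j
  exact lpExtend_apply_of_le a ⟨j, Nat.le_of_succ_le j.2⟩ j.2

variable {A : Type u} [NonUnitalCStarAlgebra A]

/-- The pairs consisting of a bounded sequence `a j ∈ Ak j`, for `j ≥ n`, and a path in `A`. -/
abbrev SeqPath (Ak : ℕ → Type u) [∀ k, NonUnitalCStarAlgebra (Ak k)] (A : Type u)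
    [NonUnitalCStarAlgebra A] (n : ℕ) : Type u :=
  lp (fun j : Ici n => Ak j) ∞ × C(I, A)

/-- Forgetting the `n`-th entry of the sequence and the first half of the path. -/
def seqPathRestrict (Ak : ℕ → Type u) [∀ k, NonUnitalCStarAlgebra (Ak k)] (A : Type u)
    [NonUnitalCStarAlgebra A] (n : ℕ) : SeqPath Ak A n →⋆ₙₐ[ℂ] SeqPath Ak A (n + 1) :=
  NonUnitalStarAlgHom.prod
    ((lpTail Ak n).comp (NonUnitalStarAlgHom.fst ℂ _ _))
    ((pathReparam A upperHalf).comp (NonUnitalStarAlgHom.snd ℂ _ _))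

/-- The continuous right inverse of `seqPathRestrict` which starts at `0`. -/
def seqPathExtend (n : ℕ) (x : SeqPath Ak A (n + 1)) : SeqPath Ak A n :=
  (lpExtend Ak n x.1,
    ⟨fun s => (lowerHalfRamp s : ℝ) • x.2 (upperHalfRetract s), by fun_prop⟩)

lemma continuous_seqPathExtend (n : ℕ) :
    Continuous (seqPathExtend (Ak := Ak) (A := A) n) := by
  refine ((continuous_lpExtend n).comp continuous_fst).prodMk ?_
  refine ContinuousMap.continuous_of_continuous_uncurry _ ?_
  change Continuous fun p : SeqPath Ak A (n + 1) × I =>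
    (lowerHalfRamp p.2 : ℝ) • p.1.2 (upperHalfRetract p.2)
  fun_prop

lemma seqPathRestrict_seqPathExtend (n : ℕ) (x : SeqPath Ak A (n + 1)) :
    seqPathRestrict Ak A n (seqPathExtend n x) = x := by
  refine Prod.ext (lpTail_lpExtend x.1) ?_
  ext s
  change (lowerHalfRamp (upperHalf s) : ℝ) • x.2 (upperHalfRetract (upperHalf s)) = x.2 s
  simp

variable (γ : ∀ k, Ak k →⋆ₙₐ[ℂ] Ak (k + 1)) (μ : ∀ k, Ak k →⋆ₙₐ[ℂ] A)

/-- The eventually coherent sequences together with a path through their images in `A`. -/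
def preTelescope (n : ℕ) : NonUnitalStarSubalgebra ℂ (SeqPath Ak A n) where
  carrier := {x | (∀ j : Ici n, x.2 (upperHalf^[j - n] 0) = μ j (x.1 j)) ∧
    ∃ N, ∀ (j : ℕ) (h : n ≤ j), N ≤ j → x.1 ⟨j + 1, Nat.le_succ_of_le h⟩ = γ j (x.1 ⟨j, h⟩)}
  zero_mem' := ⟨fun j => by simp, 0, fun j h _ => by simp⟩
  add_mem' := by
    rintro x y ⟨hx, N, hN⟩ ⟨hy, M, hM⟩
    refine ⟨fun j => by simp [hx, hy], max N M, fun j h hj => ?_⟩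
    simp [hN j h (le_of_max_le_left hj), hM j h (le_of_max_le_right hj)]
  mul_mem' := by
    rintro x y ⟨hx, N, hN⟩ ⟨hy, M, hM⟩
    refine ⟨fun j => by simp [hx, hy, lp.infty_coeFn_mul], max N M, fun j h hj => ?_⟩
    simp [hN j h (le_of_max_le_left hj), hM j h (le_of_max_le_right hj), lp.infty_coeFn_mul]
  smul_mem' := by
    rintro c x ⟨hx, N, hN⟩
    refine ⟨fun j => by simp [hx], N, fun j h hj => by simp [hN j h hj]⟩
  star_mem' := by
    rintro x ⟨hx, N, hN⟩
    refine ⟨fun j => by simp [hx, map_star, lp.star_apply], N,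
      fun j h hj => by simp [hN j h hj, map_star, lp.star_apply]⟩

/-- The tail, starting at time `n`, of the mapping telescope of an inductive system. -/
def telescope (n : ℕ) : NonUnitalStarSubalgebra ℂ (SeqPath Ak A n) :=
  (preTelescope γ μ n).topologicalClosure

instance isClosed_telescope (n : ℕ) : IsClosed (telescope γ μ n : Set (SeqPath Ak A n)) :=
  NonUnitalStarSubalgebra.isClosed_topologicalClosure _

lemma seqPathRestrict_mem_preTelescope {n : ℕ} {x : SeqPath Ak A n}
    (hx : x ∈ preTelescope γ μ n) :
    seqPathRestrict Ak A n x ∈ preTelescope γ μ (n + 1) := by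
  obtain ⟨h, N, hN⟩ := hx
  refine ⟨fun j => ?_, N, fun j hj hNj => hN j (Nat.le_of_succ_le hj) hNj⟩
  have hj : n + 1 ≤ (j : ℕ) := j.2
  have e : (j : ℕ) - n = (j - (n + 1)) + 1 := by omega
  have := h ⟨j, Nat.le_of_succ_le j.2⟩
  simp only [e, Function.iterate_succ_apply'] at this
  exact this

lemma seqPathExtend_mem_preTelescope {n : ℕ} {x : SeqPath Ak A (n + 1)}
    (hx : x ∈ preTelescope γ μ (n + 1)) :
    seqPathExtend n x ∈ preTelescope γ μ n := by
  obtain ⟨h, N, hN⟩ := hx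
  refine ⟨fun ⟨j, hj⟩ => ?_, max N (n + 1), fun j hj hNj => ?_⟩
  · obtain rfl | hlt := eq_or_lt_of_le (show n ≤ j from hj)
    · change (lowerHalfRamp (upperHalf^[n - n] 0) : ℝ) • x.2 _ = μ n (lpExtend Ak n x.1 ⟨n, _⟩)
      rw [lpExtend_apply_self]
      simp
    · have e : j - n = (j - (n + 1)) + 1 := by omega
      change (lowerHalfRamp (upperHalf^[j - n] 0) : ℝ) •
        x.2 (upperHalfRetract (upperHalf^[j - n] 0)) = μ j (lpExtend Ak n x.1 ⟨j, _⟩)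
      rw [lpExtend_apply_of_le _ _ hlt, e, Function.iterate_succ_apply']
      simpa using h ⟨j, hlt⟩
  · have hlt : n + 1 ≤ j := le_of_max_le_right hNj
    change lpExtend Ak n x.1 ⟨j + 1, _⟩ = γ j (lpExtend Ak n x.1 ⟨j, _⟩)
    rw [lpExtend_apply_of_le _ _ (Nat.le_succ_of_le hlt), lpExtend_apply_of_le _ _ hlt]
    exact hN j hlt (le_of_max_le_left hNj)

/-- The connecting morphisms of the mapping telescope. -/
def telescopeRestrict (n : ℕ) : telescope γ μ n →⋆ₙₐ[ℂ] telescope γ μ (n + 1) :=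
  NonUnitalStarAlgHom.codRestrict
    ((seqPathRestrict Ak A n).comp (NonUnitalStarSubalgebraClass.subtype (telescope γ μ n))) _
    fun x => by
      have h := map_mem_closure (map_continuous (seqPathRestrict Ak A n)) x.2
        fun _ => seqPathRestrict_mem_preTelescope γ μ
      exact h

/-- Evaluation of the path component of an element of the telescope. -/
def telescopePath (n : ℕ) : telescope γ μ n →⋆ₙₐ[ℂ] C(I, A) :=
  (NonUnitalStarAlgHom.snd ℂ _ _).comp (NonUnitalStarSubalgebraClass.subtype (telescope γ μ n))

/-- The value of an element of the telescope at the endpoint. -/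
def telescopeEnd (n : ℕ) : telescope γ μ n →⋆ₙₐ[ℂ] A :=
  (pathEval A 1).comp (telescopePath γ μ n)

/-- The value in `Ak n` of an element of the telescope at the starting point. -/
def telescopeStart (n : ℕ) : telescope γ μ n →⋆ₙₐ[ℂ] Ak n :=
  (lpEval (fun j : Ici n => Ak j) ⟨n, le_refl n⟩).comp ((NonUnitalStarAlgHom.fst ℂ _ _).comp
    (NonUnitalStarSubalgebraClass.subtype (telescope γ μ n)))

lemma telescopeRestrict_surjective (n : ℕ) :
    Function.Surjective (telescopeRestrict γ μ n) := by
  intro x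
  refine ⟨⟨seqPathExtend n x, ?_⟩, Subtype.ext (seqPathRestrict_seqPathExtend n x.1)⟩
  exact map_mem_closure (continuous_seqPathExtend n) x.2
    fun _ => seqPathExtend_mem_preTelescope γ μ

lemma telescopePath_zero (n : ℕ) (x : telescope γ μ n) :
    telescopePath γ μ n x 0 = μ n (telescopeStart γ μ n x) := by
  have hclosed : IsClosed {y : SeqPath Ak A n | pathEval A 0 y.2 =
      μ n (lpEval (fun j : Ici n => Ak j) ⟨n, le_refl n⟩ y.1)} :=
    isClosed_eq ((map_continuous (pathEval A 0)).comp continuous_snd)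
      ((map_continuous (μ n)).comp ((map_continuous (lpEval _ _)).comp continuous_fst))
  refine closure_minimal ?_ hclosed x.2
  rintro y ⟨hy, -⟩
  have h := hy ⟨n, le_refl n⟩
  rw [Nat.sub_self] at h
  exact h

lemma telescopeEnd_comp_telescopeRestrict (n : ℕ) :
    (telescopeEnd γ μ (n + 1)).comp (telescopeRestrict γ μ n) = telescopeEnd γ μ n := by
  ext x
  change (x : SeqPath Ak A n).2 (upperHalf 1) = (x : SeqPath Ak A n).2 1
  rw [upperHalf_one]

lemma iterHom_telescopeRestrict_fst (n m : ℕ) (x : telescope γ μ n) (j : Ici (n + m)) :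
    (iterHom (A := fun n => telescope γ μ n) (telescopeRestrict γ μ) n m x :
      SeqPath Ak A (n + m)).1 j =
      (x : SeqPath Ak A n).1 ⟨j, le_trans (Nat.le_add_right n m) j.2⟩ := by
  induction m with
  | zero => rfl
  | succ m ih => exact ih ⟨j, Nat.le_of_succ_le j.2⟩

lemma iterHom_telescopeRestrict_snd (n m : ℕ) (x : telescope γ μ n) (s : I) :
    (iterHom (A := fun n => telescope γ μ n) (telescopeRestrict γ μ) n m x :
      SeqPath Ak A (n + m)).2 s = (x : SeqPath Ak A n).2 (upperHalf^[m] s) := by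
  induction m generalizing s with
  | zero => rfl
  | succ m ih => exact ih (upperHalf s)

variable {γ μ}

lemma norm_telescope_le {n : ℕ} (x : telescope γ μ n) {c : ℝ} (hc : 0 ≤ c)
    (h1 : ∀ j, ‖(x : SeqPath Ak A n).1 j‖ ≤ c) (h2 : ∀ s, ‖(x : SeqPath Ak A n).2 s‖ ≤ c) :
    ‖x‖ ≤ c :=
  max_le (lp.norm_le_of_forall_le hc h1) ((ContinuousMap.norm_le _ hc).2 h2)

lemma norm_iterHom_telescopeRestrict_le (n m : ℕ) (x : telescope γ μ n) {c : ℝ} (hc : 0 ≤ c)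
    (h1 : ∀ j : Ici (n + m),
      ‖(x : SeqPath Ak A n).1 ⟨j, le_trans (Nat.le_add_right n m) j.2⟩‖ ≤ c)
    (h2 : ∀ s, ‖(x : SeqPath Ak A n).2 (upperHalf^[m] s)‖ ≤ c) :
    ‖iterHom (A := fun n => telescope γ μ n) (telescopeRestrict γ μ) n m x‖ ≤ c := by
  let z : telescope γ μ (n + m) :=
    iterHom (A := fun n => telescope γ μ n) (telescopeRestrict γ μ) n m x
  have hz1 (j : Ici (n + m)) : ‖(z : SeqPath Ak A (n + m)).1 j‖ ≤ c := by
    exact (congrArg norm (iterHom_telescopeRestrict_fst γ μ n m x j)).trans_le (h1 j)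
  have hz2 (s : I) : ‖(z : SeqPath Ak A (n + m)).2 s‖ ≤ c := by
    exact (congrArg norm (iterHom_telescopeRestrict_snd γ μ n m x s)).trans_le (h2 s)
  exact norm_telescope_le z hc hz1 hz2

/-- An eventually coherent sequence is eventually bounded in norm by anything exceeding the norm
of its limit. -/
lemma exists_forall_norm_le_of_mem_preTelescope (hlim : IsInductiveLimit γ A μ) {n : ℕ}
    {x : SeqPath Ak A n} (hx : x ∈ preTelescope γ μ n) {c : ℝ} (hc : ‖x.2 1‖ < c) :
    ∃ N, ∀ j : Ici n, N ≤ (j : ℕ) → ‖x.1 j‖ ≤ c := by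
  obtain ⟨h, N, hN⟩ := hx
  have hle : n ≤ max N n := le_max_right _ _
  set M := max N n with hM
  have hiter (i : ℕ) : x.1 ⟨M + i, le_trans hle (Nat.le_add_right M i)⟩ =
      iterHom γ M i (x.1 ⟨M, hle⟩) := by
    induction i with
    | zero => rfl
    | succ i ih =>
      refine (hN (M + i) _ ?_).trans (congrArg (γ (M + i)) ih)
      exact le_trans (le_max_left N n) (Nat.le_add_right M i)
  have hconst (i : ℕ) : x.2 (upperHalf^[M + i - n] 0) = μ M (x.1 ⟨M, hle⟩) := by
    rw [h ⟨M + i, le_trans hle (Nat.le_add_right M i)⟩, hiter,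
      comp_iterHom hlim.compat]
  have hend : x.2 1 = μ M (x.1 ⟨M, hle⟩) := by
    have h1 : Tendsto (fun i => x.2 (upperHalf^[M + i - n] 0)) atTop (𝓝 (x.2 1)) := by
      refine ((map_continuous x.2).tendsto 1).comp ((tendsto_upperHalf_iterate 0).comp ?_)
      exact tendsto_atTop_mono (fun i => show i ≤ M + i - n by omega) tendsto_id
    simp only [hconst] at h1
    exact tendsto_nhds_unique h1 tendsto_const_nhds
  have hev := (hlim.norm_tendsto M (x.1 ⟨M, hle⟩)).eventually_lt_const (hend ▸ hc)
  obtain ⟨K, hK⟩ := eventually_atTop.1 hev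
  refine ⟨M + K, fun ⟨j, hj⟩ hKj => ?_⟩
  obtain ⟨i, rfl⟩ := Nat.exists_eq_add_of_le (le_trans (Nat.le_add_right M K) hKj)
  rw [hiter]
  exact (hK i (by simpa using hKj)).le

lemma eventually_norm_iterHom_telescopeRestrict_lt (hlim : IsInductiveLimit γ A μ) (n : ℕ)
    (x : telescope γ μ n) (hx : (x : SeqPath Ak A n) ∈ preTelescope γ μ n) {c : ℝ}
    (hc : ‖(x : SeqPath Ak A n).2 1‖ < c) :
    ∀ᶠ m in atTop,
      ‖iterHom (A := fun n => telescope γ μ n) (telescopeRestrict γ μ) n m x‖ < c := by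
  obtain ⟨d, hd, hdc⟩ := exists_between hc
  obtain ⟨N, hN⟩ := exists_forall_norm_le_of_mem_preTelescope hlim hx hd
  obtain ⟨M, hM⟩ := exists_forall_norm_upperHalf_iterate_le (x : SeqPath Ak A n).2 hd
  have hd0 : 0 ≤ d := (norm_nonneg _).trans hd.le
  filter_upwards [eventually_ge_atTop (max N M)] with m hm
  refine (norm_iterHom_telescopeRestrict_le n m x hd0 (fun j => hN _ ?_) fun s =>
    hM m (le_of_max_le_right hm) s).trans_lt hdc
  have hj : n + m ≤ (j : ℕ) := j.2
  have hNm := le_of_max_le_left hm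
  change N ≤ (j : ℕ)
  omega

lemma dense_preTelescope (γ : ∀ k, Ak k →⋆ₙₐ[ℂ] Ak (k + 1)) (μ : ∀ k, Ak k →⋆ₙₐ[ℂ] A) (n : ℕ) :
    Dense {y : telescope γ μ n | (y : SeqPath Ak A n) ∈ preTelescope γ μ n} := by
  intro y
  rw [closure_subtype]
  refine closure_mono (fun z hz => ?_) y.2
  exact ⟨⟨z, subset_closure hz⟩, hz, rfl⟩

lemma tendsto_norm_iterHom_telescopeRestrict (hlim : IsInductiveLimit γ A μ) (n : ℕ)
    (x : telescope γ μ n) :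
    Tendsto (fun m => ‖iterHom (A := fun n => telescope γ μ n) (telescopeRestrict γ μ) n m x‖)
      atTop (𝓝 ‖telescopeEnd γ μ n x‖) := by
  have hclosed := isClosed_setOf_tendsto_norm_iterHom (A := fun n => telescope γ μ n)
    (telescopeRestrict γ μ) n (telescopeEnd γ μ n)
  refine closure_minimal ?_ hclosed (dense_preTelescope γ μ n x)
  intro y hy
  refine tendsto_order.2 ⟨fun c hc => Eventually.of_forall fun m => hc.trans_le ?_,
    fun c hc => eventually_norm_iterHom_telescopeRestrict_lt hlim n y hy hc⟩
  rw [← comp_iterHom (A := fun n => telescope γ μ n)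
    (telescopeEnd_comp_telescopeRestrict γ μ) n m y]
  exact NonUnitalStarAlgHom.norm_apply_le _ _

lemma range_subset_range_telescopeEnd (hlim : IsInductiveLimit γ A μ) (n : ℕ) :
    Set.range (μ n) ⊆ Set.range (telescopeEnd γ μ n) := by
  rintro _ ⟨a, rfl⟩
  let f (j : ℕ) (h : n ≤ j) : Ak j := Nat.leRecOn h (fun {k} => γ k) a
  have f_self : f n le_rfl = a := Nat.leRecOn_self a
  have f_succ (j : ℕ) (h : n ≤ j) : f (j + 1) (Nat.le_succ_of_le h) = γ j (f j h) :=
    Nat.leRecOn_succ h a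
  have f_norm (j : ℕ) (h : n ≤ j) : ‖f j h‖ ≤ ‖a‖ := by
    induction j, h using Nat.le_induction with
    | base => rw [f_self]
    | succ j h ih =>
      rw [f_succ j h]
      exact (NonUnitalStarAlgHom.norm_apply_le _ _).trans ih
  have f_map (j : ℕ) (h : n ≤ j) : μ j (f j h) = μ n a := by
    induction j, h using Nat.le_induction with
    | base => rw [f_self]
    | succ j h ih =>
      rw [f_succ j h, ← ih, ← hlim.compat j]
      rfl
  let x : SeqPath Ak A n := (⟨fun j => f j j.2, memℓp_infty ⟨‖a‖, by
    rintro _ ⟨j, rfl⟩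
    exact f_norm j j.2⟩⟩, ContinuousMap.const _ (μ n a))
  have hx : x ∈ preTelescope γ μ n :=
    ⟨fun j => (f_map j j.2).symm, 0, fun j h _ => f_succ j h⟩
  exact ⟨⟨x, subset_closure hx⟩, rfl⟩

lemma isInductiveLimit_telescope (hlim : IsInductiveLimit γ A μ) :
    IsInductiveLimit (A := fun n => telescope γ μ n) (telescopeRestrict γ μ) A
      (telescopeEnd γ μ) where
  compat := telescopeEnd_comp_telescopeRestrict γ μ
  dense_union := hlim.dense_union.mono
    (Set.iUnion_mono fun n => range_subset_range_telescopeEnd hlim n)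
  norm_tendsto := tendsto_norm_iterHom_telescopeRestrict hlim

/-- Up to homotopy, a semiprojective morphism into an inductive limit factors through one of the
algebras of the inductive system. -/
lemma IsSemiprojectiveMorphism.exists_homotopic {D : Type u} [NonUnitalCStarAlgebra D]
    {φ : D →⋆ₙₐ[ℂ] A} (hφ : IsSemiprojectiveMorphism φ) (hlim : IsInductiveLimit γ A μ) :
    ∃ (k : ℕ) (ψ : D →⋆ₙₐ[ℂ] Ak k), Homotopic ((μ k).comp ψ) φ := by
  obtain ⟨k, ψ, hψ⟩ := hφ (fun n => telescope γ μ n) (telescopeRestrict γ μ)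
    (telescopeRestrict_surjective γ μ) A (telescopeEnd γ μ) (isInductiveLimit_telescope hlim)
    (NonUnitalStarAlgHom.id ℂ A)
  refine ⟨k, (telescopeStart γ μ k).comp ψ, (telescopePath γ μ k).comp ψ,
    fun d => telescopePath_zero γ μ k (ψ d), fun d => DFunLike.congr_fun hψ d⟩

end Telescope

open TopologicalSpace in
/-- If a separable C*-algebra `A` is an inductive limit of a system with null-homotopic
connecting morphisms, then every semiprojective morphism into `A` is null-homotopic. -/
theorem nullHomotopic_system_implies_semiprojective_maps_nullHomotopic
    (A : Type u) [NonUnitalCStarAlgebra A] [SeparableSpace A]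
    (Ak : ℕ → Type u) [∀ k, NonUnitalCStarAlgebra (Ak k)]
    (γ : ∀ k, Ak k →⋆ₙₐ[ℂ] Ak (k + 1)) (μ : ∀ k, Ak k →⋆ₙₐ[ℂ] A)
    (hlim : IsInductiveLimit γ A μ)
    (hnull : ∀ k, NullHomotopic (γ k)) :
    ∀ (D : Type u) [NonUnitalCStarAlgebra D] (φ : D →⋆ₙₐ[ℂ] A),
      IsSemiprojectiveMorphism φ → NullHomotopic φ := by
  intro D _ φ hφ
  obtain ⟨k, ψ, hψ⟩ := hφ.exists_homotopic hlim
  refine hψ.symm.trans ?_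
  rw [← hlim.compat k]
  exact ((hnull k).comp_left (μ (k + 1))).comp_right ψ
end

section
/- Every separable, contractible C*-algebra is isomorphic to the inductive limit of an inductive system all of whose terms are projective C*-algebras. -/
open Filter Topology Set

noncomputable section

section Clamp

variable {A : Type u} {B : Type v} [NonUnitalCStarAlgebra A] [NonUnitalCStarAlgebra B]

theorem NonUnitalStarAlgHom.continuous_of_cstar (φ : A →⋆ₙₐ[ℂ] B) : Continuous φ :=
  AddMonoidHomClass.continuous_of_bound φ 1
    fun a => by simpa using NonUnitalStarAlgHom.norm_apply_le φ a

/-- A self-adjoint element in the range of a *-homomorphism has a self-adjoint preimage whose norm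
obeys any bound on the norm of the image. -/
theorem exists_isSelfAdjoint_norm_le_map_eq (φ : A →⋆ₙₐ[ℂ] B) {a : A} (ha : IsSelfAdjoint a)
    {r : ℝ} (hr : ‖φ a‖ ≤ r) :
    ∃ b : A, IsSelfAdjoint b ∧ ‖b‖ ≤ r ∧ φ b = φ a := by
  have hr0 : 0 ≤ r := (norm_nonneg _).trans hr
  have hφa : IsSelfAdjoint (φ a) := ha.map φ
  have h0 : max (-r) (min r 0) = 0 := by rw [min_eq_right hr0]; simp [hr0]
  refine ⟨cfcₙ (fun t : ℝ => max (-r) (min r t)) a, cfcₙ_predicate _ a,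
    norm_cfcₙ_le fun x _ => ?_, ?_⟩
  · rw [Real.norm_eq_abs, abs_le]
    exact ⟨le_max_left _ _, max_le (by linarith) (min_le_left _ _)⟩
  · rw [NonUnitalStarAlgHom.map_cfcₙ φ (fun t : ℝ => max (-r) (min r t)) a
      (by fun_prop) h0 φ.continuous_of_cstar ha hφa]
    conv_rhs => rw [← cfcₙ_id ℝ (φ a)]
    refine cfcₙ_congr fun x hx => ?_
    have hx' : ‖x‖ ≤ r := by
      have := NonUnitalIsometricContinuousFunctionalCalculus.norm_quasispectrum_le (𝕜 := ℝ) (φ a) hx hφa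
      exact this.trans hr
    rw [Real.norm_eq_abs, abs_le] at hx'
    simp [hx'.1, hx'.2]

/-- The range of a *-homomorphism between C*-algebras is closed. -/
theorem NonUnitalStarAlgHom.isClosed_range_of_cstar (φ : A →⋆ₙₐ[ℂ] B) :
    IsClosed (Set.range φ) := by
  let f : NormedAddGroupHom A B :=
    { toFun := φ
      map_add' := map_add φ
      bound' := ⟨1, fun a => by simpa using NonUnitalStarAlgHom.norm_apply_le φ a⟩ }
  let K : AddSubgroup B := (φ : A →+ B).range
  have hyp : f.SurjectiveOnWith K 2 := by
    rintro _ ⟨a, rfl⟩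
    have key : ∀ x : A, IsSelfAdjoint x → ∃ b : A, ‖b‖ ≤ ‖φ x‖ ∧ φ b = φ x := fun x hx =>
      let ⟨b, _, h1, h2⟩ := exists_isSelfAdjoint_norm_le_map_eq φ hx le_rfl
      ⟨b, h1, h2⟩
    obtain ⟨b, hb, hb'⟩ := key (realPart a : A) (realPart a).2
    obtain ⟨c, hc, hc'⟩ := key (imaginaryPart a : A) (imaginaryPart a).2
    have hre : φ (realPart a : A) = (realPart (φ a) : B) := by
      rw [realPart_apply_coe, realPart_apply_coe, map_real_smul φ φ.continuous_of_cstar, map_add,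
        map_star]
    have him : φ (imaginaryPart a : A) = (imaginaryPart (φ a) : B) := by
      rw [imaginaryPart_apply_coe, imaginaryPart_apply_coe, map_smul,
        map_real_smul φ φ.continuous_of_cstar, map_sub, map_star]
    refine ⟨b + Complex.I • c, ?_, ?_⟩
    · change φ (b + Complex.I • c) = φ a
      rw [map_add, map_smul, hb', hc', hre, him]
      exact realPart_add_I_smul_imaginaryPart (φ a)
    · change _ ≤ 2 * ‖φ a‖
      refine (norm_add_le _ _).trans ?_
      rw [norm_smul, Complex.norm_I, one_mul, two_mul]
      refine add_le_add (hb.trans ?_) (hc.trans ?_)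
      · rw [hre]; exact realPart.norm_le (φ a)
      · rw [him]; exact imaginaryPart.norm_le (φ a)
  have := controlled_closure_of_complete two_pos one_pos hyp
  refine isClosed_of_closure_subset fun y hy => ?_
  obtain ⟨g, hg, -⟩ := this y hy
  exact ⟨g, hg⟩

end Clamp

section QuasiCentral

variable {F : Type u} {A : Type v} [NonUnitalCStarAlgebra F] [NonUnitalCStarAlgebra A]

theorem exists_approximate_unit_ker (q : F →⋆ₙₐ[ℂ] A) (Y : Finset F) (hY : ∀ y ∈ Y, q y = 0)
    {ε : ℝ} (hε : 0 < ε) :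
    ∃ h : F, IsSelfAdjoint h ∧ ‖h‖ ≤ 1 ∧ q h = 0 ∧ ∀ y ∈ Y, ‖h * y - y‖ ≤ ε := by
  let J : NonUnitalStarSubalgebra ℂ F :=
    { carrier := {y | q y = 0}
      add_mem' := fun {a b} ha hb => by
        simp only [Set.mem_ofPred_eq] at *; rw [map_add, ha, hb, add_zero]
      zero_mem' := map_zero q
      mul_mem' := fun {a b} ha hb => by
        simp only [Set.mem_ofPred_eq] at *; rw [map_mul, ha, zero_mul]
      smul_mem' := fun c x hx => by
        simp only [Set.mem_ofPred_eq] at *; rw [map_smul, hx, smul_zero]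
      star_mem' := fun {x} hx => by
        simp only [Set.mem_ofPred_eq] at *; rw [map_star, hx, star_zero] }
  have : IsClosed (J : Set F) := isClosed_singleton.preimage q.continuous_of_cstar
  let : PartialOrder J := CStarAlgebra.spectralOrder J
  let : StarOrderedRing J := CStarAlgebra.spectralOrderedRing J
  have hl := CStarAlgebra.increasingApproximateUnit J
  have := hl.neBot
  have h1 : ∀ᶠ e : J in CStarAlgebra.approximateUnit J, ∀ y ∈ Y, ‖(e : F) * y - y‖ ≤ ε := by
    rw [Finset.eventually_all]
    intro y hy
    have ht := hl.tendsto_mul_right ⟨y, hY y hy⟩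
    have := (tendsto_iff_norm_sub_tendsto_zero.1 ht).eventually (gt_mem_nhds hε)
    filter_upwards [this] with e he
    exact le_of_lt he
  obtain ⟨e, he1, he2, he3⟩ := (h1.and (hl.eventually_norm.and hl.eventually_isSelfAdjoint)).exists
  exact ⟨e, congrArg Subtype.val he3, he2, e.2, he1⟩

theorem exists_sum_quasicentral (q : F →⋆ₙₐ[ℂ] A) (X Y : Finset F) (hY : ∀ y ∈ Y, q y = 0)
    {M : ℝ} (hM0 : 0 ≤ M) (hM : ∀ x ∈ X, ‖x‖ ≤ M) {ε : ℝ} (hε : 0 < ε) (n : ℕ) :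
    ∃ s : F, IsSelfAdjoint s ∧ ‖s‖ ≤ n ∧ q s = 0 ∧ (∀ y ∈ Y, ‖s * y - (n : ℂ) • y‖ ≤ n * ε) ∧
      ∀ x ∈ X, ‖s * x - x * s‖ ^ 2 ≤ n * (4 * M ^ 2 + 1) := by
  classical
  induction n with
  | zero => exact ⟨0, by simp⟩
  | succ n ih =>
    obtain ⟨s, hs, hsn, hqs, hsY, hsX⟩ := ih
    have hδ : 0 < 1 / (2 * (1 + M)) := by positivity
    set δ := min ε (1 / (2 * (1 + M))) with hδ_def
    have hδ0 : 0 < δ := lt_min hε hδ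
    obtain ⟨h, hh, hh1, hqh, hhY⟩ := exists_approximate_unit_ker q
      (Y ∪ X.image (fun x => x * star (s * x - x * s)) ∪ X.image fun x => star (s * x - x * s))
      (by
        intro y hy
        simp only [Finset.mem_union, Finset.mem_image] at hy
        rcases hy with (hy | ⟨x, -, rfl⟩) | ⟨x, -, rfl⟩
        · exact hY y hy
        · simp [hqs, map_star]
        · simp [hqs, map_star]) hδ0
    refine ⟨s + h, hs.add hh, ?_, ?_, fun y hy => ?_, fun x hx => ?_⟩
    · push_cast
      exact (norm_add_le _ _).trans (add_le_add hsn hh1)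
    · rw [map_add, hqs, hqh, add_zero]
    · have e : (s + h) * y - ((n + 1 : ℕ) : ℂ) • y = (s * y - (n : ℂ) • y) + (h * y - y) := by
        push_cast
        rw [add_mul, add_smul, one_smul]
        abel
      rw [e]
      refine (norm_add_le _ _).trans ?_
      have := (hhY y (by simp [hy])).trans (min_le_left _ _)
      push_cast
      linarith [hsY y hy]
    · set c := s * x - x * s with hc
      set d := h * x - x * h with hd
      have e : (s + h) * x - x * (s + h) = c + d := by
        rw [hc, hd, add_mul, mul_add]; abel
      have hd' : star d = star x * h - h * star x := by
        rw [hd, star_sub, star_mul, star_mul, hh.star_eq]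
      have h1 : ‖c * star x * h - c * star x‖ ≤ δ := by
        have := hhY (x * star c) (by
          simp only [Finset.mem_union, Finset.mem_image]
          exact Or.inl (Or.inr ⟨x, hx, rfl⟩))
        rw [← norm_star] at this
        simpa [star_sub, star_mul, hh.star_eq, mul_assoc] using this
      have h2 : ‖c * h - c‖ ≤ δ := by
        have := hhY (star c) (by
          simp only [Finset.mem_union, Finset.mem_image]
          exact Or.inr ⟨x, hx, rfl⟩)
        rw [← norm_star] at this
        simpa [star_sub, star_mul, hh.star_eq, mul_assoc] using this
      have h3 : ‖c * star d‖ ≤ 1 / 2 := by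
        have e3 : c * star d = (c * star x * h - c * star x) - (c * h - c) * star x := by
          rw [hd', mul_sub, sub_mul (c * h), mul_assoc c (star x), mul_assoc c h]; abel
        rw [e3]
        calc _ ≤ ‖c * star x * h - c * star x‖ + ‖(c * h - c) * star x‖ := norm_sub_le _ _
          _ ≤ δ + δ * M := by
              refine add_le_add h1 ((norm_mul_le _ _).trans ?_)
              rw [norm_star]
              exact mul_le_mul h2 (hM x hx) (norm_nonneg _) hδ0.le
          _ = δ * (1 + M) := by ring
          _ ≤ 1 / (2 * (1 + M)) * (1 + M) := by
              gcongr
              exact min_le_right _ _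
          _ = 1 / 2 := by field_simp
      have h4 : ‖d * star c‖ ≤ 1 / 2 := by
        rw [← norm_star]; simpa [star_mul] using h3
      have h5 : ‖d‖ ≤ 2 * M := by
        have a1 : ‖h * x‖ ≤ 1 * M :=
          (norm_mul_le _ _).trans (mul_le_mul hh1 (hM x hx) (norm_nonneg _) zero_le_one)
        have a2 : ‖x * h‖ ≤ M * 1 :=
          (norm_mul_le _ _).trans (mul_le_mul (hM x hx) hh1 (norm_nonneg _) hM0)
        calc ‖d‖ ≤ ‖h * x‖ + ‖x * h‖ := norm_sub_le _ _
          _ ≤ 2 * M := by linarith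
      have h6 : ‖d‖ ^ 2 ≤ 4 * M ^ 2 := by nlinarith [norm_nonneg d]
      rw [e, sq, ← CStarRing.norm_self_mul_star]
      have e5 : (c + d) * star (c + d) = c * star c + c * star d + (d * star c + d * star d) := by
        rw [star_add, add_mul, mul_add, mul_add]
      rw [e5]
      have := hsX x hx
      calc _ ≤ (‖c * star c‖ + ‖c * star d‖) + (‖d * star c‖ + ‖d * star d‖) :=
              (norm_add_le _ _).trans (add_le_add (norm_add_le _ _) (norm_add_le _ _))
        _ ≤ ‖c‖ ^ 2 + 1 / 2 + (1 / 2 + ‖d‖ ^ 2) := by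
              rw [CStarRing.norm_self_mul_star, CStarRing.norm_self_mul_star, ← sq, ← sq]
              gcongr
        _ ≤ _ := by push_cast; linarith

/-- Quasi-central approximate units for the kernel of a *-homomorphism. -/
theorem exists_quasicentral (q : F →⋆ₙₐ[ℂ] A) (X Y : Finset F) (hY : ∀ y ∈ Y, q y = 0)
    {ε : ℝ} (hε : 0 < ε) :
    ∃ h : F, IsSelfAdjoint h ∧ ‖h‖ ≤ 1 ∧ q h = 0 ∧ (∀ y ∈ Y, ‖h * y - y‖ ≤ ε) ∧
      ∀ x ∈ X, ‖h * x - x * h‖ ≤ ε := by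
  set M : ℝ := ∑ x ∈ X, ‖x‖ with hM_def
  have hM : ∀ x ∈ X, ‖x‖ ≤ M := fun x hx =>
    Finset.single_le_sum (f := fun x => ‖x‖) (fun _ _ => norm_nonneg _) hx
  have hM0 : 0 ≤ M := Finset.sum_nonneg fun _ _ => norm_nonneg _
  obtain ⟨n, hn⟩ := exists_nat_gt (max 1 ((4 * M ^ 2 + 1) / ε ^ 2))
  have hn1 : (1 : ℝ) < n := (le_max_left _ _).trans_lt hn
  have hn2 : (4 * M ^ 2 + 1) / ε ^ 2 < n := (le_max_right _ _).trans_lt hn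
  have hn0 : (0 : ℝ) < n := by linarith
  have hnC : (n : ℂ) ≠ 0 := by exact_mod_cast hn0.ne'
  obtain ⟨s, hs, hsn, hqs, hsY, hsX⟩ := exists_sum_quasicentral q X Y hY hM0 hM hε n
  have hnorm : ∀ z : F, ‖(n : ℂ)⁻¹ • z‖ = ‖z‖ / n := fun z => by
    rw [norm_smul, norm_inv, Complex.norm_natCast, div_eq_inv_mul]
  refine ⟨(n : ℂ)⁻¹ • s, ?_, ?_, ?_, fun y hy => ?_, fun x hx => ?_⟩
  · rw [isSelfAdjoint_iff, star_smul, hs.star_eq]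
    simp
  · rw [hnorm, div_le_one hn0]; exact hsn
  · rw [map_smul, hqs, smul_zero]
  · have e : (n : ℂ)⁻¹ • s * y - y = (n : ℂ)⁻¹ • (s * y - (n : ℂ) • y) := by
      rw [smul_sub, smul_smul, inv_mul_cancel₀ hnC, one_smul, smul_mul_assoc]
    rw [e, hnorm, div_le_iff₀ hn0, mul_comm]
    exact hsY y hy
  · have e : (n : ℂ)⁻¹ • s * x - x * (n : ℂ)⁻¹ • s = (n : ℂ)⁻¹ • (s * x - x * s) := by
      rw [smul_sub, smul_mul_assoc, mul_smul_comm]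
    rw [e, hnorm, div_le_iff₀ hn0]
    refine le_of_sq_le_sq ?_ (by positivity)
    refine (hsX x hx).trans ?_
    rw [div_lt_iff₀ (by positivity)] at hn2
    nlinarith

end QuasiCentral

section PartitionSums

variable {B : Type u} [CStarAlgebra B]

section
attribute [local instance] CStarAlgebra.spectralOrder CStarAlgebra.spectralOrderedRing

theorem norm_sum_conj_le_of_isSelfAdjoint {ι : Type*} (T : Finset ι) (s y : ι → B)
    (hs : ∀ i ∈ T, IsSelfAdjoint (s i)) (hsum : ∑ i ∈ T, s i * s i = 1)
    (hy : ∀ i ∈ T, IsSelfAdjoint (y i)) {M : ℝ} (hM : 0 ≤ M) (hyM : ∀ i ∈ T, ‖y i‖ ≤ M) :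
    ‖∑ i ∈ T, s i * y i * s i‖ ≤ M := by
  cases subsingleton_or_nontrivial B with
  | inl _ => rw [Subsingleton.elim (∑ i ∈ T, s i * y i * s i) 0, norm_zero]; exact hM
  | inr _ =>
  have hone : ∑ i ∈ T, s i * algebraMap ℝ B M * s i = algebraMap ℝ B M := by
    have : ∀ i ∈ T, s i * algebraMap ℝ B M * s i = algebraMap ℝ B M * (s i * s i) := by
      intro i _
      rw [← Algebra.commutes, mul_assoc]
    rw [Finset.sum_congr rfl this, ← Finset.mul_sum, hsum, mul_one]
  have hbound : ∀ i ∈ T, y i ≤ algebraMap ℝ B M ∧ -algebraMap ℝ B M ≤ y i := by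
    intro i hi
    have h1 := (hy i hi).le_algebraMap_norm_self
    have h2 := (hy i hi).neg_algebraMap_norm_le_self
    have h3 : algebraMap ℝ B ‖y i‖ ≤ algebraMap ℝ B M := algebraMap_mono B (hyM i hi)
    exact ⟨h1.trans h3, (neg_le_neg h3).trans h2⟩
  have hsa : IsSelfAdjoint (∑ i ∈ T, s i * y i * s i) := by
    refine isSelfAdjoint_sum _ fun i hi => ?_
    have := (hy i hi).conjugate (s i)
    rwa [(hs i hi).star_eq] at this
  have hupper : ∑ i ∈ T, s i * y i * s i ≤ algebraMap ℝ B M := by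
    rw [← hone]
    refine Finset.sum_le_sum fun i hi => ?_
    have := star_left_conjugate_le_conjugate (hbound i hi).1 (s i)
    rwa [(hs i hi).star_eq] at this
  have hlower : -algebraMap ℝ B M ≤ ∑ i ∈ T, s i * y i * s i := by
    rw [← hone, ← Finset.sum_neg_distrib]
    refine Finset.sum_le_sum fun i hi => ?_
    have := star_left_conjugate_le_conjugate (hbound i hi).2 (s i)
    rw [(hs i hi).star_eq] at this
    simpa [mul_assoc] using this
  rw [← map_neg] at hlower
  rw [← cfc_id ℝ (∑ i ∈ T, s i * y i * s i)]
  refine norm_cfc_le hM fun x hx => ?_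
  rw [Real.norm_eq_abs, abs_le]
  exact ⟨(algebraMap_le_iff_le_spectrum).1 hlower x hx, (le_algebraMap_iff_spectrum_le).1 hupper x hx⟩


end

theorem norm_sum_conj_le {ι : Type*} (T : Finset ι) (s y : ι → B)
    (hs : ∀ i ∈ T, IsSelfAdjoint (s i)) (hsum : ∑ i ∈ T, s i * s i = 1)
    {M : ℝ} (hM : 0 ≤ M) (hyM : ∀ i ∈ T, ‖y i‖ ≤ M) :
    ‖∑ i ∈ T, s i * y i * s i‖ ≤ 2 * M := by
  have hdec : ∑ i ∈ T, s i * y i * s i =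
      ∑ i ∈ T, s i * (realPart (y i) : B) * s i +
        Complex.I • ∑ i ∈ T, s i * (imaginaryPart (y i) : B) * s i := by
    rw [Finset.smul_sum, ← Finset.sum_add_distrib]
    refine Finset.sum_congr rfl fun i _ => ?_
    conv_lhs => rw [← realPart_add_I_smul_imaginaryPart (y i)]
    rw [mul_add, add_mul, mul_smul_comm, smul_mul_assoc]
  have h1 := norm_sum_conj_le_of_isSelfAdjoint T s (fun i => (realPart (y i) : B)) hs hsum
    (fun i _ => (realPart (y i)).2) hM fun i hi => (realPart.norm_le (y i)).trans (hyM i hi)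
  have h2 := norm_sum_conj_le_of_isSelfAdjoint T s (fun i => (imaginaryPart (y i) : B)) hs hsum
    (fun i _ => (imaginaryPart (y i)).2) hM
    fun i hi => (imaginaryPart.norm_le (y i)).trans (hyM i hi)
  rw [hdec]
  refine (norm_add_le _ _).trans ?_
  rw [norm_smul, Complex.norm_I, one_mul]
  linarith

theorem conj_mul_conj_sub_eq {a b f g g' : B} (h : b * a = a * b) :
    a * f * a * (b * g * b) - a * (f * g') * a * (b * b) =
      (a * b) * (f * (g - g')) * (a * b) + (a * (f * b - b * f) * a * g * b +
        a * b * f * (a * g - g * a) * b - a * (f * g' * b - b * (f * g')) * a * b) := by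
  have h1 : a * f * a * (b * g * b) = a * f * (b * a) * g * b := by rw [h]; noncomm_ring
  have h2 : a * (f * g') * a * (b * b) = a * (f * g') * (b * a) * b := by rw [h]; noncomm_ring
  rw [h1, h2]
  noncomm_ring

theorem norm_sum_conj_mul_sub_le {ι : Type*} (T : Finset ι) (s f g : ι → B)
    (hs : ∀ i ∈ T, IsSelfAdjoint (s i)) (hn : ∀ i ∈ T, ‖s i‖ ≤ 1)
    (hc : ∀ i ∈ T, ∀ j ∈ T, s i * s j = s j * s i) (hsum : ∑ i ∈ T, s i * s i = 1)
    {K : ℝ} (hK : 0 ≤ K)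
    (hfg : ∀ i ∈ T, ∀ j ∈ T, s i * s j = 0 ∨ ‖f i * (g j - g i)‖ ≤ K) :
    ‖(∑ i ∈ T, s i * f i * s i) * (∑ i ∈ T, s i * g i * s i) -
        ∑ i ∈ T, s i * (f i * g i) * s i‖ ≤
      2 * K + ∑ p ∈ T ×ˢ T, (‖f p.1 * s p.2 - s p.2 * f p.1‖ * ‖g p.2‖ +
        ‖f p.1‖ * ‖s p.1 * g p.2 - g p.2 * s p.1‖ +
        ‖f p.1 * g p.1 * s p.2 - s p.2 * (f p.1 * g p.1)‖) := by
  classical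
  have hmem : ∀ p ∈ T ×ˢ T, p.1 ∈ T ∧ p.2 ∈ T := fun p hp => Finset.mem_product.1 hp
  have hsq : ∑ p ∈ T ×ˢ T, (s p.1 * s p.2) * (s p.1 * s p.2) = 1 := by
    have : ∀ p ∈ T ×ˢ T, (s p.1 * s p.2) * (s p.1 * s p.2) =
        (s p.1 * s p.1) * (s p.2 * s p.2) := by
      intro p hp
      rw [mul_assoc, ← mul_assoc (s p.2), hc _ (hmem p hp).2 _ (hmem p hp).1]
      noncomm_ring
    rw [Finset.sum_congr rfl this, Finset.sum_product]
    simp only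
    rw [← Finset.sum_mul_sum, hsum, one_mul]
  have hright : ∑ i ∈ T, s i * (f i * g i) * s i =
      ∑ p ∈ T ×ˢ T, s p.1 * (f p.1 * g p.1) * s p.1 * (s p.2 * s p.2) := by
    rw [Finset.sum_product]
    simp only
    rw [← Finset.sum_mul_sum, hsum, mul_one]
  set y : ι × ι → B := fun p => if s p.1 * s p.2 = 0 then 0 else f p.1 * (g p.2 - g p.1)
  have hy : ∀ p : ι × ι, (s p.1 * s p.2) * (f p.1 * (g p.2 - g p.1)) * (s p.1 * s p.2) =
      (s p.1 * s p.2) * y p * (s p.1 * s p.2) := by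
    intro p
    by_cases h : s p.1 * s p.2 = 0
    · simp [h]
    · simp [y, h]
  rw [hright, Finset.sum_mul_sum, ← Finset.sum_product', ← Finset.sum_sub_distrib,
    Finset.sum_congr rfl fun p hp => (conj_mul_conj_sub_eq (f := f p.1) (g := g p.2)
      (g' := g p.1) (hc _ (hmem p hp).2 _ (hmem p hp).1)).trans (by rw [hy]),
    Finset.sum_add_distrib]
  refine (norm_add_le _ _).trans (add_le_add ?_ ?_)
  · refine norm_sum_conj_le (T ×ˢ T) (fun p => s p.1 * s p.2) y (fun p hp => ?_) hsq hK
      fun p hp => ?_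
    · rw [IsSelfAdjoint, star_mul, (hs _ (hmem p hp).1).star_eq, (hs _ (hmem p hp).2).star_eq,
        hc _ (hmem p hp).1 _ (hmem p hp).2]
    · by_cases h : s p.1 * s p.2 = 0
      · simpa [y, h] using hK
      · simpa [y, h] using (hfg _ (hmem p hp).1 _ (hmem p hp).2).resolve_left h
  · refine (norm_sum_le _ _).trans (Finset.sum_le_sum fun p hp => ?_)
    have ha := hn _ (hmem p hp).1
    have hb := hn _ (hmem p hp).2
    have hmul : ∀ x z : B, ∀ r : ℝ, 0 ≤ r → ‖x‖ ≤ r → ‖z‖ ≤ 1 → ‖x * z‖ ≤ r := by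
      intro x z r hr hx hz
      calc ‖x * z‖ ≤ ‖x‖ * ‖z‖ := norm_mul_le _ _
        _ ≤ r * 1 := mul_le_mul hx hz (norm_nonneg _) hr
        _ = r := mul_one r
    have hmul' : ∀ z x : B, ‖z‖ ≤ 1 → ‖z * x‖ ≤ ‖x‖ := by
      intro z x hz
      calc ‖z * x‖ ≤ ‖z‖ * ‖x‖ := norm_mul_le _ _
        _ ≤ 1 * ‖x‖ := by gcongr
        _ = ‖x‖ := one_mul _
    refine (norm_sub_le _ _).trans (add_le_add ((norm_add_le _ _).trans (add_le_add ?_ ?_)) ?_)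
    · refine hmul _ _ _ (by positivity) ?_ hb
      refine (norm_mul_le _ _).trans (mul_le_mul_of_nonneg_right ?_ (norm_nonneg _))
      exact hmul _ _ _ (norm_nonneg _) (hmul' _ _ ha) ha
    · refine hmul _ _ _ (by positivity) ?_ hb
      refine (norm_mul_le _ _).trans (mul_le_mul_of_nonneg_right ?_ (norm_nonneg _))
      rw [mul_assoc]
      exact (hmul' _ _ ha).trans (hmul' _ _ hb)
    · exact hmul _ _ _ (norm_nonneg _) (hmul _ _ _ (norm_nonneg _) (hmul' _ _ ha) ha) hb

end PartitionSums

section Weierstrass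

variable {B : Type u} [CStarAlgebra B] [Nontrivial B] {Λ : Type*} {l : Filter Λ} {h k : Λ → B}

theorem tendsto_pow_mul_sub_mul_pow
    (hh : ∀ p, ‖h p‖ ≤ 1) (hk : ∀ p, ‖k p‖ ≤ 1) {y : B}
    (hy : Tendsto (fun p => h p * y - y * k p) l (𝓝 0)) (n : ℕ) :
    Tendsto (fun p => h p ^ n * y - y * k p ^ n) l (𝓝 0) := by
  induction n with
  | zero => simpa using tendsto_const_nhds
  | succ n ih =>
    have h1 := ih.norm.add hy.norm
    rw [norm_zero, add_zero] at h1
    refine squeeze_zero_norm (fun p => ?_) h1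
    have h2 : h p ^ (n + 1) * y - y * k p ^ (n + 1) =
        h p * (h p ^ n * y - y * k p ^ n) + (h p * y - y * k p) * k p ^ n := by
      rw [pow_succ' (h p), pow_succ' (k p)]
      noncomm_ring
    rw [h2]
    refine (norm_add_le _ _).trans (add_le_add ?_ ?_)
    · exact (norm_mul_le _ _).trans (mul_le_of_le_one_left (norm_nonneg _) (hh p))
    · refine (norm_mul_le _ _).trans (mul_le_of_le_one_right (norm_nonneg _) ?_)
      exact (norm_pow_le _ _).trans (pow_le_one₀ (norm_nonneg _) (hk p))

theorem tendsto_aeval_mul_sub_mul_aeval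
    (hh : ∀ p, ‖h p‖ ≤ 1) (hk : ∀ p, ‖k p‖ ≤ 1) {y : B}
    (hy : Tendsto (fun p => h p * y - y * k p) l (𝓝 0)) (P : Polynomial ℝ) :
    Tendsto (fun p => P.aeval (h p) * y - y * P.aeval (k p)) l (𝓝 0) := by
  induction P using Polynomial.induction_on' with
  | add P Q hP hQ =>
    have := hP.add hQ
    rw [add_zero] at this
    refine this.congr fun p => ?_
    simp only [map_add]
    noncomm_ring
  | monomial n a =>
    have := (tendsto_pow_mul_sub_mul_pow hh hk hy n).const_smul a
    rw [smul_zero] at this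
    refine this.congr fun p => ?_
    simp only [Polynomial.aeval_monomial, ← Algebra.smul_def, smul_mul_assoc, mul_smul_comm,
      smul_sub]

/-- Approximate intertwining relations pass to the continuous functional calculus. -/
theorem tendsto_cfc_mul_sub_mul_cfc {φ : ℝ → ℝ} (hφ : Continuous φ)
    (hhs : ∀ p, IsSelfAdjoint (h p)) (hks : ∀ p, IsSelfAdjoint (k p))
    (hh : ∀ p, ‖h p‖ ≤ 1) (hk : ∀ p, ‖k p‖ ≤ 1) {y : B}
    (hy : Tendsto (fun p => h p * y - y * k p) l (𝓝 0)) :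
    Tendsto (fun p => cfc φ (h p) * y - y * cfc φ (k p)) l (𝓝 0) := by
  rw [Metric.tendsto_nhds]
  intro ε hε
  set δ : ℝ := ε / (4 * (‖y‖ + 1)) with hδ
  have hy1 : 0 < ‖y‖ + 1 := by positivity
  have hδ0 : 0 < δ := by positivity
  obtain ⟨P, hP⟩ := exists_polynomial_near_of_continuousOn (-1) 1 φ hφ.continuousOn δ hδ0
  have happrox : ∀ a : B, IsSelfAdjoint a → ‖a‖ ≤ 1 → ‖cfc φ a - P.aeval a‖ ≤ δ := by
    intro a ha hn
    rw [← cfc_polynomial P a, ← cfc_sub φ P.eval a hφ.continuousOn P.continuous.continuousOn]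
    refine norm_cfc_le hδ0.le fun x hx => ?_
    have hx1 : |x| ≤ 1 := (spectrum.norm_le_norm_of_mem hx).trans hn
    rw [norm_sub_rev]
    exact (hP x (abs_le.1 hx1)).le
  have hev := (Metric.tendsto_nhds.1 (tendsto_aeval_mul_sub_mul_aeval hh hk hy P)) (ε / 2)
    (by positivity)
  filter_upwards [hev] with p hp
  rw [dist_zero_right] at hp ⊢
  have hdec : cfc φ (h p) * y - y * cfc φ (k p) = (cfc φ (h p) - P.aeval (h p)) * y +
      (P.aeval (h p) * y - y * P.aeval (k p)) - y * (cfc φ (k p) - P.aeval (k p)) := by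
    noncomm_ring
  have e1 : ‖(cfc φ (h p) - P.aeval (h p)) * y‖ ≤ δ * ‖y‖ :=
    (norm_mul_le _ _).trans (by gcongr; exact happrox _ (hhs p) (hh p))
  have e2 : ‖y * (cfc φ (k p) - P.aeval (k p))‖ ≤ ‖y‖ * δ :=
    (norm_mul_le _ _).trans (by gcongr; exact happrox _ (hks p) (hk p))
  have e3 : δ * (‖y‖ + 1) = ε / 4 := by rw [hδ]; field_simp
  rw [hdec]
  have := norm_sub_le ((cfc φ (h p) - P.aeval (h p)) * y +
      (P.aeval (h p) * y - y * P.aeval (k p))) (y * (cfc φ (k p) - P.aeval (k p)))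
  have := norm_add_le ((cfc φ (h p) - P.aeval (h p)) * y)
    (P.aeval (h p) * y - y * P.aeval (k p))
  nlinarith

theorem tendsto_cfc_mul_sub_mul_cfc_self {φ : ℝ → ℝ} (hφ : Continuous φ)
    (hhs : ∀ p, IsSelfAdjoint (h p)) (hh : ∀ p, ‖h p‖ ≤ 1) {y : B}
    (hy : Tendsto (fun p => h p * y - y * h p) l (𝓝 0)) :
    Tendsto (fun p => cfc φ (h p) * y - y * cfc φ (h p)) l (𝓝 0) :=
  tendsto_cfc_mul_sub_mul_cfc hφ hhs hhs hh hh hy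

theorem tendsto_cfc_mul_of_tendsto_mul {φ : ℝ → ℝ} (hφ : Continuous φ)
    (hhs : ∀ p, IsSelfAdjoint (h p)) (hh : ∀ p, ‖h p‖ ≤ 1) {y : B}
    (hy : Tendsto (fun p => h p * y) l (𝓝 y)) :
    Tendsto (fun p => cfc φ (h p) * y) l (𝓝 (φ 1 • y)) := by
  have h1 : Tendsto (fun p => h p * y - y * (1 : B)) l (𝓝 0) := by
    simpa using hy.sub_const y
  have h2 := tendsto_cfc_mul_sub_mul_cfc (k := fun _ => (1 : B)) hφ hhs
    (fun _ => .one B) hh (fun _ => norm_one.le) h1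
  have h3 : cfc φ (1 : B) = algebraMap ℝ B (φ 1) := by
    rw [cfc_apply_one]
  simp only [h3, ← Algebra.commutes, ← Algebra.smul_def] at h2
  simpa using h2.add_const (φ 1 • y)

end Weierstrass

section Partition

/-- The piecewise linear functions whose successive differences form the standard partition of
unity of the unit interval with `N + 1` members. -/
def rampFun (N j : ℕ) (t : ℝ) : ℝ := max 0 (min 1 (N * max 0 (min 1 t) - j + 1))

/-- The standard hat functions of mesh `1 / N` on the unit interval. -/
def hatFun (N j : ℕ) (t : ℝ) : ℝ := rampFun N j t - rampFun N (j + 1) t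

/-- Square roots of the hat functions. -/
def sqrtHat (N j : ℕ) (t : ℝ) : ℝ := Real.sqrt (hatFun N j t)

theorem continuous_sqrtHat (N j : ℕ) : Continuous (sqrtHat N j) := by
  unfold sqrtHat hatFun rampFun
  fun_prop

theorem hatFun_nonneg (N j : ℕ) (t : ℝ) : 0 ≤ hatFun N j t := by
  unfold hatFun rampFun
  rw [sub_nonneg]
  refine max_le_max le_rfl (min_le_min le_rfl ?_)
  push_cast
  linarith

theorem sqrtHat_mul_self (N j : ℕ) (t : ℝ) : sqrtHat N j t * sqrtHat N j t = hatFun N j t :=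
  Real.mul_self_sqrt (hatFun_nonneg N j t)

theorem clamp_mem (t : ℝ) : 0 ≤ max 0 (min 1 t) ∧ max 0 (min 1 t) ≤ 1 :=
  ⟨le_max_left _ _, max_le zero_le_one (min_le_left _ _)⟩

theorem sum_hatFun (N : ℕ) (t : ℝ) : ∑ j ∈ Finset.range (N + 1), hatFun N j t = 1 := by
  unfold hatFun
  rw [Finset.sum_range_sub']
  obtain ⟨h0, h1⟩ := clamp_mem t
  have hN : (0 : ℝ) ≤ N := N.cast_nonneg
  have e1 : rampFun N 0 t = 1 := by
    unfold rampFun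
    rw [min_eq_left, max_eq_right zero_le_one]
    push_cast
    nlinarith
  have e2 : rampFun N (N + 1) t = 0 := by
    unfold rampFun
    refine max_eq_left ((min_le_right _ _).trans ?_)
    push_cast
    nlinarith
  rw [e1, e2, sub_zero]

theorem hatFun_le_one (N j : ℕ) (t : ℝ) : hatFun N j t ≤ 1 := by
  unfold hatFun rampFun
  have h1 := (clamp_mem (N * max 0 (min 1 t) - j + 1)).2
  have h2 := (clamp_mem (N * max 0 (min 1 t) - (j + 1 : ℕ) + 1)).1
  linarith

theorem abs_sqrtHat_le_one (N j : ℕ) (t : ℝ) : ‖sqrtHat N j t‖ ≤ 1 := by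
  rw [Real.norm_eq_abs, abs_of_nonneg (show 0 ≤ sqrtHat N j t from Real.sqrt_nonneg _)]
  exact Real.sqrt_le_one.2 (hatFun_le_one N j t)

theorem sqrtHat_zero_left (N : ℕ) : sqrtHat N 0 0 = 1 := by
  simp [sqrtHat, hatFun, rampFun]

theorem sqrtHat_succ_zero (N j : ℕ) : sqrtHat N (j + 1) 0 = 0 := by
  have h1 : -((j : ℝ) + 1) + 1 ≤ 0 := by have := j.cast_nonneg (α := ℝ); linarith
  have h2 : -((j : ℝ) + 1 + 1) + 1 ≤ 0 := by have := j.cast_nonneg (α := ℝ); linarith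
  have h3 : hatFun N (j + 1) 0 = 0 := by
    simp only [hatFun, rampFun]
    rw [max_eq_left, max_eq_left, sub_zero] <;>
      refine (min_le_right _ _).trans ?_ <;> push_cast <;> [(simp; linarith); simp]
  rw [sqrtHat, h3, Real.sqrt_zero]

theorem sqrtHat_one_of_lt {N j : ℕ} (h : j < N) : sqrtHat N j 1 = 0 := by
  have h1 : (j : ℝ) + 1 ≤ N := by exact_mod_cast h
  have h3 : hatFun N j 1 = 0 := by
    simp only [hatFun, rampFun, min_self, max_eq_right zero_le_one, mul_one]
    rw [min_eq_left, min_eq_left, sub_self] <;> push_cast <;> linarith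
  rw [sqrtHat, h3, Real.sqrt_zero]

theorem sqrtHat_mul_of_lt {N j k : ℕ} (h : j + 1 < k) (t : ℝ) :
    sqrtHat N j t * sqrtHat N k t = 0 := by
  have h1 : (j : ℝ) + 2 ≤ k := by exact_mod_cast h
  suffices hatFun N j t = 0 ∨ hatFun N k t = 0 by
    rcases this with h | h <;> simp [sqrtHat, h]
  simp only [hatFun, rampFun]
  generalize (N : ℝ) * max 0 (min 1 t) = z
  rcases le_total (1 : ℝ) (z - j) with hz | hz
  · left
    rw [min_eq_left, min_eq_left, sub_self] <;> push_cast <;> linarith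
  · right
    rw [max_eq_left, max_eq_left, sub_self] <;>
      refine (min_le_right _ _).trans ?_ <;> push_cast <;> linarith

theorem sqrtHat_mul_eq_zero {N j k : ℕ} (h : j + 1 < k ∨ k + 1 < j) (t : ℝ) :
    sqrtHat N j t * sqrtHat N k t = 0 := by
  rcases h with h | h
  · exact sqrtHat_mul_of_lt h t
  · rw [mul_comm]
    exact sqrtHat_mul_of_lt h t

/-- The nodes `j / N` of the unit interval. -/
def node (N j : ℕ) : unitInterval := projIcc 0 1 zero_le_one ((j : ℝ) / N)

theorem node_zero (N : ℕ) : node N 0 = 0 := by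
  simp [node]

theorem node_self {N : ℕ} (hN : N ≠ 0) : node N N = 1 := by
  simp [node, div_self (Nat.cast_ne_zero (R := ℝ).2 hN)]

theorem dist_node_le {N j k : ℕ} (h1 : j ≤ k + 1) (h2 : k ≤ j + 1) :
    dist (node N j) (node N k) ≤ 1 / N := by
  have h3 : (j : ℝ) ≤ k + 1 := by exact_mod_cast h1
  have h4 : (k : ℝ) ≤ j + 1 := by exact_mod_cast h2
  refine (LipschitzWith.projIcc (zero_le_one (α := ℝ))).dist_le_mul _ _ |>.trans ?_
  rw [NNReal.coe_one, one_mul, Real.dist_eq, ← sub_div, abs_div, Nat.abs_cast]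
  gcongr
  rw [abs_le]
  constructor <;> linarith

end Partition

section Net

variable {A : Type v} {F : Type u} [NonUnitalCStarAlgebra A] [NonUnitalCStarAlgebra F]

/-- The kernel of a *-homomorphism has a net of approximate units which is asymptotically
central in the ambient algebra. -/
theorem exists_quasicentral_net (q : F →⋆ₙₐ[ℂ] A) :
    ∃ h : Finset F × ℕ → F, (∀ p, IsSelfAdjoint (h p)) ∧ (∀ p, ‖h p‖ ≤ 1) ∧ (∀ p, q (h p) = 0) ∧
      (∀ y, Tendsto (fun p => h p * y - y * h p) atTop (𝓝 0)) ∧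
      ∀ y, q y = 0 → Tendsto (fun p => h p * y) atTop (𝓝 y) := by
  classical
  have key : ∀ p : Finset F × ℕ, ∃ h : F, IsSelfAdjoint h ∧ ‖h‖ ≤ 1 ∧ q h = 0 ∧
      (∀ y ∈ p.1.filter (fun y => q y = 0), ‖h * y - y‖ ≤ 1 / ((p.2 : ℝ) + 1)) ∧
      ∀ x ∈ p.1, ‖h * x - x * h‖ ≤ 1 / ((p.2 : ℝ) + 1) := fun p =>
    exists_quasicentral q p.1 (p.1.filter fun y => q y = 0)
      (fun y hy => (Finset.mem_filter.1 hy).2) (by positivity)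
  choose h h1 h2 h3 h4 h5 using key
  have hlim : Tendsto (fun p : Finset F × ℕ => 1 / ((p.2 : ℝ) + 1)) atTop (𝓝 0) := by
    rw [← prod_atTop_atTop_eq]
    exact tendsto_one_div_add_atTop_nhds_zero_nat.comp tendsto_snd
  have hev : ∀ y : F, ∀ᶠ p : Finset F × ℕ in atTop, y ∈ p.1 := by
    intro y
    filter_upwards [eventually_ge_atTop (({y}, 0) : Finset F × ℕ)] with p hp
    exact hp.1 (Finset.mem_singleton_self y)
  refine ⟨h, h1, h2, h3, fun y => ?_, fun y hy => ?_⟩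
  · refine squeeze_zero_norm' ?_ hlim
    filter_upwards [hev y] with p hp using h5 p y hp
  · rw [← tendsto_sub_nhds_zero_iff]
    refine squeeze_zero_norm' ?_ hlim
    filter_upwards [hev y] with p hp using h4 p y (Finset.mem_filter.2 ⟨hp, hy⟩)

end Net

section HatCalculus

variable {B : Type u} [CStarAlgebra B]

theorem isSelfAdjoint_cfc_sqrtHat (N j : ℕ) (h : B) : IsSelfAdjoint (cfc (sqrtHat N j) h) :=
  cfc_predicate _ _

theorem norm_cfc_sqrtHat_le (N j : ℕ) (h : B) : ‖cfc (sqrtHat N j) h‖ ≤ 1 :=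
  norm_cfc_le zero_le_one fun t _ => abs_sqrtHat_le_one N j t

theorem cfc_sqrtHat_comm (N j k : ℕ) (h : B) :
    cfc (sqrtHat N j) h * cfc (sqrtHat N k) h = cfc (sqrtHat N k) h * cfc (sqrtHat N j) h :=
  cfc_commute_cfc _ _ _

theorem cfc_sqrtHat_mul (N j k : ℕ) (h : B) :
    cfc (sqrtHat N j) h * cfc (sqrtHat N k) h = cfc (fun t => sqrtHat N j t * sqrtHat N k t) h :=
  (cfc_mul _ _ _ (continuous_sqrtHat N j).continuousOn (continuous_sqrtHat N k).continuousOn).symm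

theorem sum_cfc_sqrtHat_mul_self (N : ℕ) {h : B} (hh : IsSelfAdjoint h) :
    ∑ j ∈ Finset.range (N + 1), cfc (sqrtHat N j) h * cfc (sqrtHat N j) h = 1 := by
  simp only [cfc_sqrtHat_mul]
  rw [← cfc_sum (fun j t => sqrtHat N j t * sqrtHat N j t) h _ fun j _ =>
    ((continuous_sqrtHat N j).mul (continuous_sqrtHat N j)).continuousOn]
  have : (∑ j ∈ Finset.range (N + 1), fun t => sqrtHat N j t * sqrtHat N j t) = fun _ => 1 := by
    ext t
    simp only [Finset.sum_apply, sqrtHat_mul_self, sum_hatFun]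
  rw [this, cfc_const_one ℝ h]

theorem cfc_sqrtHat_mul_eq_zero {N j k : ℕ} (hjk : j + 1 < k ∨ k + 1 < j) (h : B) :
    cfc (sqrtHat N j) h * cfc (sqrtHat N k) h = 0 := by
  rw [cfc_sqrtHat_mul]
  simp only [sqrtHat_mul_eq_zero hjk]
  exact cfc_const_zero ℝ h

end HatCalculus

section HatMap

variable {F : Type u} [NonUnitalCStarAlgebra F]

/-- Evaluate a path in `F` on a self-adjoint contraction by means of a partition of unity; the
result lives in the unitization. -/
def hatSum (N : ℕ) (h : F) (f : C(unitInterval, F)) : Unitization ℂ F :=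
  ∑ j ∈ Finset.range (N + 1), cfc (sqrtHat N j) (h : Unitization ℂ F) * (f (node N j) : F) *
    cfc (sqrtHat N j) (h : Unitization ℂ F)

/-- Evaluate a path in `F` on a self-adjoint contraction by means of a partition of unity. -/
def hatMap (N : ℕ) (h : F) (f : C(unitInterval, F)) : F := (hatSum N h f).snd

theorem coe_hatMap (N : ℕ) (h : F) (f : C(unitInterval, F)) :
    Unitization.inr (R := ℂ) (hatMap N h f) = hatSum N h f := by
  refine Unitization.ext ?_ rfl
  rw [Unitization.fst_inr, hatSum, ← Unitization.fstHom_apply (R := ℂ), map_sum]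
  symm
  refine Finset.sum_eq_zero fun j _ => ?_
  simp

theorem hatMap_add (N : ℕ) (h : F) (f g : C(unitInterval, F)) :
    hatMap N h (f + g) = hatMap N h f + hatMap N h g := by
  apply Unitization.inr_injective (R := ℂ)
  rw [Unitization.inr_add, coe_hatMap, coe_hatMap, coe_hatMap, hatSum, hatSum, hatSum,
    ← Finset.sum_add_distrib]
  refine Finset.sum_congr rfl fun j _ => ?_
  rw [ContinuousMap.add_apply, Unitization.inr_add, mul_add, add_mul]

theorem hatMap_smul (N : ℕ) (h : F) (c : ℂ) (f : C(unitInterval, F)) :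
    hatMap N h (c • f) = c • hatMap N h f := by
  apply Unitization.inr_injective (R := ℂ)
  rw [Unitization.inr_smul, coe_hatMap, coe_hatMap, hatSum, hatSum, Finset.smul_sum]
  refine Finset.sum_congr rfl fun j _ => ?_
  rw [ContinuousMap.smul_apply, Unitization.inr_smul, mul_smul_comm, smul_mul_assoc]

theorem hatMap_star (N : ℕ) (h : F) (f : C(unitInterval, F)) :
    hatMap N h (star f) = star (hatMap N h f) := by
  apply Unitization.inr_injective (R := ℂ)
  rw [Unitization.inr_star, coe_hatMap, coe_hatMap, hatSum, hatSum, star_sum]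
  refine Finset.sum_congr rfl fun j _ => ?_
  rw [ContinuousMap.star_apply, Unitization.inr_star, star_mul, star_mul,
    (isSelfAdjoint_cfc_sqrtHat N j _).star_eq, mul_assoc]

theorem norm_hatMap_le (N : ℕ) {h : F} (hh : IsSelfAdjoint h) (f : C(unitInterval, F)) :
    ‖hatMap N h f‖ ≤ 2 * ‖f‖ := by
  rw [← Unitization.norm_inr (𝕜 := ℂ) (hatMap N h f), coe_hatMap]
  refine norm_sum_conj_le _ _ _ (fun j _ => isSelfAdjoint_cfc_sqrtHat N j _)
    (sum_cfc_sqrtHat_mul_self N (hh.inr ℂ)) (norm_nonneg _) fun j _ => ?_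
  rw [Unitization.norm_inr]
  exact f.norm_coe_le_norm _

theorem map_hatMap {A : Type v} [NonUnitalCStarAlgebra A] (q : F →⋆ₙₐ[ℂ] A) (N : ℕ) {h : F}
    (hh : IsSelfAdjoint h) (hq : q h = 0) (f : C(unitInterval, F)) :
    q (hatMap N h f) = q (f 0) := by
  set Q : Unitization ℂ F →⋆ₐ[ℂ] Unitization ℂ A := Unitization.starMap q
  have hQ : ∀ x : F, Q (Unitization.inr x) = Unitization.inr (q x) := fun x =>
    Unitization.starMap_inr q x
  have hcont : Continuous Q := AddMonoidHomClass.continuous_of_bound Q 1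
    fun a => by simpa using NonUnitalStarAlgHom.norm_apply_le Q a
  have hcfc : ∀ j, Q (cfc (sqrtHat N j) (h : Unitization ℂ F)) =
      algebraMap ℝ _ (sqrtHat N j 0) := by
    intro j
    rw [StarAlgHom.map_cfc Q (sqrtHat N j) _ (continuous_sqrtHat N j).continuousOn hcont
      (hh.inr ℂ) ((hh.inr ℂ).map Q), hQ, hq, Unitization.inr_zero, cfc_apply_zero]
  apply Unitization.inr_injective (R := ℂ)
  rw [← hQ, coe_hatMap, hatSum, map_sum, Finset.sum_eq_single_of_mem 0 (by simp)]
  · rw [map_mul, map_mul, hcfc, sqrtHat_zero_left, map_one, one_mul, mul_one, hQ, node_zero]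
  · intro j _ hj
    obtain ⟨i, rfl⟩ := Nat.exists_eq_succ_of_ne_zero hj
    rw [map_mul, hcfc, Nat.succ_eq_add_one, sqrtHat_succ_zero, map_zero, mul_zero]

variable {Λ : Type*} {l : Filter Λ} {h : Λ → F}

theorem tendsto_cfc_sqrtHat_comm (hhs : ∀ p, IsSelfAdjoint (h p)) (hh : ∀ p, ‖h p‖ ≤ 1) {y : F}
    (hy : Tendsto (fun p => h p * y - y * h p) l (𝓝 0)) (N j : ℕ) :
    Tendsto (fun p => cfc (sqrtHat N j) (h p : Unitization ℂ F) * (y : Unitization ℂ F) -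
      y * cfc (sqrtHat N j) (h p : Unitization ℂ F)) l (𝓝 0) := by
  refine tendsto_cfc_mul_sub_mul_cfc_self (continuous_sqrtHat N j) (fun p => (hhs p).inr ℂ)
    (fun p => (Unitization.norm_inr (𝕜 := ℂ) (h p)).trans_le (hh p)) ?_
  rw [tendsto_zero_iff_norm_tendsto_zero] at hy ⊢
  refine hy.congr fun p => ?_
  rw [← Unitization.norm_inr (𝕜 := ℂ) (h p * y - y * h p), Unitization.inr_sub,
    Unitization.inr_mul, Unitization.inr_mul]

theorem tendsto_hatMap_zero (hhs : ∀ p, IsSelfAdjoint (h p)) (hh : ∀ p, ‖h p‖ ≤ 1)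
    {f : C(unitInterval, F)} (hf : f 1 = 0)
    (hhf : ∀ t, Tendsto (fun p => h p * f t) l (𝓝 (f t))) {N : ℕ} (hN : N ≠ 0) :
    Tendsto (fun p => hatMap N (h p) f) l (𝓝 0) := by
  have hterm : ∀ j ∈ Finset.range (N + 1),
      Tendsto (fun p => ‖cfc (sqrtHat N j) (h p : Unitization ℂ F) *
        (f (node N j) : Unitization ℂ F)‖) l (𝓝 0) := by
    intro j hj
    rcases (Nat.lt_succ_iff.1 (Finset.mem_range.1 hj)).lt_or_eq with hj | rfl
    · have h1 : Tendsto (fun p => (h p : Unitization ℂ F) * (f (node N j) : Unitization ℂ F)) l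
          (𝓝 (f (node N j) : Unitization ℂ F)) := by
        have := ((Unitization.isometry_inr (𝕜 := ℂ) (A := F)).continuous.tendsto _).comp
          (hhf (node N j))
        simpa [Function.comp_def] using this
      have h2 := tendsto_cfc_mul_of_tendsto_mul (continuous_sqrtHat N j)
        (fun p => (hhs p).inr ℂ)
        (fun p => (Unitization.norm_inr (𝕜 := ℂ) (h p)).trans_le (hh p)) h1
      rw [sqrtHat_one_of_lt hj, zero_smul] at h2
      simpa using h2.norm
    · simpa [node_self hN, hf] using tendsto_const_nhds
  have hsum := tendsto_finsetSum _ hterm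
  rw [Finset.sum_const_zero] at hsum
  refine squeeze_zero_norm (fun p => ?_) hsum
  rw [← Unitization.norm_inr (𝕜 := ℂ) (hatMap N (h p) f), coe_hatMap]
  refine (norm_sum_le _ _).trans (Finset.sum_le_sum fun j _ => ?_)
  exact (norm_mul_le _ _).trans
    (mul_le_of_le_one_right (norm_nonneg _) (norm_cfc_sqrtHat_le N j _))

theorem tendsto_hatMap_mul (hhs : ∀ p, IsSelfAdjoint (h p)) (hh : ∀ p, ‖h p‖ ≤ 1)
    (hc : ∀ y, Tendsto (fun p => h p * y - y * h p) l (𝓝 0)) (f g : C(unitInterval, F)) :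
    Tendsto (fun p : ℕ × Λ => hatMap p.1 (h p.2) f * hatMap p.1 (h p.2) g -
      hatMap p.1 (h p.2) (f * g)) (curry atTop l) (𝓝 0) := by
  rw [Metric.tendsto_nhds]
  intro ε hε
  rw [eventually_curry_iff]
  set K : ℝ := ε / 8
  have hK : 0 < K := by positivity
  have huc := CompactSpace.uniformContinuous_of_continuous g.continuous
  obtain ⟨δ, hδ, hg⟩ := Metric.uniformContinuous_iff.1 huc (K / (‖f‖ + 1)) (by positivity)
  obtain ⟨N₀, hN₀⟩ := exists_nat_gt (1 / δ)
  filter_upwards [eventually_ge_atTop (N₀ + 1)] with N hN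
  have hNδ : 1 / (N : ℝ) < δ := by
    have h1 : (N₀ : ℝ) + 1 ≤ N := by exact_mod_cast hN
    have h2 : 0 < 1 / δ := by positivity
    rw [div_lt_comm₀ (by linarith) hδ]
    linarith
  have hE : Tendsto (fun p => ∑ i ∈ Finset.range (N + 1) ×ˢ Finset.range (N + 1),
      (‖(f (node N i.1) : Unitization ℂ F) * cfc (sqrtHat N i.2) (h p : Unitization ℂ F) -
          cfc (sqrtHat N i.2) (h p : Unitization ℂ F) * (f (node N i.1) : Unitization ℂ F)‖ *
            ‖(g (node N i.2) : Unitization ℂ F)‖ +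
        ‖(f (node N i.1) : Unitization ℂ F)‖ *
          ‖cfc (sqrtHat N i.1) (h p : Unitization ℂ F) * (g (node N i.2) : Unitization ℂ F) -
            (g (node N i.2) : Unitization ℂ F) * cfc (sqrtHat N i.1) (h p : Unitization ℂ F)‖ +
        ‖(f (node N i.1) : Unitization ℂ F) * (g (node N i.1) : Unitization ℂ F) *
            cfc (sqrtHat N i.2) (h p : Unitization ℂ F) -
          cfc (sqrtHat N i.2) (h p : Unitization ℂ F) *
            ((f (node N i.1) : Unitization ℂ F) * (g (node N i.1) : Unitization ℂ F))‖)) l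
      (𝓝 0) := by
    rw [← Finset.sum_const_zero (s := Finset.range (N + 1) ×ˢ Finset.range (N + 1))]
    refine tendsto_finsetSum _ fun i _ => ?_
    have e1 := (tendsto_cfc_sqrtHat_comm hhs hh (hc (f (node N i.1))) N i.2).norm.mul_const
      ‖(g (node N i.2) : Unitization ℂ F)‖
    have e2 := (tendsto_cfc_sqrtHat_comm hhs hh (hc (g (node N i.2))) N i.1).norm.const_mul
      ‖(f (node N i.1) : Unitization ℂ F)‖
    have e3 := (tendsto_cfc_sqrtHat_comm hhs hh (hc (f (node N i.1) * g (node N i.1)))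
      N i.2).norm
    have e := (e1.add e2).add e3
    simp only [norm_zero, zero_mul, mul_zero, add_zero, Unitization.inr_mul] at e
    refine e.congr fun p => ?_
    congr 1
    · congr 2
      exact norm_sub_rev _ _
    · exact norm_sub_rev _ _
  filter_upwards [Metric.tendsto_nhds.1 hE (ε / 2) (by positivity)] with p hp
  rw [dist_zero_right] at hp ⊢
  rw [← Unitization.norm_inr (𝕜 := ℂ), Unitization.inr_sub, Unitization.inr_mul, coe_hatMap,
    coe_hatMap, coe_hatMap]
  have hmain := norm_sum_conj_mul_sub_le (Finset.range (N + 1))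
    (fun j => cfc (sqrtHat N j) (h p : Unitization ℂ F))
    (fun j => (f (node N j) : Unitization ℂ F)) (fun j => (g (node N j) : Unitization ℂ F))
    (fun j _ => isSelfAdjoint_cfc_sqrtHat N j _) (fun j _ => norm_cfc_sqrtHat_le N j _)
    (fun j _ k _ => cfc_sqrtHat_comm N j k _)
    (sum_cfc_sqrtHat_mul_self N ((hhs p).inr ℂ)) hK.le (fun j _ k _ => by
      by_cases hjk : j + 1 < k ∨ k + 1 < j
      · exact Or.inl (cfc_sqrtHat_mul_eq_zero hjk _)
      · right
        push Not at hjk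
        have hd : ‖g (node N k) - g (node N j)‖ < K / (‖f‖ + 1) := by
          rw [← dist_eq_norm]
          exact hg ((dist_node_le hjk.1 hjk.2).trans_lt hNδ)
        rw [← Unitization.inr_sub, ← Unitization.inr_mul, Unitization.norm_inr]
        calc ‖f (node N j) * (g (node N k) - g (node N j))‖
            ≤ (‖f‖ + 1) * (K / (‖f‖ + 1)) := by
              refine (norm_mul_le _ _).trans (mul_le_mul ?_ hd.le (norm_nonneg _) (by positivity))
              exact (f.norm_coe_le_norm _).trans (by linarith)
          _ = K := by field_simp)
  have hmul : hatSum N (h p) (f * g) = ∑ j ∈ Finset.range (N + 1),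
      cfc (sqrtHat N j) (h p : Unitization ℂ F) *
        ((f (node N j) : Unitization ℂ F) * (g (node N j) : Unitization ℂ F)) *
        cfc (sqrtHat N j) (h p : Unitization ℂ F) := by
    simp only [hatSum, ContinuousMap.mul_apply, Unitization.inr_mul]
  rw [hmul]
  refine hmain.trans_lt ?_
  have hp' := (le_abs_self _).trans_lt hp
  have hKε : 2 * K = ε / 4 := by simp only [K]; ring
  linarith

end HatMap

section Lifting

/-- Morphisms out of a projective C*-algebra lift through arbitrary *-homomorphisms, as soon as
each individual value lifts. -/
theorem IsProjective.exists_lift {F C D : Type u} [NonUnitalCStarAlgebra F]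
    [NonUnitalCStarAlgebra C] [NonUnitalCStarAlgebra D] (hF : IsProjective F)
    (π : C →⋆ₙₐ[ℂ] D) (σ : F →⋆ₙₐ[ℂ] D) (h : ∀ x, ∃ c, π c = σ x) :
    ∃ ψ : F →⋆ₙₐ[ℂ] C, ∀ x, π (ψ x) = σ x := by
  have hcl : IsClosed (NonUnitalStarAlgHom.range π : Set D) := by
    have := π.isClosed_range_of_cstar
    rwa [← NonUnitalStarAlgHom.coe_range] at this
  obtain ⟨ψ, hψ⟩ := hF C (NonUnitalStarAlgHom.range π) (NonUnitalStarAlgHom.rangeRestrict π)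
    (by
      rintro ⟨_, c, rfl⟩
      exact ⟨c, rfl⟩)
    (NonUnitalStarAlgHom.codRestrict σ (NonUnitalStarAlgHom.range π)
      fun x => (NonUnitalStarAlgHom.mem_range π).2 (h x))
  exact ⟨ψ, fun x => congrArg Subtype.val (DFunLike.congr_fun hψ x)⟩

/-- Postcomposition with a *-homomorphism. -/
def NonUnitalStarAlgHom.compPath {A : Type v} {F : Type u} [NonUnitalCStarAlgebra A]
    [NonUnitalCStarAlgebra F] (q : F →⋆ₙₐ[ℂ] A) : C(unitInterval, F) →⋆ₙₐ[ℂ] C(unitInterval, A) where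
  toFun f := ⟨fun t => q (f t), q.continuous_of_cstar.comp f.continuous⟩
  map_smul' c f := by ext t; simp
  map_zero' := by ext t; simp
  map_add' f g := by ext t; simp
  map_mul' f g := by ext t; simp
  map_star' f := by ext t; simp [map_star]

theorem NonUnitalStarAlgHom.compPath_surjective {A : Type v} {F : Type u} [NonUnitalCStarAlgebra A]
    [NonUnitalCStarAlgebra F] {q : F →⋆ₙₐ[ℂ] A} (hq : Function.Surjective q) :
    Function.Surjective q.compPath := by
  rw [← Set.range_eq_univ, ← q.compPath.isClosed_range_of_cstar.closure_eq]
  refine Set.eq_univ_of_forall fun g => Metric.mem_closure_iff.2 fun ε hε => ?_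
  have hconv : ∀ s : unitInterval, Convex ℝ {y : F | ‖g s - q y‖ < ε} := by
    intro s y hy z hz a b ha hb hab
    have hy' : ‖g s - q y‖ < ε := hy
    have hz' : ‖g s - q z‖ < ε := hz
    have e : g s - q (a • y + b • z) = a • (g s - q y) + b • (g s - q z) := by
      have : g s = a • g s + b • g s := by rw [← add_smul, hab, one_smul]
      rw [map_add, map_real_smul q q.continuous_of_cstar, map_real_smul q q.continuous_of_cstar]
      conv_lhs => rw [this]
      module
    have := convex_ball (0 : A) ε (show g s - q y ∈ _ by simpa using hy')
      (show g s - q z ∈ _ by simpa using hz') ha hb hab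
    rw [← e, mem_ball_zero_iff] at this
    exact this
  have hloc : ∀ s : unitInterval, ∃ y : F, ∀ᶠ s' in 𝓝 s, y ∈ {y : F | ‖g s' - q y‖ < ε} := by
    intro s
    obtain ⟨y, hy⟩ := hq (g s)
    refine ⟨y, ?_⟩
    have : Tendsto (fun s' => ‖g s' - q y‖) (𝓝 s) (𝓝 0) := by
      have := (g.continuous.sub (continuous_const (y := q y))).norm.tendsto s
      simpa [hy] using this
    exact this.eventually (gt_mem_nhds hε)
  obtain ⟨f, hf⟩ := exists_continuous_forall_mem_convex_of_local_const hconv hloc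
  refine ⟨_, ⟨f, rfl⟩, ?_⟩
  rw [ContinuousMap.dist_lt_iff hε]
  intro s
  rw [dist_eq_norm]
  exact hf s

end Lifting

section Asymptotic

open BoundedContinuousFunction

variable {A F ι : Type u} [NonUnitalCStarAlgebra A] [NonUnitalCStarAlgebra F]
  (l : Filter ι) (q : F →⋆ₙₐ[ℂ] A)
  (Φ : ι → C(unitInterval, F) → F)

/-- An asymptotic morphism from paths in `F` to `F` covering evaluation at `0`. -/
structure IsAsymptoticEval : Prop where
  map_add : ∀ p f g, Φ p (f + g) = Φ p f + Φ p g
  map_smul : ∀ p (c : ℂ) f, Φ p (c • f) = c • Φ p f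
  map_star : ∀ p f, Φ p (star f) = star (Φ p f)
  norm_le : ∀ p f, ‖Φ p f‖ ≤ 2 * ‖f‖
  map_mul : ∀ f g, Tendsto (fun p => Φ p f * Φ p g - Φ p (f * g)) l (𝓝 0)
  map_eq : ∀ p f, q (Φ p f) = q (f 0)
  tendsto_zero : ∀ f : C(unitInterval, F), f 1 = 0 → (∀ t, q (f t) = 0) →
    Tendsto (fun p => Φ p f) l (𝓝 0)

variable {l q Φ}

theorem IsAsymptoticEval.map_sub (hΦ : IsAsymptoticEval l q Φ) (p : ι)
    (f g : C(unitInterval, F)) :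
    Φ p (f - g) = Φ p f - Φ p g := by
  have := hΦ.map_smul p (-1) g
  rw [neg_one_smul, neg_one_smul] at this
  rw [sub_eq_add_neg, hΦ.map_add, this, sub_eq_add_neg]

variable [TopologicalSpace ι]

/-- The algebra of paths ending at `0` together with an asymptotic representative of their
image. -/
def IsAsymptoticEval.graph (hΦ : IsAsymptoticEval l q Φ) :
    NonUnitalStarSubalgebra ℂ (C(unitInterval, F) × (ι →ᵇ F)) where
  carrier := {x | x.1 1 = 0 ∧ Tendsto (fun p => x.2 p - Φ p x.1) l (𝓝 0) ∧
    ∀ p, q (x.2 p) = q (x.1 0)}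
  zero_mem' := by
    have : ∀ p, Φ p 0 = 0 := fun p => by simpa using hΦ.map_smul p 0 0
    refine ⟨rfl, ?_, fun p => rfl⟩
    simpa [this] using tendsto_const_nhds
  add_mem' := by
    rintro ⟨f, b⟩ ⟨g, c⟩ ⟨h1, h2, h3⟩ ⟨k1, k2, k3⟩
    refine ⟨by simp_all, ?_, fun p => by simp_all⟩
    have := h2.add k2
    rw [add_zero] at this
    refine this.congr fun p => ?_
    simp only [Prod.mk_add_mk, BoundedContinuousFunction.add_apply, hΦ.map_add]
    abel
  smul_mem' := by
    rintro c ⟨f, b⟩ ⟨h1, h2, h3⟩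
    refine ⟨by simp_all, ?_, fun p => by simp_all⟩
    have := h2.const_smul c
    rw [smul_zero] at this
    refine this.congr fun p => ?_
    simp only [Prod.smul_mk, BoundedContinuousFunction.smul_apply, hΦ.map_smul, smul_sub]
  star_mem' := by
    rintro ⟨f, b⟩ ⟨h1, h2, h3⟩
    refine ⟨by simp_all, ?_, fun p => by simp_all [StarHomClass.map_star]⟩
    have := h2.star
    rw [star_zero] at this
    refine this.congr fun p => ?_
    simp only [Prod.star_def, BoundedContinuousFunction.star_apply, hΦ.map_star, star_sub]
  mul_mem' := by
    rintro ⟨f, b⟩ ⟨g, c⟩ ⟨h1, h2, h3⟩ ⟨k1, k2, k3⟩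
    refine ⟨by simp_all, ?_, fun p => by simp_all⟩
    have := ((h2.norm.mul_const ‖c‖).add (k2.norm.const_mul (2 * ‖f‖))).add (hΦ.map_mul f g).norm
    simp only [norm_zero, zero_mul, mul_zero, add_zero] at this
    refine squeeze_zero_norm (fun p => ?_) this
    have e : b p * c p - Φ p (f * g) = (b p - Φ p f) * c p + Φ p f * (c p - Φ p g) +
        (Φ p f * Φ p g - Φ p (f * g)) := by noncomm_ring
    simp only [Prod.mk_mul_mk, BoundedContinuousFunction.mul_apply]
    rw [e]
    refine (norm_add_le _ _).trans (add_le_add ((norm_add_le _ _).trans (add_le_add ?_ ?_)) le_rfl)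
    · refine (norm_mul_le _ _).trans ?_
      gcongr
      exact c.norm_coe_le_norm p
    · refine (norm_mul_le _ _).trans ?_
      gcongr
      exact hΦ.norm_le p f

theorem IsAsymptoticEval.mem_graph (hΦ : IsAsymptoticEval l q Φ)
    {x : C(unitInterval, F) × (ι →ᵇ F)} :
    x ∈ hΦ.graph ↔ x.1 1 = 0 ∧ Tendsto (fun p => x.2 p - Φ p x.1) l (𝓝 0) ∧
      ∀ p, q (x.2 p) = q (x.1 0) := Iff.rfl

theorem IsAsymptoticEval.isClosed_graph (hΦ : IsAsymptoticEval l q Φ) :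
    IsClosed (hΦ.graph : Set (C(unitInterval, F) × (ι →ᵇ F))) := by
  have hq := q.continuous_of_cstar
  have h1 : IsClosed {x : C(unitInterval, F) × (ι →ᵇ F) | x.1 1 = 0} :=
    isClosed_eq ((continuous_eval_const (F := C(unitInterval, F)) 1).comp continuous_fst) continuous_const
  have h3 : IsClosed {x : C(unitInterval, F) × (ι →ᵇ F) | ∀ p, q (x.2 p) = q (x.1 0)} := by
    rw [Set.ofPred_forall]
    refine isClosed_iInter fun p => isClosed_eq (hq.comp ?_) (hq.comp ?_)
    · exact (continuous_eval_const (F := ι →ᵇ F) p).comp continuous_snd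
    · exact (continuous_eval_const (F := C(unitInterval, F)) 0).comp continuous_fst
  have h2 : IsClosed {x : C(unitInterval, F) × (ι →ᵇ F) |
      Tendsto (fun p => x.2 p - Φ p x.1) l (𝓝 0)} := by
    refine isClosed_of_closure_subset fun x hx => ?_
    change Tendsto _ _ _
    rw [Metric.tendsto_nhds]
    intro ε hε
    obtain ⟨y, hy, hxy⟩ := Metric.mem_closure_iff.1 hx (ε / 4) (by positivity)
    rw [Prod.dist_eq, max_lt_iff] at hxy
    filter_upwards [Metric.tendsto_nhds.1 hy (ε / 4) (by positivity)] with p hp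
    rw [dist_zero_right] at hp ⊢
    have e : x.2 p - Φ p x.1 = (x.2 p - y.2 p) + (y.2 p - Φ p y.1) - Φ p (x.1 - y.1) := by
      rw [hΦ.map_sub]; abel
    have e1 : ‖x.2 p - y.2 p‖ < ε / 4 := by
      rw [← dist_eq_norm]
      exact (BoundedContinuousFunction.dist_coe_le_dist p).trans_lt hxy.2
    have e2 : ‖Φ p (x.1 - y.1)‖ < 2 * (ε / 4) := by
      refine (hΦ.norm_le p _).trans_lt ?_
      rw [← dist_eq_norm]
      linarith [hxy.1]
    rw [e]
    have := norm_sub_le ((x.2 p - y.2 p) + (y.2 p - Φ p y.1)) (Φ p (x.1 - y.1))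
    have := norm_add_le (x.2 p - y.2 p) (y.2 p - Φ p y.1)
    linarith
  exact h1.inter (h2.inter h3)

/-- Lifting a null-homotopy of `A` to a projective algebra over `A` by means of an asymptotic
evaluation yields endomorphisms over `A` which asymptotically annihilate the kernel. -/
theorem IsAsymptoticEval.exists_endomorphisms [DiscreteTopology ι]
    (hΦ : IsAsymptoticEval l q Φ) (hF : IsProjective F) (hq : Function.Surjective q)
    (hA : Contractible A) :
    ∃ ψ : ι → F →⋆ₙₐ[ℂ] F, (∀ p x, q (ψ p x) = q x) ∧
      ∀ x, q x = 0 → Tendsto (fun p => ψ p x) l (𝓝 0) := by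
  obtain ⟨H, H0, H1⟩ := hA
  have := hΦ.isClosed_graph
  let π : hΦ.graph →⋆ₙₐ[ℂ] C(unitInterval, A) :=
    (q.compPath.comp (NonUnitalStarAlgHom.fst ℂ _ _)).comp
      (NonUnitalStarSubalgebraClass.subtype hΦ.graph)
  have hπ : ∀ (x : hΦ.graph) t, π x t = q (x.1.1 t) := fun _ _ => rfl
  have hlift : ∀ x, ∃ c, π c = (H.comp q) x := by
    intro x
    obtain ⟨g, hg⟩ := NonUnitalStarAlgHom.compPath_surjective hq (H (q x))
    have hg' : ∀ t, q (g t) = H (q x) t := fun t => DFunLike.congr_fun hg t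
    let f : C(unitInterval, F) := g - ContinuousMap.const _ (g 1)
    have hf : ∀ t, q (f t) = H (q x) t := by
      intro t
      change q (g t - g 1) = _
      rw [_root_.map_sub, hg', hg', H1]
      simp
    let b : ι →ᵇ F := BoundedContinuousFunction.ofNormedAddCommGroupDiscrete
      (fun p => Φ p f) (2 * ‖f‖) fun p => hΦ.norm_le p f
    refine ⟨⟨(f, b), hΦ.mem_graph.2 ⟨sub_self (g 1), ?_, fun p => hΦ.map_eq p f⟩⟩, ?_⟩
    · have : ∀ p, b p - Φ p f = 0 := fun p => sub_self (Φ p f)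
      simpa [this] using tendsto_const_nhds
    · ext t
      rw [hπ]
      exact hf t
  obtain ⟨Ψ, hΨ⟩ := hF.exists_lift π (H.comp q) hlift
  have hval : ∀ x t, q ((Ψ x).1.1 t) = H (q x) t := fun x t => by
    rw [← hπ, hΨ]; rfl
  let ev : ∀ p : ι, (ι →ᵇ F) →⋆ₙₐ[ℂ] F := fun p =>
    { toFun := fun b => b p
      map_smul' := fun _ _ => rfl
      map_zero' := rfl
      map_add' := fun _ _ => rfl
      map_mul' := fun _ _ => rfl
      map_star' := fun _ => rfl }
  let ψ : ι → F →⋆ₙₐ[ℂ] F := fun p =>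
    (((ev p).comp (NonUnitalStarAlgHom.snd ℂ _ _)).comp
      (NonUnitalStarSubalgebraClass.subtype hΦ.graph)).comp Ψ
  have hψ : ∀ p x, ψ p x = (Ψ x).1.2 p := fun _ _ => rfl
  refine ⟨ψ, fun p x => ?_, fun x hx => ?_⟩
  · rw [hψ, (hΦ.mem_graph.1 (Ψ x).2).2.2 p, hval, H0]
    rfl
  · obtain ⟨h1, h2, h3⟩ := hΦ.mem_graph.1 (Ψ x).2
    have h4 := hΦ.tendsto_zero (Ψ x).1.1 h1 fun t => by rw [hval, hx, map_zero]; rfl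
    have := h2.add h4
    rw [add_zero] at this
    exact this.congr fun p => by rw [sub_add_cancel, hψ]

end Asymptotic

section Endomorphisms

variable {A F : Type u} [NonUnitalCStarAlgebra A] [NonUnitalCStarAlgebra F]

/-- A projective algebra over a contractible one has endomorphisms over it that are arbitrarily
small on any finite part of the kernel. -/
theorem IsProjective.exists_endomorphism_small_on_kernel (hF : IsProjective F) {q : F →⋆ₙₐ[ℂ] A}
    (hq : Function.Surjective q) (hA : Contractible A) (G : Finset F) {ε : ℝ} (hε : 0 < ε) :
    ∃ ψ : F →⋆ₙₐ[ℂ] F, (∀ x, q (ψ x) = q x) ∧ ∀ x ∈ G, q x = 0 → ‖ψ x‖ ≤ ε := by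
  classical
  obtain ⟨h, hs, hn, hq0, hc, hk⟩ := exists_quasicentral_net q
  let _ : TopologicalSpace (ℕ × (Finset F × ℕ)) := ⊥
  have : DiscreteTopology (ℕ × (Finset F × ℕ)) := ⟨rfl⟩
  have hΦ : IsAsymptoticEval (curry atTop atTop) q
      (fun (p : ℕ × (Finset F × ℕ)) f => hatMap p.1 (h p.2) f) :=
    { map_add := fun p => hatMap_add p.1 (h p.2)
      map_smul := fun p => hatMap_smul p.1 (h p.2)
      map_star := fun p => hatMap_star p.1 (h p.2)
      norm_le := fun p => norm_hatMap_le p.1 (hs p.2)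
      map_mul := tendsto_hatMap_mul hs hn hc
      map_eq := fun p => map_hatMap q p.1 (hs p.2) (hq0 p.2)
      tendsto_zero := fun f hf hqf => by
        rw [Metric.tendsto_nhds]
        intro δ hδ
        rw [eventually_curry_iff]
        filter_upwards [eventually_ne_atTop 0] with N hN
        exact Metric.tendsto_nhds.1
          (tendsto_hatMap_zero hs hn hf (fun t => hk (f t) (hqf t)) hN) δ hδ }
  obtain ⟨ψ, hψ, hlim⟩ := hΦ.exists_endomorphisms hF hq hA
  have hev : ∀ᶠ p in curry atTop atTop, ∀ x ∈ G, q x = 0 → ‖ψ p x‖ ≤ ε := by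
    rw [Finset.eventually_all]
    intro x _
    by_cases hx : q x = 0
    · filter_upwards [Metric.tendsto_nhds.1 (hlim x hx) ε hε] with p hp _
      rw [dist_zero_right] at hp
      exact hp.le
    · exact Eventually.of_forall fun p hx' => absurd hx' hx
  obtain ⟨N, hN⟩ := (eventually_curry_iff.1 hev).exists
  obtain ⟨p, hp⟩ := hN.exists
  exact ⟨ψ (N, p), hψ (N, p), hp⟩

end Endomorphisms

section Generated

theorem Set.Countable.subsemigroup_closure {M : Type*} [Semigroup M] {s : Set M}
    (hs : s.Countable) : (Subsemigroup.closure s : Set M).Countable := by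
  have := hs.to_subtype
  have hinj : Function.Injective fun w : FreeSemigroup s => (w.head, w.tail) := by
    rintro ⟨a, b⟩ ⟨c, d⟩ h
    simpa using h
  have := hinj.countable
  have hle : Subsemigroup.closure s ≤ (FreeSemigroup.lift (Subtype.val : s → M)).srange :=
    Subsemigroup.closure_le.2 fun x hx => ⟨FreeSemigroup.of ⟨x, hx⟩, rfl⟩
  exact (countable_range (FreeSemigroup.lift (Subtype.val : s → M))).mono hle

theorem isSeparable_topologicalClosure_adjoin {L : Type*} [NonUnitalCStarAlgebra L] {s : Set L}
    (hs : s.Countable) :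
    TopologicalSpace.IsSeparable
      ((NonUnitalStarAlgebra.adjoin ℂ s).topologicalClosure : Set L) := by
  have h1 : (s ∪ star s).Countable := by
    refine hs.union ?_
    rw [← Set.image_star]
    exact hs.image _
  have h2 := (h1.subsemigroup_closure.isSeparable).span (R := ℂ)
  rw [← NonUnitalStarAlgebra.adjoin_eq_span] at h2
  exact h2.closure

theorem small_of_separableSpace (T : Type v) [MetricSpace T] [TopologicalSpace.SeparableSpace T] :
    Small.{u} T := by
  cases isEmpty_or_nonempty T with
  | inl h => exact small_of_injective (β := PEmpty.{u + 1}) (f := h.elim) fun x => h.elim x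
  | inr h =>
    refine small_of_injective (β := ℕ → ℝ) (f := fun x n => dist x (TopologicalSpace.denseSeq T n))
      fun x y hxy => ?_
    refine eq_of_forall_dist_le fun ε hε => ?_
    obtain ⟨n, hn⟩ := (TopologicalSpace.denseRange_denseSeq T).exists_dist_lt x (half_pos hε)
    have : dist x (TopologicalSpace.denseSeq T n) = dist y (TopologicalSpace.denseSeq T n) :=
      congrFun hxy n
    have h2 := dist_triangle_right x y (TopologicalSpace.denseSeq T n)
    linarith

theorem NonUnitalStarAlgHom.ext_topologicalClosure_adjoin {L : Type u} {C : Type v}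
    [NonUnitalCStarAlgebra L] [NonUnitalCStarAlgebra C] {s : Set L}
    [IsClosed ((NonUnitalStarAlgebra.adjoin ℂ s).topologicalClosure : Set L)]
    {φ ψ : (NonUnitalStarAlgebra.adjoin ℂ s).topologicalClosure →⋆ₙₐ[ℂ] C}
    (h : ∀ x : (NonUnitalStarAlgebra.adjoin ℂ s).topologicalClosure, x.1 ∈ s → φ x = ψ x) :
    φ = ψ := by
  have hle := NonUnitalStarSubalgebra.le_topologicalClosure (NonUnitalStarAlgebra.adjoin ℂ s)
  have key : ∀ x (hx : x ∈ NonUnitalStarAlgebra.adjoin ℂ s), φ ⟨x, hle hx⟩ = ψ ⟨x, hle hx⟩ := by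
    intro x hx
    induction hx using NonUnitalStarAlgebra.adjoin_induction with
    | mem x hx => exact h _ hx
    | add x y hx hy h1 h2 =>
      have := congrArg₂ (· + ·) h1 h2
      simp only [← map_add] at this
      exact this
    | zero => exact (map_zero φ).trans (map_zero ψ).symm
    | mul x y hx hy h1 h2 =>
      have := congrArg₂ (· * ·) h1 h2
      simp only [← map_mul] at this
      exact this
    | smul r x hx h1 =>
      have := congrArg (r • ·) h1
      simp only [← map_smul] at this
      exact this
    | star x hx h1 =>
      have := congrArg star h1
      simp only [← map_star] at this
      exact this
  have hd : Dense {x : (NonUnitalStarAlgebra.adjoin ℂ s).topologicalClosure |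
      x.1 ∈ NonUnitalStarAlgebra.adjoin ℂ s} := by
    intro x
    rw [closure_subtype]
    refine closure_mono ?_ x.2
    intro y hy
    exact ⟨⟨y, hle hy⟩, hy, rfl⟩
  have hcl := Continuous.ext_on hd φ.continuous_of_cstar ψ.continuous_of_cstar
    fun x hx => key x.1 hx
  exact DFunLike.coe_injective hcl

end Generated

section Transport

variable {T : Type u} {C : Type v} [NonUnitalCStarAlgebra C]

/-- Transport a C*-algebra structure along a bijection. -/
abbrev Equiv.nonUnitalCStarAlgebra (e : T ≃ C) : NonUnitalCStarAlgebra T :=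
  letI : NonUnitalRing T := e.nonUnitalRing
  have hadd : ∀ x y : T, e (x + y) = e x + e y := fun _ _ => e.apply_symm_apply _
  have hmul : ∀ x y : T, e (x * y) = e x * e y := fun _ _ => e.apply_symm_apply _
  have hzero : e 0 = 0 := e.apply_symm_apply _
  letI : NonUnitalNormedRing T := NonUnitalNormedRing.induced T C e.ringEquiv e.injective
  have hnorm : ∀ x : T, ‖x‖ = ‖e x‖ := fun _ => rfl
  have hiso : Isometry e := Isometry.of_dist_eq fun _ _ => rfl
  letI : Star T := ⟨fun x => e.symm (star (e x))⟩
  have hstar : ∀ x : T, e (star x) = star (e x) := fun x => e.apply_symm_apply _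
  letI : SMul ℂ T := ⟨fun c x => e.symm (c • e x)⟩
  have hsmul : ∀ (c : ℂ) (x : T), e (c • x) = c • e x := fun c x => e.apply_symm_apply _
  { (inferInstance : NonUnitalNormedRing T), (inferInstance : Star T),
      (inferInstance : SMul ℂ T) with
    star_involutive := fun x => e.injective (by simp only [hstar, star_star])
    star_mul := fun x y => e.injective (by simp only [hstar, hmul, star_mul])
    star_add := fun x y => e.injective (by simp only [hstar, hadd, star_add])
    one_smul := fun x => e.injective (by simp only [hsmul, one_smul])
    mul_smul := fun c d x => e.injective (by simp only [hsmul, mul_smul])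
    smul_zero := fun c => e.injective (by simp only [hsmul, hzero, smul_zero])
    smul_add := fun c x y => e.injective (by simp only [hsmul, hadd, smul_add])
    add_smul := fun c d x => e.injective (by simp only [hsmul, hadd, add_smul])
    zero_smul := fun x => e.injective (by simp only [hsmul, hzero, zero_smul])
    norm_smul_le := fun c x => by rw [hnorm, hnorm, hsmul]; exact norm_smul_le c (e x)
    smul_assoc := fun c x y => e.injective (by
      simp only [smul_eq_mul, hsmul, hmul, smul_mul_assoc])
    smul_comm := fun c x y => e.injective (by
      simp only [smul_eq_mul, hsmul, hmul, mul_smul_comm])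
    star_smul := fun c x => e.injective (by simp only [hstar, hsmul, star_smul])
    complete := ((hiso.isUniformInducing.completeSpace_congr e.surjective).2
      inferInstance).complete
    norm_mul_self_le := fun x => by
      rw [hnorm, hnorm, hmul, hstar]
      exact CStarRing.norm_mul_self_le (e x) }

/-- A bijection as an isomorphism from the transported C*-algebra structure. -/
def Equiv.cstarEquiv (e : T ≃ C) :
    letI := e.nonUnitalCStarAlgebra
    T ≃⋆ₐ[ℂ] C :=
  letI := e.nonUnitalCStarAlgebra
  { e with
    map_mul' := fun _ _ => e.apply_symm_apply _
    map_add' := fun _ _ => e.apply_symm_apply _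
    map_star' := fun _ => e.apply_symm_apply _
    map_smul' := fun _ _ => e.apply_symm_apply _ }

theorem exists_cstarEquiv_of_small (C : Type v) [NonUnitalCStarAlgebra C] [Small.{u} C] :
    ∃ (T : Type u) (_ : NonUnitalCStarAlgebra T), Nonempty (T ≃⋆ₐ[ℂ] C) :=
  ⟨Shrink.{u} C, (equivShrink C).symm.nonUnitalCStarAlgebra, ⟨(equivShrink C).symm.cstarEquiv⟩⟩

end Transport

section Free

open scoped ENNReal

/-- A C*-algebra together with a sequence of self-adjoint contractions. -/
structure ContractionSequence : Type (u + 1) where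
  C : Type u
  inst : NonUnitalCStarAlgebra C
  c : ℕ → C
  isSelfAdjoint : ∀ n, IsSelfAdjoint (c n)
  norm_le_one : ∀ n, ‖c n‖ ≤ 1

attribute [instance] ContractionSequence.inst

namespace ContractionSequence

/-- The universal sequence of self-adjoint contractions. -/
def universal (n : ℕ) : lp (fun i : ContractionSequence.{u} => i.C) ∞ :=
  ⟨fun i => i.c n, memℓp_infty ⟨1, by rintro _ ⟨i, rfl⟩; exact i.norm_le_one n⟩⟩

theorem isSelfAdjoint_universal (n : ℕ) : IsSelfAdjoint (universal.{u} n) := by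
  refine lp.ext (funext fun i => ?_)
  rw [lp.coeFn_star]
  exact i.isSelfAdjoint n

theorem norm_universal_le_one (n : ℕ) : ‖universal.{u} n‖ ≤ 1 :=
  lp.norm_le_of_forall_le zero_le_one fun i => i.norm_le_one n

/-- Evaluation at one of the factors. -/
def eval (i : ContractionSequence.{u}) :
    lp (fun i : ContractionSequence.{u} => i.C) ∞ →⋆ₙₐ[ℂ] i.C where
  toFun f := f i
  map_smul' _ _ := rfl
  map_zero' := rfl
  map_add' _ _ := rfl
  map_mul' _ _ := rfl
  map_star' _ := rfl

end ContractionSequence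

open ContractionSequence in
theorem exists_free_contractions :
    ∃ (F : Type u) (_ : NonUnitalCStarAlgebra F) (X : ℕ → F),
      TopologicalSpace.SeparableSpace F ∧ (∀ n, IsSelfAdjoint (X n)) ∧ (∀ n, ‖X n‖ ≤ 1) ∧
      (∀ (C : Type u) [NonUnitalCStarAlgebra C] (c : ℕ → C), (∀ n, IsSelfAdjoint (c n)) →
        (∀ n, ‖c n‖ ≤ 1) → ∃ φ : F →⋆ₙₐ[ℂ] C, ∀ n, φ (X n) = c n) ∧
      (∀ (C : Type u) [NonUnitalCStarAlgebra C] (φ ψ : F →⋆ₙₐ[ℂ] C),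
        (∀ n, φ (X n) = ψ (X n)) → φ = ψ) := by
  let S := (NonUnitalStarAlgebra.adjoin ℂ (range universal.{u})).topologicalClosure
  have hS : IsClosed (S : Set (lp (fun i : ContractionSequence.{u} => i.C) ∞)) :=
    NonUnitalStarSubalgebra.isClosed_topologicalClosure _
  have hsep : TopologicalSpace.SeparableSpace S :=
    (isSeparable_topologicalClosure_adjoin (countable_range universal.{u})).separableSpace
  have hsmall : Small.{u} S := small_of_separableSpace S
  obtain ⟨F, instF, ⟨e⟩⟩ := exists_cstarEquiv_of_small.{u} S
  have hX : ∀ n, universal n ∈ S := fun n =>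
    NonUnitalStarSubalgebra.le_topologicalClosure _
      (NonUnitalStarAlgebra.subset_adjoin ℂ _ (mem_range_self n))
  let f : F →⋆ₙₐ[ℂ] S := e
  let g : S →⋆ₙₐ[ℂ] F := e.symm
  have hfg : ∀ x, f (g x) = x := e.apply_symm_apply
  have hgf : ∀ x, g (f x) = x := e.symm_apply_apply
  refine ⟨F, instF, fun n => g ⟨universal n, hX n⟩, ?_, ?_, ?_, ?_, ?_⟩
  · exact (Function.LeftInverse.surjective hgf).denseRange.separableSpace g.continuous_of_cstar
  · intro n
    have : IsSelfAdjoint (⟨universal n, hX n⟩ : S) := Subtype.ext (isSelfAdjoint_universal n)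
    exact this.map g
  · exact fun n => (NonUnitalStarAlgHom.norm_apply_le g _).trans (norm_universal_le_one n)
  · intro C _ c hc hc1
    refine ⟨((eval ⟨C, _, c, hc, hc1⟩).comp
      (NonUnitalStarSubalgebraClass.subtype S)).comp f, fun n => ?_⟩
    simp only [NonUnitalStarAlgHom.comp_apply, hfg]
    rfl
  · intro C _ φ ψ h
    have : φ.comp g = ψ.comp g := by
      refine NonUnitalStarAlgHom.ext_topologicalClosure_adjoin ?_
      rintro ⟨x, hx⟩ ⟨n, rfl⟩
      exact h n
    ext x
    have := DFunLike.congr_fun this (f x)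
    simpa [hgf] using this

/-- A separable C*-algebra is a quotient of a separable projective C*-algebra. -/
theorem exists_projective_cover (A : Type u) [NonUnitalCStarAlgebra A]
    [TopologicalSpace.SeparableSpace A] :
    ∃ (F : Type u) (_ : NonUnitalCStarAlgebra F) (q : F →⋆ₙₐ[ℂ] A),
      TopologicalSpace.SeparableSpace F ∧ IsProjective F ∧ Function.Surjective q := by
  obtain ⟨F, _, X, hsep, hsa, hnorm, hex, hext⟩ := exists_free_contractions.{u}
  let B : Set A := {a | IsSelfAdjoint a ∧ ‖a‖ ≤ 1}
  have : Nonempty B := ⟨⟨0, .zero A, by simp⟩⟩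
  obtain ⟨q, hq⟩ := hex A (fun n => (TopologicalSpace.denseSeq B n).1)
    (fun n => (TopologicalSpace.denseSeq B n).2.1) (fun n => (TopologicalSpace.denseSeq B n).2.2)
  refine ⟨F, _, q, hsep, ?_, ?_⟩
  · intro C D _ _ π hπ σ
    have hlift : ∀ n, ∃ c : C, IsSelfAdjoint c ∧ ‖c‖ ≤ 1 ∧ π c = σ (X n) := by
      intro n
      obtain ⟨c, hc⟩ := hπ (σ (X n))
      have h1 : π (realPart c : C) = σ (X n) := by
        rw [realPart_apply_coe, map_real_smul π π.continuous_of_cstar, map_add, map_star, hc,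
          ((hsa n).map σ).star_eq, ← two_smul ℝ, smul_smul]
        norm_num
      obtain ⟨b, hb, hb1, hb2⟩ := exists_isSelfAdjoint_norm_le_map_eq π (realPart c).2 (r := 1)
        (h1 ▸ (NonUnitalStarAlgHom.norm_apply_le σ _).trans (hnorm n))
      exact ⟨b, hb, hb1, hb2.trans h1⟩
    choose c hc hc1 hc2 using hlift
    obtain ⟨ψ, hψ⟩ := hex C c hc hc1
    refine ⟨ψ, hext _ _ _ fun n => ?_⟩
    simp [hψ, hc2]
  · have hB : ∀ a ∈ B, a ∈ range q := by
      intro a ha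
      have hd := (TopologicalSpace.denseRange_denseSeq B) ⟨a, ha⟩
      rw [closure_subtype] at hd
      have : closure (range q) = range q := q.isClosed_range_of_cstar.closure_eq
      rw [← this]
      refine closure_mono ?_ hd
      rintro _ ⟨_, ⟨n, rfl⟩, rfl⟩
      exact ⟨X n, hq n⟩
    have hself : ∀ a : A, IsSelfAdjoint a → a ∈ range q := by
      intro a ha
      have hpos : (0 : ℝ) < ‖a‖ + 1 := by positivity
      obtain ⟨x, hx⟩ := hB ((‖a‖ + 1)⁻¹ • a) ⟨(IsSelfAdjoint.all _).smul ha, by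
        rw [norm_smul, norm_inv, Real.norm_of_nonneg hpos.le, inv_mul_le_iff₀ hpos]
        linarith⟩
      refine ⟨(‖a‖ + 1) • x, ?_⟩
      rw [map_real_smul q q.continuous_of_cstar, hx, smul_smul, mul_inv_cancel₀ hpos.ne', one_smul]
    intro a
    obtain ⟨x, hx⟩ := hself (realPart a : A) (realPart a).2
    obtain ⟨y, hy⟩ := hself (imaginaryPart a : A) (imaginaryPart a).2
    exact ⟨x + Complex.I • y, by rw [map_add, map_smul, hx, hy, realPart_add_I_smul_imaginaryPart]⟩

end Free

section Limit

variable {F : Type u} {A : Type v} [NonUnitalCStarAlgebra F] [NonUnitalCStarAlgebra A]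

theorem map_iterHom {γ : ℕ → F →⋆ₙₐ[ℂ] F} {q : F →⋆ₙₐ[ℂ] A} (h : ∀ k x, q (γ k x) = q x)
    (k n : ℕ) (x : F) : q (iterHom (A := fun _ => F) γ k n x) = q x := by
  induction n with
  | zero => rfl
  | succ n ih => exact (h _ _).trans ih

theorem tendsto_norm_iterHom {γ : ℕ → F →⋆ₙₐ[ℂ] F} {q : F →⋆ₙₐ[ℂ] A}
    (h : ∀ k x, q (γ k x) = q x) (k : ℕ)
    (hk : ∀ x, q x = 0 → Tendsto (fun n => ‖iterHom (A := fun _ => F) γ k n x‖) atTop (𝓝 0))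
    (x : F) : Tendsto (fun n => ‖iterHom (A := fun _ => F) γ k n x‖) atTop (𝓝 ‖q x‖) := by
  have hlow : ∀ n x, ‖q x‖ ≤ ‖iterHom (A := fun _ => F) γ k n x‖ := fun n x => by
    rw [← map_iterHom h k n x]
    exact NonUnitalStarAlgHom.norm_apply_le q _
  have hself : ∀ x, IsSelfAdjoint x →
      Tendsto (fun n => ‖iterHom (A := fun _ => F) γ k n x‖) atTop (𝓝 ‖q x‖) := by
    intro x hx
    obtain ⟨b, -, hb1, hb2⟩ := exists_isSelfAdjoint_norm_le_map_eq q hx le_rfl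
    have h0 := (hk (x - b) (by rw [map_sub, hb2, sub_self])).const_add ‖q x‖
    rw [add_zero] at h0
    refine tendsto_of_tendsto_of_tendsto_of_le_of_le tendsto_const_nhds h0
      (fun n => hlow n x) fun n => ?_
    have h1 : ‖iterHom (A := fun _ => F) γ k n b‖ ≤ ‖q x‖ :=
      (NonUnitalStarAlgHom.norm_apply_le _ b).trans hb1
    calc ‖iterHom (A := fun _ => F) γ k n x‖
        = ‖iterHom (A := fun _ => F) γ k n b + iterHom (A := fun _ => F) γ k n (x - b)‖ := by
          rw [← map_add, add_sub_cancel]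
      _ ≤ _ := (norm_add_le _ _).trans (by gcongr)
  have hs := (hself (star x * x) (.star_mul_self x)).sqrt
  simpa only [map_mul, map_star, CStarRing.norm_star_mul_self,
    Real.sqrt_mul_self (norm_nonneg _)] using hs

/-- If every finite set admits an endomorphism of `F` over `q` that is small on its kernel part,
then a suitable sequence of such endomorphisms eventually kills the whole kernel. -/
theorem exists_endomorphisms_tendsto_zero_on_kernel [TopologicalSpace.SeparableSpace F]
    (q : F →⋆ₙₐ[ℂ] A)
    (hq : ∀ (G : Finset F) (ε : ℝ), 0 < ε → ∃ ψ : F →⋆ₙₐ[ℂ] F, (∀ x, q (ψ x) = q x) ∧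
      ∀ x ∈ G, q x = 0 → ‖ψ x‖ ≤ ε) :
    ∃ γ : ℕ → F →⋆ₙₐ[ℂ] F, (∀ k x, q (γ k x) = q x) ∧ ∀ k x, q x = 0 →
      Tendsto (fun n => ‖iterHom (A := fun _ => F) γ k n x‖) atTop (𝓝 0) := by
  classical
  have : SecondCountableTopology F := UniformSpace.secondCountable_of_separable F
  let K : Set F := {x | q x = 0}
  have : Nonempty K := ⟨⟨0, map_zero q⟩⟩
  let e : ℕ → F := fun l => (TopologicalSpace.denseSeq K l).1
  have he : ∀ l, q (e l) = 0 := fun l => (TopologicalSpace.denseSeq K l).2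
  choose Ψ hΨ hΨG using fun (k : ℕ) (G : Finset F) =>
    hq G (1 / ((k : ℝ) + 1)) Nat.one_div_pos_of_nat
  let G : ℕ → (ℕ × ℕ → F) → Finset F := fun k t =>
    (Finset.range (k + 1) ×ˢ Finset.range (k + 1)).image t
  -- `T k (i, l)` is the image in the `k`-th stage of the element `e l` of the `i`-th stage.
  let T : ℕ → ℕ × ℕ → F := fun k => Nat.rec (fun p => e p.2)
    (fun k t p => if p.1 ≤ k then Ψ k (G k t) (t p) else e p.2) k
  let γ : ℕ → F →⋆ₙₐ[ℂ] F := fun k => Ψ k (G k (T k))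
  have hγ : ∀ k x, q (γ k x) = q x := fun k x => hΨ _ _ x
  have hTsucc : ∀ k p, T (k + 1) p = if p.1 ≤ k then γ k (T k p) else e p.2 := fun _ _ => rfl
  have hT : ∀ i l n, T (i + n) (i, l) = iterHom (A := fun _ => F) γ i n (e l) := by
    intro i l n
    induction n with
    | zero =>
      cases i with
      | zero => rfl
      | succ i => exact (hTsucc i _).trans (if_neg (by simp))
    | succ n ih =>
      refine (hTsucc (i + n) _).trans ((if_pos (by simp)).trans ?_)
      rw [ih]
      rfl
  have hsmall : ∀ i l n, l ≤ n →
      ‖iterHom (A := fun _ => F) γ i (n + 1) (e l)‖ ≤ 1 / ((n : ℝ) + 1) := by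
    intro i l n hln
    have h1 : iterHom (A := fun _ => F) γ i (n + 1) (e l) = γ (i + n) (T (i + n) (i, l)) := by
      rw [hT]
      rfl
    rw [h1]
    refine (hΨG _ _ _ (Finset.mem_image_of_mem _ ?_) ?_).trans ?_
    · simp only [Finset.mem_product, Finset.mem_range]
      omega
    · rw [hT, map_iterHom hγ, he]
    · push_cast
      gcongr
      simp
  refine ⟨γ, hγ, fun k x hx => ?_⟩
  rw [Metric.tendsto_atTop]
  intro ε hε
  obtain ⟨l, hl⟩ := (TopologicalSpace.denseRange_denseSeq K).exists_dist_lt ⟨x, hx⟩ (half_pos hε)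
  have hl' : ‖x - e l‖ < ε / 2 := by rwa [← dist_eq_norm]
  obtain ⟨N, hN⟩ := exists_nat_one_div_lt (half_pos hε)
  refine ⟨max l N + 1, fun n hn => ?_⟩
  obtain ⟨m, rfl⟩ : ∃ m, n = m + 1 := ⟨n - 1, by omega⟩
  have hm : l ≤ m ∧ N ≤ m := by omega
  have h1 : 1 / ((m : ℝ) + 1) ≤ 1 / ((N : ℝ) + 1) := by
    gcongr
    exact hm.2
  rw [dist_zero_right, norm_norm]
  calc ‖iterHom (A := fun _ => F) γ k (m + 1) x‖
      = ‖iterHom (A := fun _ => F) γ k (m + 1) (x - e l) +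
          iterHom (A := fun _ => F) γ k (m + 1) (e l)‖ := by
        rw [← map_add, sub_add_cancel]
    _ ≤ ‖x - e l‖ + 1 / ((m : ℝ) + 1) :=
        (norm_add_le _ _).trans
          (add_le_add (NonUnitalStarAlgHom.norm_apply_le _ _) (hsmall k l m hm.1))
    _ < ε := by linarith

end Limit

end

open TopologicalSpace in
/-- Every separable contractible C*-algebra is an inductive limit of projective
C*-algebras. -/
theorem contractible_implies_limit_of_projectives
    (A : Type u) [NonUnitalCStarAlgebra A] [SeparableSpace A]
    (hA : Contractible A) :
    IsInductiveLimitOfProjectives A := by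
  obtain ⟨F, _, q, _, hF, hq⟩ := exists_projective_cover A
  obtain ⟨γ, hγ, hγ0⟩ := exists_endomorphisms_tendsto_zero_on_kernel q fun G ε hε =>
    hF.exists_endomorphism_small_on_kernel hq hA G hε
  refine ⟨⟨fun _ => F, fun _ => inferInstance, γ⟩, fun _ => q, ⟨?_, ?_, ?_⟩, fun _ => hF⟩
  · exact fun k => NonUnitalStarAlgHom.ext (hγ k)
  · exact (hq.denseRange).mono (subset_iUnion (fun _ : ℕ => range q) 0)
  · exact fun k x => tendsto_norm_iterHom hγ k (hγ0 k) x
end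

section
/- (Contractible-like C*-algebras are inductive limits of contractibles.) Let A be a separable C*-algebra such that for every finite subset F ⊆ A and every ε > 0 there exists a contractible sub-C*-algebra B ⊆ A with F ⊂_ε B. Then A is isomorphic to the inductive limit of an inductive system all of whose terms are contractible C*-algebras. -/
open Filter Topology Set

noncomputable section

/-! ### Cones -/

/-- Evaluation at a point of the unit interval. -/
def evalHom (B : Type u) [NonUnitalCStarAlgebra B] (t : unitInterval) :
    C(unitInterval, B) →⋆ₙₐ[ℂ] B where
  toFun f := f t
  map_smul' _ _ := rfl
  map_zero' := rfl
  map_add' _ _ := rfl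
  map_mul' _ _ := rfl
  map_star' _ := rfl

@[simp]
theorem evalHom_apply {B : Type u} [NonUnitalCStarAlgebra B] (t : unitInterval)
    (f : C(unitInterval, B)) : evalHom B t f = f t := rfl

/-- The cone over a C*-algebra: paths which vanish at `1`. -/
def cone (P : Type u) [NonUnitalCStarAlgebra P] :
    NonUnitalStarSubalgebra ℂ C(unitInterval, P) where
  carrier := {f | f 1 = 0}
  add_mem' {f g} hf hg := by simp_all
  zero_mem' := rfl
  mul_mem' {f g} hf hg := by simp_all
  smul_mem' c f hf := by simp_all
  star_mem' {f} hf := by simp_all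

theorem mem_cone {P : Type u} [NonUnitalCStarAlgebra P] {f : C(unitInterval, P)} :
    f ∈ cone P ↔ f 1 = 0 := Iff.rfl

instance isClosed_cone (P : Type u) [NonUnitalCStarAlgebra P] :
    IsClosed (cone P : Set C(unitInterval, P)) :=
  isClosed_singleton.preimage (f := fun f : C(unitInterval, P) => f 1)
    (continuous_eval_const 1) (t := {0})

/-- Evaluation at `0` on the cone. -/
def coneEval (P : Type u) [NonUnitalCStarAlgebra P] : cone P →⋆ₙₐ[ℂ] P :=
  (evalHom P 0).comp (NonUnitalStarSubalgebraClass.subtype (cone P))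

theorem coneEval_apply {P : Type u} [NonUnitalCStarAlgebra P] (f : cone P) :
    coneEval P f = (f : C(unitInterval, P)) 0 := rfl

theorem coneEval_surjective (P : Type u) [NonUnitalCStarAlgebra P] :
    Function.Surjective (coneEval P) := by
  intro x
  refine ⟨⟨⟨fun t => ((1 - (t : ℝ) : ℝ) : ℂ) • x, by fun_prop⟩, ?_⟩, ?_⟩
  · simp [mem_cone]
  · simp [coneEval_apply]

/-- Cones are contractible. -/
theorem contractible_cone (P : Type u) [NonUnitalCStarAlgebra P] : Contractible (cone P) := by
  let F (f : cone P) : C(unitInterval × unitInterval, P) :=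
    (f : C(unitInterval, P)).comp ⟨fun p => max p.1 p.2, by fun_prop⟩
  have hF (f : cone P) (s : unitInterval) : (F f).curry s ∈ cone P := by
    rw [mem_cone, ← mem_cone.1 f.2]
    exact congrArg _ (max_eq_right unitInterval.le_one')
  let H : cone P →⋆ₙₐ[ℂ] C(unitInterval, cone P) :=
    { toFun := fun f => ⟨fun s => ⟨(F f).curry s, hF f s⟩, (F f).curry.continuous.subtype_mk _⟩
      map_smul' := fun _ _ => rfl
      map_zero' := rfl
      map_add' := fun _ _ => rfl
      map_mul' := fun _ _ => rfl
      map_star' := fun _ => rfl }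
  refine ⟨H, fun f => Subtype.ext <| ContinuousMap.ext fun t => ?_,
    fun f => Subtype.ext <| ContinuousMap.ext fun t => ?_⟩
  · exact congrArg _ (max_eq_right unitInterval.nonneg')
  · exact (congrArg _ (max_eq_left unitInterval.le_one')).trans (mem_cone.1 f.2)

/-! ### Inductive limits -/

section InductiveLimits

variable {A : Type u} [NonUnitalCStarAlgebra A]

theorem norm_map_sub_le {B : Type u} {C : Type v} [NonUnitalCStarAlgebra B]
    [NonUnitalCStarAlgebra C] (φ : B →⋆ₙₐ[ℂ] C) (x y : B) : ‖φ x - φ y‖ ≤ ‖x - y‖ := by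
  rw [← map_sub]
  exact NonUnitalStarAlgHom.norm_apply_le φ _

/-- A sequence of *-homomorphisms which is Cauchy on a dense set converges pointwise. -/
theorem exists_pointwise_limit {B : Type u} [NonUnitalCStarAlgebra B] (φ : ℕ → B →⋆ₙₐ[ℂ] A)
    {ι : Type*} {d : ι → B} (hd : DenseRange d) (h : ∀ i, CauchySeq fun n => φ n (d i)) :
    ∃ μ : B →⋆ₙₐ[ℂ] A, ∀ x, Tendsto (fun n => φ n x) atTop (𝓝 (μ x)) := by
  have key (x : B) : ∃ a, Tendsto (fun n => φ n x) atTop (𝓝 a) := by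
    refine cauchySeq_tendsto_of_complete (Metric.cauchySeq_iff.2 fun ε hε => ?_)
    obtain ⟨i, hi⟩ := hd.exists_dist_lt x (ε := ε / 3) (by positivity)
    obtain ⟨N, hN⟩ := Metric.cauchySeq_iff.1 (h i) (ε / 3) (by positivity)
    refine ⟨N, fun m hm n hn => ?_⟩
    have h1 := norm_map_sub_le (φ m) x (d i)
    have h2 := norm_map_sub_le (φ n) x (d i)
    have h3 := hN m hm n hn
    rw [← dist_eq_norm, ← dist_eq_norm] at h1 h2
    have := dist_triangle4 (φ m x) (φ m (d i)) (φ n (d i)) (φ n x)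
    rw [dist_comm (φ n (d i)) (φ n x)] at this
    linarith
  choose μ hμ using key
  refine ⟨{ toFun := μ, map_smul' := ?_, map_zero' := ?_, map_add' := ?_, map_mul' := ?_,
            map_star' := ?_ }, hμ⟩
  · intro c x
    refine tendsto_nhds_unique (hμ (c • x)) ?_
    simpa using! (hμ x).const_smul c
  · refine tendsto_nhds_unique (hμ 0) ?_
    simp
  · intro x y
    refine tendsto_nhds_unique (hμ (x + y)) ?_
    simpa using (hμ x).add (hμ y)
  · intro x y
    refine tendsto_nhds_unique (hμ (x * y)) ?_
    simpa using (hμ x).mul (hμ y)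
  · intro x
    refine tendsto_nhds_unique (hμ (star x)) ?_
    simpa [map_star] using (hμ x).star

theorem iterHom_zero {Q : ℕ → Type u} [∀ k, NonUnitalCStarAlgebra (Q k)]
    (ψ : ∀ k, Q k →⋆ₙₐ[ℂ] Q (k + 1)) (k : ℕ) (x : Q k) : iterHom ψ k 0 x = x := rfl

theorem iterHom_succ {Q : ℕ → Type u} [∀ k, NonUnitalCStarAlgebra (Q k)]
    (ψ : ∀ k, Q k →⋆ₙₐ[ℂ] Q (k + 1)) (k n : ℕ) (x : Q k) :
    iterHom ψ k (n + 1) x = ψ (k + n) (iterHom ψ k n x) := rfl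

theorem iterHom_succ_heq {Q : ℕ → Type u} [∀ k, NonUnitalCStarAlgebra (Q k)]
    (ψ : ∀ k, Q k →⋆ₙₐ[ℂ] Q (k + 1)) (k n : ℕ) (x : Q k) :
    iterHom ψ (k + 1) n (ψ k x) ≍ iterHom ψ k (n + 1) x := by
  have aux (i j : ℕ) (h : i = j) (x : Q i) (y : Q j) (hxy : x ≍ y) : ψ i x ≍ ψ j y := by
    subst h; rw [eq_of_heq hxy]
  induction n with
  | zero => exact HEq.rfl
  | succ n ih => exact aux _ _ (by omega) _ _ ih

theorem apply_iterHom_succ {Q : ℕ → Type u} [∀ k, NonUnitalCStarAlgebra (Q k)]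
    (ψ : ∀ k, Q k →⋆ₙₐ[ℂ] Q (k + 1)) (ρ : ∀ k, Q k →⋆ₙₐ[ℂ] A) (k n : ℕ) (x : Q k) :
    ρ (k + 1 + n) (iterHom ψ (k + 1) n (ψ k x)) = ρ (k + (n + 1)) (iterHom ψ k (n + 1) x) := by
  have aux (i j : ℕ) (h : i = j) (x : Q i) (y : Q j) (hxy : x ≍ y) : ρ i x = ρ j y := by
    subst h; rw [eq_of_heq hxy]
  exact aux _ _ (by omega) _ _ (iterHom_succ_heq ψ k n x)

/-- One-sided approximate intertwining. -/
theorem exists_isInductiveLimit {Q : ℕ → Type u} [∀ k, NonUnitalCStarAlgebra (Q k)]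
    (ψ : ∀ k, Q k →⋆ₙₐ[ℂ] Q (k + 1)) (ρ : ∀ k, Q k →⋆ₙₐ[ℂ] A)
    (d : ∀ k, ℕ → Q k) (hd : ∀ k, DenseRange (d k)) (e : ℕ → A) (he : DenseRange e)
    (hde : ∀ k i, ρ k (d k i) = e i)
    (hρ : ∀ k n i, i ≤ k + n →
      ‖ρ (k + n + 1) (iterHom ψ k (n + 1) (d k i)) - ρ (k + n) (iterHom ψ k n (d k i))‖
        ≤ (1 / 2) ^ (k + n))
    (hψ : ∀ k n i, i ≤ k + n →
      ‖iterHom ψ k (n + 1) (d k i)‖ ≤ ‖ρ (k + n) (iterHom ψ k n (d k i))‖ + (1 / 2) ^ (k + n)) :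
    ∃ μ : ∀ k, Q k →⋆ₙₐ[ℂ] A, IsInductiveLimit ψ A μ := by
  have hc (k i : ℕ) : CauchySeq fun n => (ρ (k + n)).comp (iterHom ψ k n) (d k i) := by
    let g (n : ℕ) : A := ρ (k + n) (iterHom ψ k n (d k i))
    have hg (n : ℕ) (hn : i ≤ k + n) : ‖g (n + 1) - g n‖ ≤ (1 / 2) ^ (k + n) := hρ k n i hn
    change CauchySeq g
    rw [← cauchySeq_shift i]
    refine cauchySeq_of_le_geometric (1 / 2) ((1 / 2) ^ (k + i)) (by norm_num) fun n => ?_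
    rw [dist_comm, dist_eq_norm, ← pow_add, add_right_comm n 1 i, add_assoc k i n, add_comm i n]
    exact hg (n + i) (by omega)
  choose μ hμ using fun k => exists_pointwise_limit (fun n => (ρ (k + n)).comp (iterHom ψ k n))
    (hd k) (hc k)
  simp only [NonUnitalStarAlgHom.comp_apply] at hμ
  refine ⟨μ, fun k => NonUnitalStarAlgHom.ext fun x => ?_, ?_, ?_⟩
  · have h1 := hμ (k + 1) (ψ k x)
    simp only [apply_iterHom_succ] at h1
    exact tendsto_nhds_unique h1 ((tendsto_add_atTop_iff_nat 1).2 (hμ k x))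
  · refine Metric.dense_iff.2 fun a r hr => ?_
    obtain ⟨i, hi⟩ := he.exists_dist_lt a (half_pos hr)
    obtain ⟨k, hk⟩ := exists_pow_lt_of_lt_one (show 0 < r / 4 by positivity)
      (show (1 / 2 : ℝ) < 1 by norm_num)
    let m := max i k
    have hm : (1 / 2 : ℝ) ^ m < r / 4 :=
      (pow_le_pow_of_le_one (by norm_num) (by norm_num) (le_max_right i k)).trans_lt hk
    refine ⟨μ m (d m i), ?_, Set.mem_iUnion.2 ⟨m, Set.mem_range_self _⟩⟩
    have := dist_le_of_le_geometric_of_tendsto₀ (1 / 2) ((1 / 2) ^ m) (by norm_num)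
      (f := fun n => ρ (m + n) (iterHom ψ m n (d m i))) (fun n => by
        rw [dist_comm, dist_eq_norm, ← pow_add]
        exact hρ m n i (by omega)) (hμ m (d m i))
    simp only [iterHom_zero] at this
    erw [hde m i] at this
    rw [Metric.mem_ball]
    have h3 := dist_triangle (μ m (d m i)) (e i) a
    rw [dist_comm (μ m (d m i)) (e i), dist_comm (e i) a] at h3
    rw [show (1 / 2 : ℝ) ^ m / (1 - 1 / 2) = 2 * (1 / 2) ^ m by ring] at this
    linarith
  · intro k x
    have hdk (i : ℕ) : Tendsto (fun n => ‖iterHom ψ k n (d k i)‖) atTop (𝓝 ‖μ k (d k i)‖) := by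
      have h1 := (hμ k (d k i)).norm
      rw [← tendsto_add_atTop_iff_nat 1]
      have h2 : Tendsto (fun n => ‖ρ (k + n) (iterHom ψ k n (d k i))‖ + (1 / 2 : ℝ) ^ (k + n))
          atTop (𝓝 (‖μ k (d k i)‖ + 0)) := by
        refine h1.add ?_
        simp_rw [add_comm k]
        exact (tendsto_add_atTop_iff_nat k).2
          (tendsto_pow_atTop_nhds_zero_of_lt_one (by norm_num) (by norm_num))
      rw [add_zero] at h2
      refine tendsto_of_tendsto_of_tendsto_of_le_of_le' ((tendsto_add_atTop_iff_nat 1).2 h1) h2 ?_ ?_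
      · exact .of_forall fun n => NonUnitalStarAlgHom.norm_apply_le (ρ (k + (n + 1))) _
      · filter_upwards [eventually_ge_atTop i] with n hn
        exact hψ k n i (by omega)
    rw [Metric.tendsto_atTop]
    intro ε hε
    obtain ⟨i, hi⟩ := (hd k).exists_dist_lt x (ε := ε / 3) (by positivity)
    obtain ⟨N, hN⟩ := Metric.tendsto_atTop.1 (hdk i) (ε / 3) (by positivity)
    refine ⟨N, fun n hn => ?_⟩
    have h1 := norm_map_sub_le (iterHom ψ k n) x (d k i)
    have h2 := norm_map_sub_le (μ k) x (d k i)
    have h3 := hN n hn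
    have h4 := abs_norm_sub_norm_le (iterHom ψ k n x) (iterHom ψ k n (d k i))
    have h5 := abs_norm_sub_norm_le (μ k x) (μ k (d k i))
    rw [dist_eq_norm] at hi
    rw [Real.dist_eq, abs_lt] at h3 ⊢
    rw [abs_le] at h4 h5
    constructor <;> linarith [h3.1, h3.2, h4.1, h4.2, h5.1, h5.2]

/-- An inductive system whose connecting morphisms factor through cones may be replaced by the
system of these cones. -/
theorem IsInductiveLimit.cone {Q : ℕ → Type u} [∀ k, NonUnitalCStarAlgebra (Q k)]
    {ψ : ∀ k, Q k →⋆ₙₐ[ℂ] Q (k + 1)} {μ : ∀ k, Q k →⋆ₙₐ[ℂ] A} (h : IsInductiveLimit ψ A μ)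
    (θ : ∀ k, Q k →⋆ₙₐ[ℂ] _root_.cone (Q (k + 1)))
    (hθ : ∀ k, (coneEval (Q (k + 1))).comp (θ k) = ψ k) :
    IsInductiveLimit (fun k => (θ k).comp (coneEval (Q k))) A
      (fun k => (μ k).comp (coneEval (Q k))) := by
  have hθ' (k : ℕ) (x : Q k) : coneEval _ (θ k x) = ψ k x := by rw [← hθ]; rfl
  have hit (k n : ℕ) (f : _root_.cone (Q k)) :
      coneEval _ (iterHom (fun k => (θ k).comp (coneEval (Q k))) k n f) =
        iterHom ψ k n (coneEval _ f) := by
    induction n with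
    | zero => rfl
    | succ n ih => exact (hθ' _ _).trans (congrArg _ ih)
  refine ⟨fun k => NonUnitalStarAlgHom.ext fun f => ?_, ?_, fun k f => ?_⟩
  · simp only [NonUnitalStarAlgHom.comp_apply]
    rw [hθ', ← NonUnitalStarAlgHom.comp_apply, h.compat]
  · convert h.dense_union using 3 with k
    exact (coneEval_surjective (Q k)).range_comp (μ k)
  · have h1 := h.norm_tendsto k (coneEval _ f)
    rw [← tendsto_add_atTop_iff_nat 1]
    refine tendsto_of_tendsto_of_tendsto_of_le_of_le ((tendsto_add_atTop_iff_nat 1).2 h1) h1 ?_ ?_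
    · intro n
      simp only [← hit]
      exact NonUnitalStarAlgHom.norm_apply_le (coneEval _) _
    · intro n
      simp only [← hit]
      exact NonUnitalStarAlgHom.norm_apply_le (θ (k + n)) _

/-- If the algebras `P m` over `A` approximately factor through cones over each other,
with arbitrarily small kernel, then `A` is an inductive limit of cones. -/
theorem exists_isInductiveLimit_cones {P : ℕ → Type u} [∀ m, NonUnitalCStarAlgebra (P m)]
    (ρ : ∀ m, P m →⋆ₙₐ[ℂ] A) (d : ∀ m, ℕ → P m) (hd : ∀ m, DenseRange (d m))
    (e : ℕ → A) (he : DenseRange e) (hde : ∀ m i, ρ m (d m i) = e i)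
    (step : ∀ m (S : Finset (P m)) (ε : ℝ), 0 < ε →
      ∃ (m' : ℕ) (θ : P m →⋆ₙₐ[ℂ] cone (P m')), ∀ y ∈ S,
        ‖ρ m' (coneEval _ (θ y)) - ρ m y‖ ≤ ε ∧ ‖coneEval _ (θ y)‖ ≤ ‖ρ m y‖ + ε) :
    ∃ (S : CStarInductiveSystem.{u}) (ν : ∀ k, S.X k →⋆ₙₐ[ℂ] A),
      IsInductiveLimit S.conn A ν ∧ ∀ k, Contractible (S.X k) := by
  classical
  choose nxt θ hθ using fun (n : ℕ) (s : Σ m, ℕ → ℕ → P m) =>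
    step s.1 ((Finset.range (n + 1) ×ˢ Finset.range (n + 1)).image fun p => s.2 p.1 p.2)
      ((1 / 2) ^ n) (by positivity)
  let s : ℕ → Σ m, ℕ → ℕ → P m := fun n => Nat.rec ⟨0, fun _ => d 0⟩
    (fun n s => ⟨nxt n s, fun k i =>
      if k ≤ n then coneEval _ (θ n s (s.2 k i)) else d (nxt n s) i⟩) n
  let Θ (k : ℕ) : P (s k).1 →⋆ₙₐ[ℂ] cone (P (s (k + 1)).1) := θ k (s k)
  let ψ (k : ℕ) : P (s k).1 →⋆ₙₐ[ℂ] P (s (k + 1)).1 := (coneEval _).comp (Θ k)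
  have hs_le (n k i : ℕ) (h : k ≤ n) : (s (n + 1)).2 k i = ψ n ((s n).2 k i) := if_pos h
  have hs_self (n i : ℕ) : (s n).2 n i = d (s n).1 i := by
    cases n with
    | zero => rfl
    | succ n => exact if_neg (by omega)
  have hit (k n i : ℕ) :
      iterHom (A := fun k => P (s k).1) ψ k n (d (s k).1 i) = (s (k + n)).2 k i := by
    induction n with
    | zero => exact (hs_self k i).symm
    | succ n ih =>
      rw [iterHom_succ, ih]
      exact (hs_le (k + n) k i (by omega)).symm
  have hψ (k n i : ℕ) (hi : i ≤ k + n) := hθ (k + n) (s (k + n)) ((s (k + n)).2 k i)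
    (Finset.mem_image.2 ⟨(k, i), by simp; omega, rfl⟩)
  obtain ⟨μ, hμ⟩ := exists_isInductiveLimit (Q := fun k => P (s k).1) ψ (fun k => ρ (s k).1)
    (fun k => d (s k).1) (fun k => hd _) e he (fun k i => hde _ i)
    (fun k n i hi => by
      rw [iterHom_succ, hit]
      exact (hψ k n i hi).1)
    (fun k n i hi => by
      rw [iterHom_succ, hit]
      exact (hψ k n i hi).2)
  exact ⟨⟨fun k => cone (P (s k).1), fun k => inferInstance, _⟩, _, hμ.cone Θ fun _ => rfl,
    fun k => contractible_cone _⟩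

end InductiveLimits

end

noncomputable section

/-! ### Algebras generated by coordinate functions -/

section Generators

/-- Sequences in `A` whose terms are bounded in norm by those of `r`. -/
abbrev BddSeq (A : Type u) [NonUnitalCStarAlgebra A] (r : ℕ → ℝ) : Type u :=
  {α : ℕ → A // ∀ i, ‖α i‖ ≤ r i}

variable {A : Type u} [NonUnitalCStarAlgebra A] {r : ℕ → ℝ}

/-- The `i`-th coordinate function on a set of sequences. -/
def coord (T : Set (BddSeq A r)) (i : ℕ) : BoundedContinuousFunction T A :=
  BoundedContinuousFunction.ofNormedAddCommGroup (fun α => α.1.1 i) ((continuous_apply i).comp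
      (continuous_subtype_val.comp continuous_subtype_val)) (r i)
    (fun α => α.1.2 i)

/-- The C*-algebra of functions generated by the coordinates. -/
def gen (T : Set (BddSeq A r)) : NonUnitalStarSubalgebra ℂ (BoundedContinuousFunction T A) :=
  (NonUnitalStarAlgebra.adjoin ℂ (Set.range (coord T))).topologicalClosure

instance isClosed_gen (T : Set (BddSeq A r)) :
    IsClosed (gen T : Set (BoundedContinuousFunction T A)) :=
  NonUnitalStarSubalgebra.isClosed_topologicalClosure _

theorem gen_le {T : Set (BddSeq A r)}
    {K : NonUnitalStarSubalgebra ℂ (BoundedContinuousFunction T A)}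
    (hK : IsClosed (K : Set (BoundedContinuousFunction T A))) (h : ∀ i, coord T i ∈ K) :
    gen T ≤ K :=
  NonUnitalStarSubalgebra.topologicalClosure_minimal _
    (NonUnitalStarAlgebra.adjoin_le (Set.range_subset_iff.2 h)) hK

/-- The coordinate functions as elements of the algebra which they generate. -/
def genCoord (T : Set (BddSeq A r)) (i : ℕ) : gen T :=
  ⟨coord T i, NonUnitalStarSubalgebra.le_topologicalClosure _
    (NonUnitalStarAlgebra.subset_adjoin ℂ _ (Set.mem_range_self i))⟩

/-- Evaluation at a point. -/
def genEval {T : Set (BddSeq A r)} (α : T) : gen T →⋆ₙₐ[ℂ] A where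
  toFun x := x.1 α
  map_smul' _ _ := rfl
  map_zero' := rfl
  map_add' _ _ := rfl
  map_mul' _ _ := rfl
  map_star' _ := rfl

theorem gen_ext {T : Set (BddSeq A r)} {x y : gen T}
    (h : ∀ α, genEval α x = genEval α y) : x = y :=
  Subtype.ext <| BoundedContinuousFunction.ext h

theorem norm_genEval_le {T : Set (BddSeq A r)} (α : T) (x : gen T) : ‖genEval α x‖ ≤ ‖x‖ :=
  x.1.norm_coe_le_norm α

theorem continuous_genEval {T : Set (BddSeq A r)} (α : T) : Continuous (genEval (r := r) α) :=
  (continuous_eval_const (F := BoundedContinuousFunction T A) (α)).comp continuous_subtype_val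

/-- A family of continuous maps between sets of sequences whose coordinates are paths in `gen T'`
pulls `gen T` back to paths in `gen T'`. -/
theorem exists_pullback {T T' : Set (BddSeq A r)} (y : ℕ → C(unitInterval, gen T'))
    (ζ : unitInterval → T' → T) (hζ : ∀ i t α, (ζ t α).1.1 i = genEval α (y i t)) :
    ∃ Θ : gen T →⋆ₙₐ[ℂ] C(unitInterval, gen T'),
      ∀ x t α, genEval α (Θ x t) = genEval (ζ t α) x := by
  let K : NonUnitalStarSubalgebra ℂ (BoundedContinuousFunction T A) :=
    { carrier := {x | ∃ f : C(unitInterval, gen T'), ∀ t α, genEval α (f t) = x (ζ t α)}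
      add_mem' := by
        rintro x x' ⟨f, hf⟩ ⟨f', hf'⟩
        exact ⟨f + f', fun t α => by simp [hf, hf']⟩
      zero_mem' := ⟨0, fun t α => by simp⟩
      mul_mem' := by
        rintro x x' ⟨f, hf⟩ ⟨f', hf'⟩
        exact ⟨f * f', fun t α => by simp [hf, hf']⟩
      smul_mem' := by
        rintro c x ⟨f, hf⟩
        exact ⟨c • f, fun t α => by simp [hf]⟩
      star_mem' := by
        rintro x ⟨f, hf⟩
        exact ⟨star f, fun t α => by simp [hf, map_star]⟩ }
  have hle : ∀ (x : BoundedContinuousFunction T A) (f : C(unitInterval, gen T')),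
      (∀ t α, genEval α (f t) = x (ζ t α)) → ‖f‖ ≤ ‖x‖ := by
    intro x f hf
    refine (ContinuousMap.norm_le _ (norm_nonneg _)).2 fun t =>
      (BoundedContinuousFunction.norm_le (norm_nonneg _)).2 fun α => ?_
    exact (congrArg norm (hf t α)).trans_le (x.norm_coe_le_norm _)
  have hK : IsClosed (K : Set (BoundedContinuousFunction T A)) := by
    refine isClosed_of_closure_subset fun x hx => ?_
    obtain ⟨s, hs, hsx⟩ := mem_closure_iff_seq_limit.1 hx
    choose f hf using hs
    have hc : CauchySeq f := by
      rw [Metric.cauchySeq_iff]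
      intro ε hε
      obtain ⟨N, hN⟩ := Metric.cauchySeq_iff.1 hsx.cauchySeq ε hε
      refine ⟨N, fun m hm n hn => lt_of_le_of_lt ?_ (hN m hm n hn)⟩
      rw [dist_eq_norm (s m)]
      refine (dist_eq_norm (f m) (f n)).trans_le (hle _ _ fun t α => by simp [hf])
    obtain ⟨g, hg⟩ := cauchySeq_tendsto_of_complete hc
    refine ⟨g, fun t α => tendsto_nhds_unique
      ((((continuous_genEval α).comp (continuous_eval_const t)).tendsto g).comp hg) ?_⟩
    have h1 := ((continuous_eval_const (F := BoundedContinuousFunction T A) (ζ t α)).tendsto x).comp hsx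
    exact h1.congr fun n => (hf n t α).symm
  have hmem : ∀ x : gen T, x.1 ∈ K := fun x =>
    gen_le hK (fun i => ⟨y i, fun t α => (hζ i t α).symm⟩) x.2
  choose f hf using hmem
  have hf' (x t α) : genEval α (f x t) = genEval (ζ t α) x := hf x t α
  have hext {g g' : C(unitInterval, gen T')} (h : ∀ t α, genEval α (g t) = genEval α (g' t)) :
      g = g' := ContinuousMap.ext fun t => gen_ext (h t)
  exact ⟨{ toFun := f
           map_smul' := fun c x => hext fun t α => by simp [hf']
           map_zero' := hext fun t α => by simp [hf']
           map_add' := fun x x' => hext fun t α => by simp [hf']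
           map_mul' := fun x x' => hext fun t α => by simp [hf']
           map_star' := fun x => hext fun t α => by simp [hf', map_star] }, hf'⟩

theorem exists_genRestrict {T T' : Set (BddSeq A r)} (h : T' ⊆ T) :
    ∃ R : gen T →⋆ₙₐ[ℂ] gen T', (∀ x α, genEval α (R x) = genEval ⟨α.1, h α.2⟩ x) ∧
      DenseRange R := by
  obtain ⟨Θ, hΘ⟩ := exists_pullback (T := T) (fun i => ContinuousMap.const _ (genCoord T' i))
    (fun _ α => ⟨α.1, h α.2⟩) (fun i t α => rfl)
  let R := (evalHom _ 0).comp Θ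
  have hR (x α) : genEval α (R x) = genEval ⟨α.1, h α.2⟩ x := hΘ x 0 α
  refine ⟨R, hR, ?_⟩
  let S : gen T →⋆ₙₐ[ℂ] BoundedContinuousFunction T' A :=
    (NonUnitalStarSubalgebraClass.subtype (gen T')).comp R
  have hle : gen T' ≤ (NonUnitalStarAlgHom.range S).topologicalClosure :=
    gen_le (NonUnitalStarSubalgebra.isClosed_topologicalClosure _) fun i =>
      NonUnitalStarSubalgebra.le_topologicalClosure _
        ⟨genCoord T i, BoundedContinuousFunction.ext fun α => hR (genCoord T i) α⟩
  intro y
  refine closure_subtype.2 ?_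
  rw [← Set.range_comp]
  exact hle y.2

theorem isSeparable_adjoin {E : Type*} [NonUnitalCStarAlgebra E] {s : Set E} (hs : s.Countable) :
    TopologicalSpace.IsSeparable (NonUnitalStarAlgebra.adjoin ℂ s : Set E) := by
  have hc : (s ∪ star s).Countable := hs.union (by
    rw [← Set.image_star]
    exact hs.image _)
  have : Countable (s ∪ star s : Set E) := hc
  let F : (s ∪ star s : Set E) × List (s ∪ star s : Set E) → E :=
    fun p => p.2.foldl (fun a b => a * b.1) p.1.1
  have hF : (Subsemigroup.closure (s ∪ star s) : Set E) ⊆ Set.range F := by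
    let K : Subsemigroup E :=
      { carrier := Set.range F
        mul_mem' := by
          rintro _ _ ⟨p, rfl⟩ ⟨q, rfl⟩
          refine ⟨(p.1, p.2 ++ q.1 :: q.2), ?_⟩
          simp only [F, List.foldl_append, List.foldl_cons]
          generalize List.foldl (fun a b => a * b.1) p.1.1 p.2 = u
          generalize (q.1 : E) = v
          induction q.2 generalizing v with
          | nil => rfl
          | cons w l ih =>
            simp only [List.foldl_cons]
            rw [mul_assoc, ih] }
    exact (Subsemigroup.closure_le (S := K)).2 fun x hx => ⟨(⟨x, hx⟩, []), rfl⟩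
  have h1 := ((Set.countable_range F).mono hF).isSeparable.span (R := ℂ)
  rwa [← NonUnitalStarAlgebra.adjoin_eq_span] at h1

instance separableSpace_gen (T : Set (BddSeq A r)) : TopologicalSpace.SeparableSpace (gen T) :=
  ((isSeparable_adjoin (Set.countable_range (coord T))).closure).separableSpace

end Generators

end

noncomputable section

/-! ### Paths of sequences -/

section Paths

variable {A : Type u} [NonUnitalCStarAlgebra A] {r : ℕ → ℝ}

/-- Noncommutative polynomials see a smaller norm after applying a *-homomorphism. -/
theorem norm_genEval_map_le {B : Type u} [NonUnitalCStarAlgebra B] (ι φ : B →⋆ₙₐ[ℂ] A)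
    (hι : Function.Injective ι) {T : Set (BddSeq A r)} (b : ℕ → B) (α β : T)
    (hα : ∀ i, α.1.1 i = ι (b i)) (hβ : ∀ i, β.1.1 i = φ (b i)) (x : gen T) :
    ‖genEval β x‖ ≤ ‖genEval α x‖ := by
  let K : NonUnitalStarSubalgebra ℂ (BoundedContinuousFunction T A) :=
    { carrier := {x | ∃ z, x α = ι z ∧ x β = φ z}
      add_mem' := by
        rintro x x' ⟨z, hz, hz'⟩ ⟨w, hw, hw'⟩
        exact ⟨z + w, by simp [hz, hw], by simp [hz', hw']⟩
      zero_mem' := ⟨0, by simp, by simp⟩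
      mul_mem' := by
        rintro x x' ⟨z, hz, hz'⟩ ⟨w, hw, hw'⟩
        exact ⟨z * w, by simp [hz, hw], by simp [hz', hw']⟩
      smul_mem' := by
        rintro c x ⟨z, hz, hz'⟩
        exact ⟨c • z, by simp [hz], by simp [hz']⟩
      star_mem' := by
        rintro x ⟨z, hz, hz'⟩
        exact ⟨star z, by simp [hz, map_star], by simp [hz', map_star]⟩ }
  have hK : NonUnitalStarAlgebra.adjoin ℂ (Set.range (coord T)) ≤ K :=
    NonUnitalStarAlgebra.adjoin_le (Set.range_subset_iff.2 fun i => ⟨b i, hα i, hβ i⟩)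
  have hc (γ : T) : Continuous fun x : BoundedContinuousFunction T A => ‖x γ‖ :=
    (continuous_eval_const (F := BoundedContinuousFunction T A) γ).norm
  refine closure_minimal (t := {x | ‖x β‖ ≤ ‖x α‖}) (fun y hy => ?_)
    (isClosed_le (hc β) (hc α)) x.2
  obtain ⟨z, hz, hz'⟩ := hK hy
  change ‖y β‖ ≤ ‖y α‖
  rw [hz, hz', NonUnitalStarAlgHom.norm_map ι hι]
  exact NonUnitalStarAlgHom.norm_apply_le φ z

/-- Extension of a finite sequence by zero. -/
def zeroExt {M : ℕ} (u : Fin M → A) (i : ℕ) : A := if h : i < M then u ⟨i, h⟩ else 0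

theorem continuous_zeroExt {M : ℕ} : Continuous (zeroExt : (Fin M → A) → ℕ → A) := by
  refine continuous_pi fun i => ?_
  unfold zeroExt
  split
  · exact continuous_apply _
  · exact continuous_const

theorem zeroExt_comp {B : Type u} [NonUnitalCStarAlgebra B] {M : ℕ} (φ : B →⋆ₙₐ[ℂ] A)
    (u : Fin M → B) (i : ℕ) : zeroExt (fun j => φ (u j)) i = φ (zeroExt u i) := by
  unfold zeroExt
  split <;> simp

theorem norm_zeroExt_le {M : ℕ} {u : Fin M → A} (hr : ∀ i, 0 ≤ r i) (hu : ∀ i, ‖u i‖ ≤ r i)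
    (i : ℕ) : ‖zeroExt u i‖ ≤ r i := by
  unfold zeroExt
  split
  · exact hu ⟨i, _⟩
  · simpa using hr i

theorem exists_path
    (h : ∀ (F : Finset A) (ε : ℝ), 0 < ε →
      ∃ (B : Type u) (_ : NonUnitalCStarAlgebra B) (ι : B →⋆ₙₐ[ℂ] A),
        Function.Injective ι ∧ EpsContained ε ↑F (Set.range ι) ∧ Contractible B)
    (a : ℕ → A) (hr : ∀ i, r i = ‖a i‖ + 1) {N : Set (ℕ → A)} (hN : N ∈ 𝓝 a) :
    ∃ (M : ℕ) (β : C(unitInterval, Fin M → A)), β 1 = 0 ∧ zeroExt (β 0) ∈ N ∧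
      (∀ t i, ‖β t i‖ < r i) ∧ ∀ (T : Set (BddSeq A r)) (α : unitInterval → T),
        (∀ t i, (α t).1.1 i = zeroExt (β t) i) →
          ∀ (x : gen T) t, ‖genEval (α t) x‖ ≤ ‖genEval (α 0) x‖ := by
  classical
  have key (n : ℕ) := h ((Finset.range n).image a) (1 / ((n : ℝ) + 1)) (by positivity)
  choose B hB ι hι hF hcon using key
  have hF' (n : ℕ) (i : Fin n) : ∃ b : B n, ‖a i - ι n b‖ < 1 / ((n : ℝ) + 1) := by
    obtain ⟨_, ⟨b, rfl⟩, hb⟩ := hF n (a i)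
      (Finset.mem_coe.2 (Finset.mem_image_of_mem a (Finset.mem_range.2 i.2)))
    exact ⟨b, hb⟩
  choose b hb using hF'
  have hlim : Tendsto (fun n => zeroExt fun i => ι n (b n i)) atTop (𝓝 a) := by
    refine tendsto_pi_nhds.2 fun i => ?_
    rw [tendsto_iff_norm_sub_tendsto_zero]
    refine squeeze_zero' (Eventually.of_forall fun _ => norm_nonneg _) ?_
      (tendsto_one_div_add_atTop_nhds_zero_nat (𝕜 := ℝ))
    filter_upwards [eventually_gt_atTop i] with n hn
    rw [norm_sub_rev]
    simpa [zeroExt, hn] using (hb n ⟨i, hn⟩).le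
  obtain ⟨n, hn⟩ := (hlim.eventually hN).exists
  obtain ⟨H, H0, H1⟩ := hcon n
  refine ⟨n, ⟨fun t i => ι n (H (b n i) t), continuous_pi fun i =>
    (NonUnitalStarAlgHom.isometry (ι n) (hι n)).continuous.comp (H (b n i)).continuous⟩, ?_, ?_, ?_, ?_⟩
  · ext i
    change ι n (H (b n i) 1) = 0
    rw [H1]
    simp
  · have : (fun i => ι n (H (b n i) 0)) = fun i => ι n (b n i) := by
      ext i
      rw [H0]
      rfl
    change zeroExt (fun i => ι n (H (b n i) 0)) ∈ N
    rwa [this]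
  · intro t i
    have h1 : ‖ι n (H (b n i) t)‖ ≤ ‖H (b n i) t‖ := NonUnitalStarAlgHom.norm_apply_le _ _
    have h2 : ‖H (b n i) t‖ ≤ ‖H (b n i)‖ := (H (b n i)).norm_coe_le_norm t
    have h3 : ‖H (b n i)‖ ≤ ‖b n i‖ := NonUnitalStarAlgHom.norm_apply_le _ _
    have h4 := NonUnitalStarAlgHom.norm_map (ι n) (hι n) (b n i)
    have h5 := hb n i
    have h6 : 1 / ((n : ℝ) + 1) ≤ 1 := by
      rw [div_le_one (by positivity)]
      linarith [n.cast_nonneg (α := ℝ)]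
    have h7 := norm_le_norm_add_norm_sub' (ι n (b n i)) (a i)
    rw [norm_sub_rev] at h7
    change ‖ι n (H (b n i) t)‖ < r i
    rw [hr]
    linarith
  · intro T α hα x t
    refine norm_genEval_map_le (ι n) ((ι n).comp ((evalHom _ t).comp H)) (hι n)
      (zeroExt (b n)) (α 0) (α t) (fun i => ?_) (fun i => ?_) x
    · rw [hα, ← zeroExt_comp]
      congr 1
      ext j
      change ι n (H (b n j) 0) = _
      rw [H0]
      rfl
    · rw [hα, ← zeroExt_comp]
      rfl

theorem exists_gen_path {T : Set (BddSeq A r)} (a : T) (ha : DenseRange a.1.1)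
    (β : C(unitInterval, A)) (hβ : β 1 = 0) {δ : ℝ} (hδ : 0 < δ) :
    ∃ y : C(unitInterval, gen T), y 1 = 0 ∧ ∀ t, ‖genEval a (y t) - β t‖ < δ := by
  let t (s : unitInterval) : Set (gen T) := {p | ‖genEval a p - β s‖ < δ ∧ (s = 1 → p = 0)}
  have ht (s) : Convex ℝ (t s) := by
    rintro p ⟨hp, hp'⟩ q ⟨hq, hq'⟩ c d hc hd hcd
    refine ⟨?_, fun hs => by simp [hp' hs, hq' hs]⟩
    have h1 : genEval a (c • p + d • q) = c • genEval a p + d • genEval a q := rfl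
    have := convex_ball (β s) δ (x := genEval a p) (by simpa [dist_eq_norm] using hp)
      (y := genEval a q) (by simpa [dist_eq_norm] using hq) hc hd hcd
    rw [h1]
    simpa [dist_eq_norm] using this
  obtain ⟨y, hy⟩ := exists_continuous_forall_mem_convex_of_local_const ht fun s => by
    by_cases hs : s = 1
    · refine ⟨0, ?_⟩
      have : ∀ᶠ s' in 𝓝 s, ‖β s'‖ < δ :=
        β.continuous.norm.continuousAt.eventually_lt_const (by simpa [hs, hβ] using hδ)
      filter_upwards [this] with s' hs'
      exact ⟨by simpa using hs', fun _ => rfl⟩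
    · obtain ⟨j, hj⟩ := ha.exists_dist_lt (β s) hδ
      refine ⟨genCoord T j, ?_⟩
      have : ∀ᶠ s' in 𝓝 s, ‖a.1.1 j - β s'‖ < δ :=
        (continuous_const.sub β.continuous).norm.continuousAt.eventually_lt_const
          (by simpa [dist_eq_norm, norm_sub_rev] using hj)
      filter_upwards [this, isOpen_ne.mem_nhds hs] with s' hs' hne
      exact ⟨hs', fun h => (hne h).elim⟩
  exact ⟨y, (hy 1).2 rfl, fun s => (hy s).1⟩

end Paths

end

noncomputable section

/-! ### Shrinking the set of sequences -/

section Filtration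

variable {A : Type u} [NonUnitalCStarAlgebra A] {r : ℕ → ℝ}

theorem continuous_starAlgHom {B C : Type u} [NonUnitalCStarAlgebra B] [NonUnitalCStarAlgebra C]
    (φ : B →⋆ₙₐ[ℂ] C) : Continuous φ :=
  NonUnitalStarAlgHom.instContinuousLinearMapClassComplex.map_continuous φ

/-- Restriction to a smaller set of sequences. -/
def genRestrict {T T' : Set (BddSeq A r)} (h : T' ⊆ T) : gen T →⋆ₙₐ[ℂ] gen T' :=
  (exists_genRestrict h).choose

theorem genEval_genRestrict {T T' : Set (BddSeq A r)} (h : T' ⊆ T) (x : gen T) (α : T') :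
    genEval α (genRestrict h x) = genEval ⟨α.1, h α.2⟩ x :=
  (exists_genRestrict h).choose_spec.1 x α

theorem denseRange_genRestrict {T T' : Set (BddSeq A r)} (h : T' ⊆ T) : DenseRange (genRestrict h) :=
  (exists_genRestrict h).choose_spec.2

/-- Restriction of a path to a smaller set of sequences. -/
def restrictPath {T T' : Set (BddSeq A r)} (h : T' ⊆ T) (y : C(unitInterval, gen T)) :
    C(unitInterval, gen T') :=
  ⟨fun t => genRestrict h (y t), (continuous_starAlgHom _).comp y.continuous⟩

theorem genEval_restrictPath {T T' : Set (BddSeq A r)} (h : T' ⊆ T)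
    (y : C(unitInterval, gen T)) (t : unitInterval) (α : T') :
    genEval α (restrictPath h y t) = genEval ⟨α.1, h α.2⟩ (y t) :=
  genEval_genRestrict h (y t) α

theorem genEval_eq_zero {T : Set (BddSeq A r)} {α : T} (hα : ∀ i, α.1.1 i = 0) (x : gen T) :
    genEval α x = 0 := by
  let K : NonUnitalStarSubalgebra ℂ (BoundedContinuousFunction T A) :=
    { carrier := {x | x α = 0}
      add_mem' {f g} hf hg := by simp_all
      zero_mem' := rfl
      mul_mem' {f g} hf hg := by simp_all
      smul_mem' c f hf := by simp_all
      star_mem' {f} hf := by simp_all }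
  exact gen_le (K := K) (isClosed_singleton.preimage
    (continuous_eval_const (F := BoundedContinuousFunction T A) α)) hα x.2

/-- The sequences at which the first `m` functions `x j` are not much larger than at `a`. -/
def nearSet (x : ℕ → gen (univ : Set (BddSeq A r))) (a : BddSeq A r) (m : ℕ) :
    Set (BddSeq A r) :=
  {α | ∀ j < m, ‖genEval ⟨α, mem_univ α⟩ (x j)‖ ≤
    ‖genEval ⟨a, mem_univ a⟩ (x j)‖ + 1 / ((m : ℝ) + 1)}

variable (x : ℕ → gen (univ : Set (BddSeq A r))) (a : BddSeq A r)

theorem self_mem_nearSet (m : ℕ) : a ∈ nearSet x a m := fun j _ =>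
  le_add_of_nonneg_right (by positivity)

theorem nearSet_anti : Antitone (nearSet x a) := fun _ _ h _ hα j hj =>
  (hα j (hj.trans_le h)).trans (by gcongr)

/-- The base point of `nearSet`. -/
def basePt (m : ℕ) : nearSet x a m := ⟨a, self_mem_nearSet x a m⟩

variable {x}

theorem exists_norm_genEval_le (hx : DenseRange x) {k : ℕ} (y : gen (nearSet x a k)) {ε : ℝ}
    (hε : 0 < ε) : ∃ n ≥ k, ∀ α ∈ nearSet x a n, ∀ hk : α ∈ nearSet x a k,
      ‖genEval ⟨α, hk⟩ y‖ ≤ ‖genEval (basePt x a k) y‖ + ε := by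
  have hd : DenseRange fun j => genRestrict (subset_univ (nearSet x a k)) (x j) :=
    (denseRange_genRestrict _).comp hx (continuous_starAlgHom _)
  obtain ⟨j, hj⟩ := hd.exists_dist_lt y (show 0 < ε / 3 by positivity)
  obtain ⟨l, hl⟩ := exists_nat_one_div_lt (show 0 < ε / 3 by positivity)
  have hclose (α : nearSet x a k) : ‖genEval α y - genEval ⟨α.1, mem_univ _⟩ (x j)‖ < ε / 3 := by
    rw [← genEval_genRestrict (subset_univ (nearSet x a k)), ← map_sub]
    exact (norm_genEval_le _ _).trans_lt ((dist_eq_norm _ _).symm.trans_lt hj)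
  refine ⟨max k (max (j + 1) l), le_max_left _ _, fun α hα hk => ?_⟩
  have h1 := hclose ⟨α, hk⟩
  have h2 := hclose (basePt x a k)
  have h3 := hα j ((Nat.lt_succ_self j).trans_le (le_max_of_le_right (le_max_left _ _)))
  have h4 : 1 / (((max k (max (j + 1) l) : ℕ) : ℝ) + 1) ≤ 1 / ((l : ℝ) + 1) := by
    gcongr
    exact le_max_of_le_right (le_max_right _ _)
  have h5 := norm_le_norm_add_norm_sub' (genEval ⟨α, hk⟩ y) (genEval ⟨α, mem_univ _⟩ (x j))
  have h6 := norm_le_norm_add_norm_sub' (genEval ⟨a, mem_univ _⟩ (x j)) (genEval (basePt x a k) y)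
  rw [norm_sub_rev] at h6
  change ‖_ - genEval ⟨a, mem_univ _⟩ (x j)‖ < _ at h2
  linarith

theorem exists_path_norm_genEval_lt (hx : DenseRange x) {k : ℕ}
    (y : C(unitInterval, gen (nearSet x a k))) {c : ℝ}
    (hc : ∀ t, ‖genEval (basePt x a k) (y t)‖ < c) :
    ∃ n ≥ k, ∀ α ∈ nearSet x a n, ∀ (hk : α ∈ nearSet x a k) t,
      ‖genEval ⟨α, hk⟩ (y t)‖ < c := by
  have := IsCompact.induction_on (isCompact_univ (X := unitInterval))
    (p := fun s => ∃ n ≥ k, ∀ α ∈ nearSet x a n, ∀ (hk : α ∈ nearSet x a k), ∀ t ∈ s,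
      ‖genEval ⟨α, hk⟩ (y t)‖ < c)
    ⟨k, le_rfl, by simp⟩
    (fun s t hst ⟨n, hn, h⟩ => ⟨n, hn, fun α hα hk u hu => h α hα hk u (hst hu)⟩)
    (fun s t ⟨n, hn, h⟩ ⟨n', hn', h'⟩ => ⟨max n n', le_max_of_le_left hn,
      fun α hα hk u hu => hu.elim
        (h α (nearSet_anti x a (le_max_left _ _) hα) hk u)
        (h' α (nearSet_anti x a (le_max_right _ _) hα) hk u)⟩)
    (fun t _ => by
      have hη : 0 < (c - ‖genEval (basePt x a k) (y t)‖) / 2 := by linarith [hc t]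
      obtain ⟨n, hn, h⟩ := exists_norm_genEval_le a hx (y t) hη
      refine ⟨_, mem_nhdsWithin_of_mem_nhds
        (y.continuous.continuousAt.preimage_mem_nhds (Metric.ball_mem_nhds (y t) hη)),
        n, hn, fun α hα hk s hs => ?_⟩
      have h1 : ‖y s - y t‖ < (c - ‖genEval (basePt x a k) (y t)‖) / 2 := by
        rw [mem_preimage, mem_ball_iff_norm] at hs
        exact hs
      have h2 := norm_genEval_le ⟨α, hk⟩ (y s - y t)
      rw [map_sub] at h2
      have h3 := h α hα hk
      have h4 := norm_le_norm_add_norm_sub' (genEval ⟨α, hk⟩ (y s)) (genEval ⟨α, hk⟩ (y t))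
      linarith)
  simpa using this

end Filtration

end

noncomputable section

/-! ### Contractible approximation -/

section Approximation

variable {A : Type u} [NonUnitalCStarAlgebra A] {r : ℕ → ℝ}

/-- In an algebra which is approximated by contractible subalgebras, a dense sequence can be
contracted, up to a small perturbation, along paths of functions generated by the coordinates, in
such a way that finitely many upper norm bounds are preserved. -/
theorem exists_gen_path_contraction
    (h : ∀ (F : Finset A) (ε : ℝ), 0 < ε →
      ∃ (B : Type u) (_ : NonUnitalCStarAlgebra B) (ι : B →⋆ₙₐ[ℂ] A),
        Function.Injective ι ∧ EpsContained ε ↑F (Set.range ι) ∧ Contractible B)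
    {T : Set (BddSeq A r)} (a : T) (ha : DenseRange a.1.1) (hr : ∀ i, r i = ‖a.1.1 i‖ + 1)
    {N : Set (ℕ → A)} (hN : N ∈ 𝓝 a.1.1) (m : ℕ) (p : ℕ → gen (univ : Set (BddSeq A r)))
    (c : ℕ → ℝ) (hp : ∀ j < m, ‖genEval ⟨a.1, mem_univ _⟩ (p j)‖ < c j) :
    ∃ (M : ℕ) (y : ℕ → C(unitInterval, gen T)) (γ : unitInterval → BddSeq A r),
      (∀ i ≥ M, y i = 0) ∧ (∀ i, y i 1 = 0) ∧ (∀ t i, (γ t).1 i = genEval a (y i t)) ∧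
      (∀ t i, ‖genEval a (y i t)‖ < r i) ∧ (γ 0).1 ∈ N ∧
      ∀ j < m, ∀ t, ‖genEval ⟨γ t, mem_univ _⟩ (p j)‖ < c j := by
  have hr0 (i : ℕ) : 0 < r i := by
    rw [hr]
    positivity
  have hOpen : IsOpen {α : BddSeq A r | ∀ j ∈ Finset.range m,
      ‖genEval ⟨α, mem_univ α⟩ (p j)‖ < c j} := by
    simp only [ofPred_forall]
    refine isOpen_biInter_finset fun j _ => isOpen_lt (Continuous.norm ?_) continuous_const
    exact (p j).1.continuous.comp (continuous_id.subtype_mk _)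
  obtain ⟨O, hO, hO'⟩ := isOpen_induced_iff.1 hOpen
  have hO' (α : BddSeq A r) :
      α.1 ∈ O ↔ ∀ j ∈ Finset.range m, ‖genEval ⟨α, mem_univ α⟩ (p j)‖ < c j := by
    change α ∈ Subtype.val ⁻¹' O ↔ _
    rw [hO']
    rfl
  have haO : a.1.1 ∈ O := (hO' a.1).2 fun j hj => hp j (Finset.mem_range.1 hj)
  obtain ⟨M, β, hβ1, ⟨hβN, hβO⟩, hβr, hβ⟩ :=
    exists_path h a.1.1 hr (inter_mem (interior_mem_nhds.2 hN) (hO.mem_nhds haO))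
  let α (t : unitInterval) : (univ : Set (BddSeq A r)) :=
    ⟨⟨zeroExt (β t), norm_zeroExt_le (fun i => (hr0 i).le) fun i => (hβr t i).le⟩, mem_univ _⟩
  let U : Set (Fin M → A) := {u | ∀ i, ‖u i‖ < r i} ∩ zeroExt ⁻¹' O
  have hU : IsOpen U := by
    refine IsOpen.inter ?_ (hO.preimage continuous_zeroExt)
    simp only [ofPred_forall]
    exact isOpen_iInter_of_finite fun i => isOpen_lt (continuous_apply i).norm continuous_const
  have hβU : range β ⊆ U := by
    rintro _ ⟨t, rfl⟩
    refine ⟨hβr t, (hO' (α t).1).2 fun j hj => ?_⟩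
    exact (hβ univ α (fun _ _ => rfl) (p j) t).trans_lt ((hO' (α 0).1).1 hβO j hj)
  obtain ⟨δ, hδ, hδU⟩ := (isCompact_range β.continuous).exists_thickening_subset_open hU hβU
  obtain ⟨δ', hδ', hδN⟩ := Metric.mem_nhds_iff.1
    (continuous_zeroExt.continuousAt.preimage_mem_nhds (isOpen_interior.mem_nhds hβN))
  have key (i : Fin M) := exists_gen_path a ha
    ⟨fun t => β t i, (continuous_apply i).comp β.continuous⟩ (congrFun hβ1 i) (lt_min hδ hδ')
  choose y hy1 hy using key
  have hdist (t) : dist (fun i => genEval a (y i t)) (β t) < min δ δ' :=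
    (dist_pi_lt_iff (lt_min hδ hδ')).2 fun i => by
      rw [dist_eq_norm]
      exact hy i t
  have hyU (t) : (fun i => genEval a (y i t)) ∈ U :=
    hδU (Metric.mem_thickening_iff.2 ⟨β t, mem_range_self t, (hdist t).trans_le (min_le_left _ _)⟩)
  have hext (t i) : zeroExt (fun i => genEval a (y i t)) i =
      genEval a ((if h : i < M then y ⟨i, h⟩ else 0) t) := by
    unfold zeroExt
    split <;> simp
  let γ (t : unitInterval) : BddSeq A r := ⟨zeroExt fun i => genEval a (y i t),
    norm_zeroExt_le (fun i => (hr0 i).le) fun i => ((hyU t).1 i).le⟩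
  refine ⟨M, fun i => if h : i < M then y ⟨i, h⟩ else 0, γ, fun i hi => dif_neg (by omega),
    fun i => ?_, hext, fun t i => ?_, interior_subset (hδN ((hdist 0).trans_le (min_le_right _ _))),
    fun j hj t => (hO' (γ t)).1 (hyU t).2 j (Finset.mem_range.2 hj)⟩
  · dsimp only
    split
    · exact hy1 _
    · rfl
  · dsimp only
    split
    · exact (hyU t).1 _
    · simpa using hr0 i

theorem exists_nhds_norm_genEval_sub_lt {T : Set (BddSeq A r)} (a : T) (S : Finset (gen T))
    {ε : ℝ} (hε : 0 < ε) :
    ∃ N ∈ 𝓝 a.1.1, ∀ α : T, α.1.1 ∈ N → ∀ y ∈ S, ‖genEval α y - genEval a y‖ < ε := by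
  have hS : ∀ᶠ α in 𝓝 a, ∀ y ∈ S, ‖genEval α y - genEval a y‖ < ε := by
    refine (Filter.eventually_all_finset S).2 fun y _ => ?_
    have h1 : ContinuousAt (fun α : T => ‖y.1 α - y.1 a‖) a :=
      (y.1.continuous.continuousAt.sub continuousAt_const).norm
    exact h1.eventually_lt_const (by simpa using hε)
  have hi : IsInducing fun α : T => α.1.1 := IsInducing.subtypeVal.comp IsInducing.subtypeVal
  rw [hi.nhds_eq_comap, eventually_comap] at hS
  exact ⟨_, hS, fun α hα => hα α rfl⟩

theorem exists_null_path_hom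
    (h : ∀ (F : Finset A) (ε : ℝ), 0 < ε →
      ∃ (B : Type u) (_ : NonUnitalCStarAlgebra B) (ι : B →⋆ₙₐ[ℂ] A),
        Function.Injective ι ∧ EpsContained ε ↑F (Set.range ι) ∧ Contractible B)
    (a : BddSeq A r) (ha : DenseRange a.1) (hr : ∀ i, r i = ‖a.1 i‖ + 1)
    {x : ℕ → gen (univ : Set (BddSeq A r))} (hx : DenseRange x) (m : ℕ)
    (S : Finset (gen (nearSet x a m))) {ε : ℝ} (hε : 0 < ε) :
    ∃ (n : ℕ) (Ψ : gen (nearSet x a m) →⋆ₙₐ[ℂ] C(unitInterval, gen (nearSet x a n))),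
      (∀ z, Ψ z 1 = 0) ∧ ∀ z ∈ S,
        ‖genEval (basePt x a n) (Ψ z 0) - genEval (basePt x a m) z‖ ≤ ε ∧
        ‖Ψ z 0‖ ≤ ‖genEval (basePt x a m) z‖ + ε := by
  have hr0 (i : ℕ) : 0 < r i := by
    rw [hr]
    positivity
  obtain ⟨N, hN, hNS⟩ := exists_nhds_norm_genEval_sub_lt (basePt x a m) S (half_pos hε)
  have hc (j : ℕ) (_ : j < m) : ‖genEval ⟨a, mem_univ a⟩ (x j)‖ <
      ‖genEval ⟨a, mem_univ a⟩ (x j)‖ + 1 / ((m : ℝ) + 1) :=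
    lt_add_of_pos_right _ (by positivity)
  obtain ⟨M, y, γ, hyM, hy1, hγ, hyr, hγN, hγx⟩ := exists_gen_path_contraction h
    (basePt x a 0) ha hr hN m x _ hc
  choose n₁ _ hn₁ using fun i => exists_path_norm_genEval_lt a hx (y i) (fun t => hyr t i)
  let n₂ := (Finset.range M).sup n₁
  have h0 {n : ℕ} : nearSet x a n ⊆ nearSet x a 0 := nearSet_anti x a n.zero_le
  let ζ (n : ℕ) (hn : n₂ ≤ n) (t : unitInterval) (α : nearSet x a n) : BddSeq A r :=
    ⟨fun i => genEval ⟨α.1, h0 α.2⟩ (y i t), fun i => by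
      by_cases hi : i < M
      · exact (hn₁ i α (nearSet_anti x a
          ((Finset.le_sup (Finset.mem_range.2 hi)).trans hn) α.2) _ t).le
      · simpa [hyM i (not_lt.1 hi)] using (hr0 i).le⟩
  have hζa (n : ℕ) (hn : n₂ ≤ n) (t) : ζ n hn t (basePt x a n) = γ t :=
    Subtype.ext (funext fun i => (hγ t i).symm)
  obtain ⟨Θ, hΘ⟩ := exists_pullback (T := univ)
    (fun i => restrictPath (h0 (n := n₂)) (y i)) (fun t α => ⟨ζ n₂ le_rfl t α, mem_univ _⟩)
    (fun i t α => (genEval_restrictPath _ _ _ _).symm)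
  have hΘx (j : Fin m) := exists_path_norm_genEval_lt a hx (Θ (x j)) (fun t => by
    rw [hΘ]
    simp only [hζa]
    exact hγx j j.2 t)
  choose n₃ _ hn₃ using hΘx
  let n₄ := max n₂ (Finset.univ.sup n₃)
  have hζm (n : ℕ) (hn : n₄ ≤ n) (t) (α : nearSet x a n) :
      ζ n ((le_max_left _ _).trans hn) t α ∈ nearSet x a m := fun j hj => by
    have := hn₃ ⟨j, hj⟩ α (nearSet_anti x a
      ((Finset.le_sup (Finset.mem_univ _)).trans ((le_max_right _ _).trans hn)) α.2)
      (nearSet_anti x a ((le_max_left _ _).trans hn) α.2) t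
    rw [hΘ] at this
    exact this.le
  have hΨ (n : ℕ) (hn : n₄ ≤ n) := exists_pullback (fun i => restrictPath (h0 (n := n)) (y i))
    (fun t α => ⟨_, hζm n hn t α⟩) (fun i t α => (genEval_restrictPath _ _ _ _).symm)
  choose Ψ hΨ using hΨ
  have hclose (n : ℕ) (hn : n₄ ≤ n) (z) (hz : z ∈ S) :
      ‖genEval (basePt x a n) (Ψ n hn z 0) - genEval (basePt x a m) z‖ < ε / 2 := by
    rw [hΨ]
    refine hNS ⟨_, hζm n hn 0 (basePt x a n)⟩ ?_ z hz
    change (ζ n ((le_max_left _ _).trans hn) 0 (basePt x a n)).1 ∈ N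
    rwa [hζa n ((le_max_left _ _).trans hn)]
  choose n₅ _ hn₅ using fun z => exists_norm_genEval_le a hx (Ψ n₄ le_rfl z 0) (half_pos hε)
  let n := max n₄ (S.sup n₅)
  have hn : n₄ ≤ n := le_max_left _ _
  refine ⟨n, Ψ n hn, fun z => gen_ext fun α => ?_,
    fun z hz => ⟨((hclose n hn z hz).trans (half_lt_self hε)).le, ?_⟩⟩
  · rw [hΨ, genEval_eq_zero, map_zero]
    intro i
    change genEval _ (y i 1) = 0
    rw [hy1, map_zero]
  · refine (BoundedContinuousFunction.norm_le (by positivity)).2 fun α => ?_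
    have h1 := hn₅ z α (nearSet_anti x a ((Finset.le_sup hz).trans (le_max_right _ _)) α.2)
      (nearSet_anti x a hn α.2)
    have h2 : genEval α (Ψ n hn z 0) =
        genEval ⟨α.1, nearSet_anti x a hn α.2⟩ (Ψ n₄ le_rfl z 0) := by
      rw [hΨ, hΨ]
    have h3 := hclose n₄ le_rfl z hz
    have h4 := norm_le_norm_add_norm_sub' (genEval (basePt x a n₄) (Ψ n₄ le_rfl z 0))
      (genEval (basePt x a m) z)
    change ‖genEval α (Ψ n hn z 0)‖ ≤ _
    rw [h2]
    linarith

/-- Finitely many elements can be sent to a cone over a later algebra in such a way that their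
values at the base point are almost preserved and their norms are almost those of the values. -/
theorem exists_cone_hom
    (h : ∀ (F : Finset A) (ε : ℝ), 0 < ε →
      ∃ (B : Type u) (_ : NonUnitalCStarAlgebra B) (ι : B →⋆ₙₐ[ℂ] A),
        Function.Injective ι ∧ EpsContained ε ↑F (Set.range ι) ∧ Contractible B)
    (a : BddSeq A r) (ha : DenseRange a.1) (hr : ∀ i, r i = ‖a.1 i‖ + 1)
    {x : ℕ → gen (univ : Set (BddSeq A r))} (hx : DenseRange x) (m : ℕ)
    (S : Finset (gen (nearSet x a m))) {ε : ℝ} (hε : 0 < ε) :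
    ∃ (n : ℕ) (θ : gen (nearSet x a m) →⋆ₙₐ[ℂ] cone (gen (nearSet x a n))), ∀ y ∈ S,
      ‖genEval (basePt x a n) (coneEval _ (θ y)) - genEval (basePt x a m) y‖ ≤ ε ∧
      ‖coneEval _ (θ y)‖ ≤ ‖genEval (basePt x a m) y‖ + ε :=
  (exists_null_path_hom h a ha hr hx m S hε).imp fun n hn =>
    hn.elim fun Ψ hΨ => ⟨NonUnitalStarAlgHom.codRestrict Ψ (cone (gen (nearSet x a n))) hΨ.1, hΨ.2⟩

end Approximation

end

open TopologicalSpace in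
/-- Contractible-like C*-algebras are inductive limits of contractibles: if a separable
C*-algebra `A` is approximated by contractible sub-C*-algebras, then `A` is an inductive
limit of contractible C*-algebras. -/
theorem contractibleLike_implies_limit_of_contractibles
    (A : Type u) [NonUnitalCStarAlgebra A] [SeparableSpace A]
    (h : ∀ (F : Finset A) (ε : ℝ), 0 < ε →
      ∃ (B : Type u) (_ : NonUnitalCStarAlgebra B) (ι : B →⋆ₙₐ[ℂ] A),
        Function.Injective ι ∧ EpsContained ε ↑F (Set.range ι) ∧ Contractible B) :
    ∃ (S : CStarInductiveSystem.{u}) (ν : ∀ k, S.X k →⋆ₙₐ[ℂ] A),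
      IsInductiveLimit S.conn A ν ∧ ∀ k, Contractible (S.X k) := by
  let a₀ := denseSeq A
  let a : BddSeq A (fun i => ‖a₀ i‖ + 1) := ⟨a₀, fun i => by linarith⟩
  have ha : DenseRange a₀ := denseRange_denseSeq A
  obtain ⟨x, hx⟩ := exists_dense_seq (gen (univ : Set (BddSeq A (fun i => ‖a₀ i‖ + 1))))
  refine exists_isInductiveLimit_cones (P := fun m => gen (nearSet x a m))
    (fun m => genEval (basePt x a m)) (fun m j => genRestrict (subset_univ _) (x j))
    (fun m => (denseRange_genRestrict _).comp hx (continuous_starAlgHom _))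
    (fun j => genEval ⟨a, mem_univ a⟩ (x j)) ?_ (fun m j => genEval_genRestrict _ _ _)
    (fun m S ε hε => exists_cone_hom h a ha (fun _ => rfl) hx m S hε)
  have hs : DenseRange (genEval (⟨a, mem_univ a⟩ : (univ : Set (BddSeq A _)))) :=
    ha.mono (range_subset_iff.2 fun i => ⟨genCoord univ i, rfl⟩)
  exact hs.comp hx (continuous_genEval _)
end
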